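/- Let n ≥ 3 and let K ∈ C^1(B_1) be a positive function with |∇K(x)| = O(|x|^{β−1}) near the origin for some β > 1. Let ξ be a positive periodic solution of (F). Then there exist constants 0 < R < 1, C > 0 and a positive solution u of (E) in B_R \ {0} such that for all x ∈ B_R \ {0}: |u(x) − |x|^{−(n−2)/2} ξ(−ln|x|)| ≤ C |x|^{β−(n−2)/2} if β ∉ {ρ_i}_{i≥1}, and |u(x) − |x|^{−(n−2)/2} ξ(−ln|x|)| ≤ C |x|^{β−(n−2)/2}(−ln|x|) if β ∈ {ρ_i}_{i≥1}. -/

import Mathlib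

open Real Set Metric Filter Function

noncomputable section

/-- The Euclidean Laplacian of `f` at `x`. -/
def lapE {n : ℕ} (f : EuclideanSpace ℝ (Fin n) → ℝ) (x : EuclideanSpace ℝ (Fin n)) : ℝ :=
  ∑ i : Fin n, iteratedFDeriv ℝ 2 f x ![EuclideanSpace.single i 1, EuclideanSpace.single i 1]

/-- The Laplace–Beltrami operator `Δ_θ` on the unit sphere `S^{n-1}`, computed via the
degree-zero homogeneous extension: for `θ` with `‖θ‖ = 1`, `sphLap f θ = Δ_θ f (θ)`. -/
def sphLap {n : ℕ} (f : EuclideanSpace ℝ (Fin n) → ℝ) (θ : EuclideanSpace ℝ (Fin n)) : ℝ :=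
  lapE (fun x => f (‖x‖⁻¹ • x)) θ

/-- Second derivative in the `t` variable. -/
def dtt (g : ℝ → ℝ) : ℝ → ℝ := deriv (deriv g)

/-- Dimension of the space of spherical harmonics on `S^{n-1}` of degree at most `d`. -/
def cumHarm (n d : ℕ) : ℕ := Nat.choose (n - 1 + d) (n - 1) + Nat.choose (n - 2 + d) (n - 1)

/-- The degree of the `i`-th spherical harmonic, eigenfunctions being listed with multiplicity. -/
def sphDeg (n i : ℕ) : ℕ := sInf {d | i < cumHarm n d}

/-- The `i`-th eigenvalue `λ_i` of `-Δ_θ` on `S^{n-1}`, listed in increasing order and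
repeated with multiplicity: `λ_i = d (n + d - 2)` where `d` is the degree of the `i`-th
spherical harmonic.  In particular `λ_0 = 0`, `λ_1 = ⋯ = λ_n = n - 1`, `λ_{n+1} = 2n`. -/
def sphEval (n i : ℕ) : ℝ := (sphDeg n i : ℝ) * ((n : ℝ) + (sphDeg n i : ℝ) - 2)

/-- The linearized operator `L_i = -d²/dt² + λ + (n-2)²/4 - ((n+2)/(n-2)) K(0) ξ^{4/(n-2)}`. -/
def Lop (n : ℕ) (K0 : ℝ) (ξ : ℝ → ℝ) (lam : ℝ) (h : ℝ → ℝ) : ℝ → ℝ :=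
  fun t => -dtt h t
    + (lam + ((n : ℝ) - 2) ^ 2 / 4
        - ((n : ℝ) + 2) / ((n : ℝ) - 2) * K0 * ξ t ^ ((4 : ℝ) / ((n : ℝ) - 2))) * h t

/-- The linearized operator `𝓛_i = -d²/dt² + λ + (n-2a-2)²/4 - (p-1) ζ^{p-2}` for the
Caffarelli-Kohn-Nirenberg equation. -/
def LopCKN (n : ℕ) (a p : ℝ) (ζ : ℝ → ℝ) (lam : ℝ) (h : ℝ → ℝ) : ℝ → ℝ :=
  fun t => -dtt h t + (lam + ((n : ℝ) - 2 * a - 2) ^ 2 / 4 - (p - 1) * ζ t ^ (p - 2)) * h t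

/-- `f, g` is a basis of the kernel of the second-order ODE operator `L` acting on `C²(ℝ)`. -/
def KerBasis (L : (ℝ → ℝ) → ℝ → ℝ) (f g : ℝ → ℝ) : Prop :=
  ContDiff ℝ 2 f ∧ ContDiff ℝ 2 g ∧ (∀ t, L f t = 0) ∧ (∀ t, L g t = 0) ∧
    LinearIndependent ℝ ![f, g] ∧
    ∀ h : ℝ → ℝ, ContDiff ℝ 2 h → (∀ t, L h t = 0) →
      ∃ c₁ c₂ : ℝ, ∀ t, h t = c₁ * f t + c₂ * g t

/-- `ξ` is a positive `T`-periodic solution of the Fowler equation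
`-ξ'' + ((n-2)²/4) ξ = K(0) ξ^{(n+2)/(n-2)}` on `ℝ`. -/
def FowlerXi (n : ℕ) (K0 : ℝ) (ξ : ℝ → ℝ) (T : ℝ) : Prop :=
  ContDiff ℝ 2 ξ ∧ (∀ t, 0 < ξ t) ∧ 0 < T ∧ Function.Periodic ξ T ∧
    ∀ t, -dtt ξ t + ((n : ℝ) - 2) ^ 2 / 4 * ξ t = K0 * ξ t ^ (((n : ℝ) + 2) / ((n : ℝ) - 2))

/-- `ζ` is a positive `T`-periodic solution of `-ζ'' + ((n-2a-2)²/4) ζ = ζ^{p-1}` on `ℝ`. -/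
def ZetaSol (n : ℕ) (a p : ℝ) (ζ : ℝ → ℝ) (T : ℝ) : Prop :=
  ContDiff ℝ 2 ζ ∧ (∀ t, 0 < ζ t) ∧ 0 < T ∧ Function.Periodic ζ T ∧
    ∀ t, -dtt ζ t + ((n : ℝ) - 2 * a - 2) ^ 2 / 4 * ζ t = ζ t ^ (p - 1)

/-- `ρ` is the increasing, divergent sequence of positive exponents such that, for every
`i ≥ 1`, the kernel of the linearized operator `L_i` at the Fowler solution `ξ` has a basis
`e^{-ρ_i t} p_i⁺(t)`, `e^{ρ_i t} p_i⁻(t)` with `p_i^±` smooth and `T`-periodic. -/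
def FowlerExponents (n : ℕ) (K0 : ℝ) (ξ : ℝ → ℝ) (T : ℝ) (ρ : ℕ → ℝ) : Prop :=
  (∀ i, 1 ≤ i → 0 < ρ i) ∧ (∀ i j, 1 ≤ i → i ≤ j → ρ i ≤ ρ j) ∧
    Tendsto ρ atTop atTop ∧
    ∀ i, 1 ≤ i → ∃ p₁ p₂ : ℝ → ℝ, ContDiff ℝ (⊤ : ℕ∞) p₁ ∧ ContDiff ℝ (⊤ : ℕ∞) p₂ ∧
      Function.Periodic p₁ T ∧ Function.Periodic p₂ T ∧
      KerBasis (Lop n K0 ξ (sphEval n i))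
        (fun t => Real.exp (-(ρ i) * t) * p₁ t) (fun t => Real.exp (ρ i * t) * p₂ t)

/-- Analogue of `FowlerExponents` for the CKN linearized operators `𝓛_i`. -/
def CKNExponents (n : ℕ) (a p : ℝ) (ζ : ℝ → ℝ) (T : ℝ) (σ : ℕ → ℝ) : Prop :=
  (∀ i, 1 ≤ i → 0 < σ i) ∧ (∀ i j, 1 ≤ i → i ≤ j → σ i ≤ σ j) ∧
    Tendsto σ atTop atTop ∧
    ∀ i, 1 ≤ i → ∃ q₁ q₂ : ℝ → ℝ, ContDiff ℝ (⊤ : ℕ∞) q₁ ∧ ContDiff ℝ (⊤ : ℕ∞) q₂ ∧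
      Function.Periodic q₁ T ∧ Function.Periodic q₂ T ∧
      KerBasis (LopCKN n a p ζ (sphEval n i))
        (fun t => Real.exp (-(σ i) * t) * q₁ t) (fun t => Real.exp (σ i * t) * q₂ t)

/-- The index set `{ Σ_{i≥1} nᵢ ρᵢ > 0 : nᵢ ∈ ℕ, finitely many nᵢ > 0 }`. -/
def IndexSet (ρ : ℕ → ℝ) : Set ℝ :=
  {s | 0 < s ∧ ∃ f : ℕ →₀ ℕ, (∀ i ∈ f.support, 1 ≤ i) ∧
    s = ∑ i ∈ f.support, (f i : ℝ) * ρ i}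

/-- `v` is a positive solution on `(t₀, ∞) × S^{n-1}` of the cylindrical conformal scalar
curvature equation `-v_tt - Δ_θ v + ((n-2)²/4) v = K(e^{-t}θ) v^{(n+2)/(n-2)}`. -/
def SolCyl (n : ℕ) (K : EuclideanSpace ℝ (Fin n) → ℝ)
    (v : ℝ → EuclideanSpace ℝ (Fin n) → ℝ) (t₀ : ℝ) : Prop :=
  (∀ t θ, t₀ < t → ‖θ‖ = 1 → 0 < v t θ) ∧
    ∀ (t : ℝ) (θ : EuclideanSpace ℝ (Fin n)), t₀ < t → ‖θ‖ = 1 →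
      -dtt (fun s => v s θ) t - sphLap (v t) θ + ((n : ℝ) - 2) ^ 2 / 4 * v t θ
        = K (Real.exp (-t) • θ) * v t θ ^ (((n : ℝ) + 2) / ((n : ℝ) - 2))

/-- `w` is a positive solution on `(t₀, ∞) × S^{n-1}` of the cylindrical CKN equation
`-w_tt - Δ_θ w + ((n-2a-2)²/4) w = w^{p-1}`. -/
def SolCylW (n : ℕ) (a p : ℝ) (w : ℝ → EuclideanSpace ℝ (Fin n) → ℝ) (t₀ : ℝ) : Prop :=
  (∀ t θ, t₀ < t → ‖θ‖ = 1 → 0 < w t θ) ∧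
    ∀ (t : ℝ) (θ : EuclideanSpace ℝ (Fin n)), t₀ < t → ‖θ‖ = 1 →
      -dtt (fun s => w s θ) t - sphLap (w t) θ + ((n : ℝ) - 2 * a - 2) ^ 2 / 4 * w t θ
        = w t θ ^ (p - 1)

/-- `v(t, θ) → ξ(t)` as `t → ∞`, uniformly for `θ ∈ S^{n-1}`. -/
def UnifConv {n : ℕ} (v : ℝ → EuclideanSpace ℝ (Fin n) → ℝ) (ξ : ℝ → ℝ) : Prop :=
  ∀ ε > 0, ∃ T : ℝ, ∀ t ≥ T, ∀ θ : EuclideanSpace ℝ (Fin n), ‖θ‖ = 1 → |v t θ - ξ t| < ε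

/-- The degree-zero homogeneous (in the sphere variable) representative of a function on the
cylinder `ℝ × S^{n-1}`. -/
def cylRep {n : ℕ} (F : ℝ → EuclideanSpace ℝ (Fin n) → ℝ) :
    ℝ × EuclideanSpace ℝ (Fin n) → ℝ :=
  fun pt => F pt.1 (‖pt.2‖⁻¹ • pt.2)

/-- The norm of the intrinsic gradient on the cylinder `ℝ × S^{n-1}` at `(t, θ)`. -/
def cylGrad {n : ℕ} (F : ℝ → EuclideanSpace ℝ (Fin n) → ℝ) (t : ℝ)
    (θ : EuclideanSpace ℝ (Fin n)) : ℝ :=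
  ‖fderiv ℝ (cylRep F) (t, θ)‖

/-- Membership in `C^{2,α}` of a region `s` of the cylinder. -/
def CylC2Holder {n : ℕ} (α : ℝ) (s : Set (ℝ × EuclideanSpace ℝ (Fin n)))
    (F : ℝ → EuclideanSpace ℝ (Fin n) → ℝ) : Prop :=
  ContDiffOn ℝ 2 (cylRep F) s ∧
    ∃ C : ℝ, ∀ p ∈ s, ∀ q ∈ s,
      ‖iteratedFDerivWithin ℝ 2 (cylRep F) s p - iteratedFDerivWithin ℝ 2 (cylRep F) s q‖
        ≤ C * ‖p - q‖ ^ α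

/-- A bounded smooth function on `(t₀, ∞) × S^{n-1}`. -/
def BddSmoothCyl {n : ℕ} (t₀ : ℝ) (c : ℝ → EuclideanSpace ℝ (Fin n) → ℝ) : Prop :=
  ContDiffOn ℝ (⊤ : ℕ∞) (cylRep c)
      ((Ioi t₀) ×ˢ {x : EuclideanSpace ℝ (Fin n) | x ≠ 0}) ∧
    ∃ M : ℝ, ∀ t θ, t₀ < t → ‖θ‖ = 1 → |c t θ| ≤ M

/-- The nonlinear operator `𝓜(f) = -f_tt - Δ_θ f + ((n-2)²/4) f - K f^{(n+2)/(n-2)}`. -/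
def Mop (n : ℕ) (K : EuclideanSpace ℝ (Fin n) → ℝ)
    (f : ℝ → EuclideanSpace ℝ (Fin n) → ℝ) (t : ℝ) (θ : EuclideanSpace ℝ (Fin n)) : ℝ :=
  -dtt (fun s => f s θ) t - sphLap (f t) θ + ((n : ℝ) - 2) ^ 2 / 4 * f t θ
    - K (Real.exp (-t) • θ) * f t θ ^ (((n : ℝ) + 2) / ((n : ℝ) - 2))

/-- The nonlinear operator `𝓝(f) = -f_tt - Δ_θ f + ((n-2a-2)²/4) f - f^{p-1}`. -/
def Nop (n : ℕ) (a p : ℝ)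
    (f : ℝ → EuclideanSpace ℝ (Fin n) → ℝ) (t : ℝ) (θ : EuclideanSpace ℝ (Fin n)) : ℝ :=
  -dtt (fun s => f s θ) t - sphLap (f t) θ + ((n : ℝ) - 2 * a - 2) ^ 2 / 4 * f t θ
    - f t θ ^ (p - 1)

/-- partial derivative -/
def pd {n : ℕ} (i : Fin n) (f : EuclideanSpace ℝ (Fin n) → ℝ) (x : EuclideanSpace ℝ (Fin n)) : ℝ :=
  fderiv ℝ f x (EuclideanSpace.single i 1)

lemma lapE_eq_pd {n : ℕ} {f : EuclideanSpace ℝ (Fin n) → ℝ} {x : EuclideanSpace ℝ (Fin n)}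
    (hf : ContDiffAt ℝ 2 f x) : lapE f x = ∑ i, pd i (pd i f) x := by
  unfold lapE
  refine Finset.sum_congr rfl fun i _ => ?_
  rw [iteratedFDeriv_two_apply]
  have h1 : DifferentiableAt ℝ (fderiv ℝ f) x :=
    (hf.fderiv_right (m := 1) (by norm_num)).differentiableAt (by norm_num)
  unfold pd
  rw [fderiv_clm_apply h1 (differentiableAt_const _)]
  simp

lemma lapE_congr {n : ℕ} {f g : EuclideanSpace ℝ (Fin n) → ℝ} {x : EuclideanSpace ℝ (Fin n)}
    (h : f =ᶠ[nhds x] g) : lapE f x = lapE g x := by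
  unfold lapE
  rw [Filter.EventuallyEq.eq_of_nhds (Filter.EventuallyEq.iteratedFDeriv ℝ h 2)]

lemma lapE_add {n : ℕ} {f g : EuclideanSpace ℝ (Fin n) → ℝ} {x : EuclideanSpace ℝ (Fin n)}
    (hf : ContDiffAt ℝ 2 f x) (hg : ContDiffAt ℝ 2 g x) :
    lapE (fun y => f y + g y) x = lapE f x + lapE g x := by
  unfold lapE
  rw [← Finset.sum_add_distrib]
  refine Finset.sum_congr rfl fun i _ => ?_
  have : (fun y => f y + g y) = f + g := rfl
  rw [this, iteratedFDeriv_add_apply hf hg]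
  simp

lemma lapE_const_mul {n : ℕ} {f : EuclideanSpace ℝ (Fin n) → ℝ} {x : EuclideanSpace ℝ (Fin n)}
    (c : ℝ) (hf : ContDiffAt ℝ 2 f x) :
    lapE (fun y => c * f y) x = c * lapE f x := by
  unfold lapE
  rw [Finset.mul_sum]
  refine Finset.sum_congr rfl fun i _ => ?_
  have : (fun y => c * f y) = c • f := rfl
  rw [this, iteratedFDeriv_const_smul_apply hf]
  simp

lemma lapE_sum {n : ℕ} {ι : Type*} (s : Finset ι) {f : ι → EuclideanSpace ℝ (Fin n) → ℝ}
    {x : EuclideanSpace ℝ (Fin n)}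
    (hf : ∀ i ∈ s, ContDiffAt ℝ 2 (f i) x) :
    lapE (fun y => ∑ i ∈ s, f i y) x = ∑ i ∈ s, lapE (f i) x := by
  classical
  induction s using Finset.induction_on with
  | empty => simp [lapE]
  | insert a s ha ih =>
    simp only [Finset.sum_insert ha]
    rw [lapE_add (hf a (by simp)) (ContDiffAt.sum fun i hi => hf i (by simp [hi])),
      ih fun i hi => hf i (by simp [hi])]

lemma pd_mul {n : ℕ} (i : Fin n) {f g : EuclideanSpace ℝ (Fin n) → ℝ} {x : EuclideanSpace ℝ (Fin n)}
    (hf : DifferentiableAt ℝ f x) (hg : DifferentiableAt ℝ g x) :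
    pd i (fun y => f y * g y) x = pd i f x * g x + f x * pd i g x := by
  unfold pd
  have : (fun y => f y * g y) = f * g := rfl
  rw [this, fderiv_mul hf hg]
  simp; ring

lemma pd_differentiableAt {n : ℕ} (i : Fin n) {f : EuclideanSpace ℝ (Fin n) → ℝ}
    {x : EuclideanSpace ℝ (Fin n)}
    (hf : ContDiffAt ℝ 2 f x) : DifferentiableAt ℝ (pd i f) x := by
  have h1 : DifferentiableAt ℝ (fderiv ℝ f) x :=
    (hf.fderiv_right (m := 1) (by norm_num)).differentiableAt (by norm_num)
  unfold pd
  fun_prop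

lemma pd_congr {n : ℕ} (i : Fin n) {f g : EuclideanSpace ℝ (Fin n) → ℝ} {x : EuclideanSpace ℝ (Fin n)}
    (h : f =ᶠ[nhds x] g) : pd i f x = pd i g x := by
  unfold pd; rw [h.fderiv_eq]

lemma lapE_mul {n : ℕ} {f g : EuclideanSpace ℝ (Fin n) → ℝ} {x : EuclideanSpace ℝ (Fin n)}
    (hf : ContDiffAt ℝ 2 f x) (hg : ContDiffAt ℝ 2 g x) :
    lapE (fun y => f y * g y) x
      = lapE f x * g x + 2 * ∑ i, pd i f x * pd i g x + f x * lapE g x := by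
  rw [lapE_eq_pd hf, lapE_eq_pd hg, lapE_eq_pd (hf.mul hg), Finset.sum_mul, Finset.mul_sum,
    Finset.mul_sum, ← Finset.sum_add_distrib, ← Finset.sum_add_distrib]
  refine Finset.sum_congr rfl fun i _ => ?_
  have hev : pd i (fun y => f y * g y) =ᶠ[nhds x] fun y => pd i f y * g y + f y * pd i g y := by
    filter_upwards [hf.eventually (by simp), hg.eventually (by simp)] with y h1 h2
    exact pd_mul i (h1.differentiableAt (by norm_num)) (h2.differentiableAt (by norm_num))
  rw [pd_congr i hev]
  have d1 := pd_differentiableAt i hf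
  have d2 := pd_differentiableAt i hg
  have d3 := hf.differentiableAt (by norm_num)
  have d4 := hg.differentiableAt (by norm_num)
  have : pd i (fun y => pd i f y * g y + f y * pd i g y) x
      = pd i (fun y => pd i f y * g y) x + pd i (fun y => f y * pd i g y) x := by
    have := fderiv_fun_add (d1.mul d4) (d3.mul d2)
    exact congrArg (fun L => L (EuclideanSpace.single i (1:ℝ))) this
  rw [this, pd_mul i d1 d4, pd_mul i d3 d2]; ring

lemma hasFDerivAt_normSq {n : ℕ} (x : EuclideanSpace ℝ (Fin n)) :
    HasFDerivAt (fun y : EuclideanSpace ℝ (Fin n) => ‖y‖ ^ 2) (2 • (innerSL ℝ x)) x := by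
  simpa using (hasStrictFDerivAt_norm_sq x).hasFDerivAt

lemma hasFDerivAt_radial {n : ℕ} {A : ℝ → ℝ} {x : EuclideanSpace ℝ (Fin n)}
    (hA : DifferentiableAt ℝ A (‖x‖ ^ 2)) :
    HasFDerivAt (fun y : EuclideanSpace ℝ (Fin n) => A (‖y‖ ^ 2))
      (deriv A (‖x‖ ^ 2) • (2 • (innerSL ℝ x))) x :=
  hA.hasDerivAt.comp_hasFDerivAt x (hasFDerivAt_normSq x)

lemma pd_radial {n : ℕ} (i : Fin n) {A : ℝ → ℝ} {x : EuclideanSpace ℝ (Fin n)}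
    (hA : DifferentiableAt ℝ A (‖x‖ ^ 2)) :
    pd i (fun y : EuclideanSpace ℝ (Fin n) => A (‖y‖ ^ 2)) x = 2 * deriv A (‖x‖ ^ 2) * x i := by
  unfold pd
  rw [(hasFDerivAt_radial hA).fderiv]
  simp [EuclideanSpace.inner_single_right]; ring

lemma contDiffAt_radial {n : ℕ} {m : WithTop ℕ∞} {A : ℝ → ℝ} {x : EuclideanSpace ℝ (Fin n)}
    (hA : ContDiffAt ℝ m A (‖x‖ ^ 2)) :
    ContDiffAt ℝ m (fun y : EuclideanSpace ℝ (Fin n) => A (‖y‖ ^ 2)) x :=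
  ContDiffAt.comp x (g := A) (f := fun y : EuclideanSpace ℝ (Fin n) => ‖y‖ ^ 2) hA (contDiff_norm_sq ℝ).contDiffAt

lemma pd_coord {n : ℕ} (i j : Fin n) (x : EuclideanSpace ℝ (Fin n)) :
    pd i (fun y : EuclideanSpace ℝ (Fin n) => y j) x = if j = i then 1 else 0 := by
  unfold pd
  have : HasFDerivAt (fun y : EuclideanSpace ℝ (Fin n) => y j) (EuclideanSpace.proj (𝕜 := ℝ) j : EuclideanSpace ℝ (Fin n) →L[ℝ] ℝ) x :=
    (EuclideanSpace.proj (𝕜 := ℝ) j : EuclideanSpace ℝ (Fin n) →L[ℝ] ℝ).hasFDerivAt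
  rw [this.fderiv]
  simp [Pi.single_apply]

lemma differentiableAt_coord {n : ℕ} (j : Fin n) (x : EuclideanSpace ℝ (Fin n)) :
    DifferentiableAt ℝ (fun y : EuclideanSpace ℝ (Fin n) => y j) x :=
  (EuclideanSpace.proj (𝕜 := ℝ) j : EuclideanSpace ℝ (Fin n) →L[ℝ] ℝ).differentiableAt

lemma lapE_radial {n : ℕ} {A : ℝ → ℝ} {x : EuclideanSpace ℝ (Fin n)}
    (hA : ContDiffAt ℝ 2 A (‖x‖ ^ 2)) :
    lapE (fun y : EuclideanSpace ℝ (Fin n) => A (‖y‖ ^ 2)) x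
      = 4 * ‖x‖ ^ 2 * deriv (deriv A) (‖x‖ ^ 2) + 2 * n * deriv A (‖x‖ ^ 2) := by
  rw [lapE_eq_pd (contDiffAt_radial hA)]
  have hA1 : DifferentiableAt ℝ (deriv A) (‖x‖ ^ 2) := by
    have h2 : ContDiffAt ℝ 1 (fun q => fderiv ℝ A q 1) (‖x‖^2) :=
      (hA.fderiv_right (m := 1) (by norm_num)).clm_apply contDiffAt_const
    exact h2.differentiableAt (by norm_num)
  have key : ∀ i : Fin n, pd i (pd i (fun y : EuclideanSpace ℝ (Fin n) => A (‖y‖ ^ 2))) x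
      = 4 * deriv (deriv A) (‖x‖ ^ 2) * (x i) ^ 2 + 2 * deriv A (‖x‖ ^ 2) := by
    intro i
    have hev : pd i (fun y : EuclideanSpace ℝ (Fin n) => A (‖y‖ ^ 2)) =ᶠ[nhds x]
        fun y => (fun q => 2 * deriv A q) (‖y‖ ^ 2) * y i := by
      have hc : Tendsto (fun y : EuclideanSpace ℝ (Fin n) => ‖y‖ ^ 2) (nhds x) (nhds (‖x‖ ^ 2)) :=
        (by fun_prop : Continuous fun y : EuclideanSpace ℝ (Fin n) => ‖y‖ ^ 2).tendsto x
      filter_upwards [hc.eventually (hA.eventually (by simp))] with y hy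
      exact pd_radial i (hy.differentiableAt (by norm_num))
    rw [pd_congr i hev]
    have hB : DifferentiableAt ℝ (fun q => 2 * deriv A q) (‖x‖ ^ 2) := hA1.const_mul 2
    rw [pd_mul i (hasFDerivAt_radial hB).differentiableAt (differentiableAt_coord i x),
      pd_radial i hB, pd_coord]
    simp only [if_true]
    rw [show deriv (fun q => 2 * deriv A q) (‖x‖ ^ 2) = 2 * deriv (deriv A) (‖x‖ ^ 2) from
      deriv_const_mul _ hA1]
    ring
  simp only [key, Finset.sum_add_distrib, ← Finset.mul_sum]
  rw [← EuclideanSpace.real_norm_sq_eq]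
  simp; ring

/-- Harmonic, homogeneous of degree `k`. -/
structure HH {n : ℕ} (k : ℕ) (Y : EuclideanSpace ℝ (Fin n) → ℝ) : Prop where
  smooth : ContDiff ℝ 2 Y
  homog : ∀ (c : ℝ) x, Y (c • x) = c ^ k * Y x
  harm : ∀ x, lapE Y x = 0

lemma euler {n : ℕ} {k : ℕ} {Y : EuclideanSpace ℝ (Fin n) → ℝ} (hs : Differentiable ℝ Y)
    (h : ∀ (c : ℝ) x, Y (c • x) = c ^ k * Y x) (x : EuclideanSpace ℝ (Fin n)) :
    fderiv ℝ Y x x = k * Y x := by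
  have h1 : HasDerivAt (fun c : ℝ => Y (c • x)) (fderiv ℝ Y x x) 1 := by
    have h2 : HasDerivAt (fun c : ℝ => c • x) x 1 := by
      simpa using (hasDerivAt_id (1:ℝ)).smul_const x
    have h3 : HasFDerivAt Y (fderiv ℝ Y x) ((1:ℝ) • x) := by
      rw [one_smul]; exact (hs x).hasFDerivAt
    exact h3.comp_hasDerivAt 1 h2
  have h4 : HasDerivAt (fun c : ℝ => Y (c • x)) (k * Y x) 1 := by
    simp only [h]
    simpa using (hasDerivAt_pow k (1:ℝ)).mul_const (Y x)
  exact h1.unique h4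

lemma sum_coord_pd {n : ℕ} (Y : EuclideanSpace ℝ (Fin n) → ℝ) (x : EuclideanSpace ℝ (Fin n)) :
    ∑ i, x i * pd i Y x = fderiv ℝ Y x x := by
  unfold pd
  have hx : x = ∑ i, x i • EuclideanSpace.single i (1:ℝ) := by
    ext j
    simp [Pi.single_apply]
  conv_rhs => arg 2; rw [hx]
  simp [map_sum]

lemma lapE_radial_mul_gen {n : ℕ} {k : ℕ} {A : ℝ → ℝ} {Y : EuclideanSpace ℝ (Fin n) → ℝ}
    {x : EuclideanSpace ℝ (Fin n)}
    (hA : ContDiffAt ℝ 2 A (‖x‖ ^ 2)) (hs : ContDiff ℝ 2 Y)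
    (h : ∀ (c : ℝ) x, Y (c • x) = c ^ k * Y x) :
    lapE (fun y : EuclideanSpace ℝ (Fin n) => A (‖y‖ ^ 2) * Y y) x
      = (4 * ‖x‖ ^ 2 * deriv (deriv A) (‖x‖ ^ 2) + (2 * n + 4 * k) * deriv A (‖x‖ ^ 2)) * Y x
        + A (‖x‖ ^ 2) * lapE Y x := by
  rw [lapE_mul (contDiffAt_radial hA) hs.contDiffAt, lapE_radial hA]
  have : ∑ i, pd i (fun y : EuclideanSpace ℝ (Fin n) => A (‖y‖ ^ 2)) x * pd i Y x
      = 2 * deriv A (‖x‖ ^ 2) * (k * Y x) := by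
    rw [← euler (hs.differentiable (by norm_num)) h x, ← sum_coord_pd, Finset.mul_sum]
    refine Finset.sum_congr rfl fun i _ => ?_
    rw [pd_radial i (hA.differentiableAt (by norm_num))]; ring
  rw [this]; ring

lemma lapE_radial_mul {n : ℕ} {k : ℕ} {A : ℝ → ℝ} {Y : EuclideanSpace ℝ (Fin n) → ℝ}
    {x : EuclideanSpace ℝ (Fin n)}
    (hA : ContDiffAt ℝ 2 A (‖x‖ ^ 2)) (hY : HH k Y) :
    lapE (fun y : EuclideanSpace ℝ (Fin n) => A (‖y‖ ^ 2) * Y y) x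
      = (4 * ‖x‖ ^ 2 * deriv (deriv A) (‖x‖ ^ 2) + (2 * n + 4 * k) * deriv A (‖x‖ ^ 2)) * Y x := by
  rw [lapE_radial_mul_gen hA hY.smooth hY.homog, hY.harm]; ring

lemma lapE_normfun_mul {n : ℕ} {k : ℕ} {m : ℝ → ℝ} {Y : EuclideanSpace ℝ (Fin n) → ℝ}
    {x : EuclideanSpace ℝ (Fin n)} (hx : x ≠ 0)
    (hm : ContDiffAt ℝ 2 m ‖x‖) (hY : HH k Y) :
    ContDiffAt ℝ 2 (fun y : EuclideanSpace ℝ (Fin n) => m ‖y‖ * Y y) x ∧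
    lapE (fun y : EuclideanSpace ℝ (Fin n) => m ‖y‖ * Y y) x
      = (deriv (deriv m) ‖x‖ + ((n:ℝ) - 1 + 2 * k) / ‖x‖ * deriv m ‖x‖) * Y x := by
  have hr : 0 < ‖x‖ := norm_pos_iff.2 hx
  set r := ‖x‖ with hrdef
  set A : ℝ → ℝ := fun q => m (Real.sqrt q) with hA
  have hsq : Real.sqrt (r ^ 2) = r := Real.sqrt_sq hr.le
  have hAc : ContDiffAt ℝ 2 A (r ^ 2) := by
    apply ContDiffAt.comp (r ^ 2) (g := m) (f := Real.sqrt)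
    · rw [hsq]; exact hm
    · exact Real.contDiffAt_sqrt (by positivity)
  have hfun : (fun y : EuclideanSpace ℝ (Fin n) => m ‖y‖ * Y y)
      = fun y => A (‖y‖ ^ 2) * Y y := by
    funext y; simp [hA, Real.sqrt_sq (norm_nonneg y)]
  refine ⟨?_, ?_⟩
  · rw [hfun]; exact (contDiffAt_radial hAc).mul hY.smooth.contDiffAt
  rw [hfun, lapE_radial_mul hAc hY]
  have hev : ∀ᶠ q in nhds (r ^ 2), ContDiffAt ℝ 2 m (Real.sqrt q) := by
    have hc : Tendsto Real.sqrt (nhds (r^2)) (nhds r) := by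
      have := (Real.continuous_sqrt.tendsto (r^2)); rwa [hsq] at this
    exact hc.eventually (hm.eventually (by simp))
  have hpos : ∀ᶠ q in nhds (r ^ 2), 0 < q := lt_mem_nhds (by positivity)
  have hd : deriv A =ᶠ[nhds (r ^ 2)] fun q => deriv m (Real.sqrt q) * (1 / (2 * Real.sqrt q)) := by
    filter_upwards [hev, hpos] with q h1 h2
    exact ((h1.differentiableAt (by norm_num)).hasDerivAt.comp q (Real.hasDerivAt_sqrt h2.ne')).deriv
  have hm1 : DifferentiableAt ℝ (deriv m) r := by
    have h2 : ContDiffAt ℝ 1 (fun q => fderiv ℝ m q 1) r :=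
      (hm.fderiv_right (m := 1) (by norm_num)).clm_apply contDiffAt_const
    exact h2.differentiableAt (by norm_num)
  have hs := Real.hasDerivAt_sqrt (x := r ^ 2) (by positivity)
  rw [hsq] at hs
  have hm1' : HasDerivAt (deriv m) (deriv (deriv m) r) (Real.sqrt (r^2)) := by
    rw [hsq]; exact hm1.hasDerivAt
  have e1 := hm1'.comp (r^2) hs
  have hs2 : HasDerivAt (fun q => (1:ℝ) / (2 * Real.sqrt q)) (-(1 / (4 * r ^ 3))) (r ^ 2) := by
    have := (hs.const_mul 2).inv (by rw [hsq]; positivity)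
    simp only [one_div]
    refine this.congr_deriv ?_
    rw [hsq]; field_simp; norm_num
  have hdd : deriv (deriv A) (r ^ 2)
      = deriv (deriv m) r * (1 / (2 * r)) * (1 / (2 * r)) + deriv m r * (-(1 / (4 * r ^ 3))) := by
    rw [hd.deriv_eq]
    have := (e1.mul hs2).deriv
    simp only [Function.comp_def, hsq] at this
    exact this
  have hd0 : deriv A (r ^ 2) = deriv m r * (1 / (2 * r)) := by
    have := hd.eq_of_nhds; simpa only [hsq] using this
  rw [hdd, hd0]
  field_simp
  ring

/-- cylinder profile function -/
def cylF {n : ℕ} (μ : ℝ) (h : ℝ → ℝ) (Y : EuclideanSpace ℝ (Fin n) → ℝ)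
    (x : EuclideanSpace ℝ (Fin n)) : ℝ :=
  ‖x‖ ^ (-μ) * h (-Real.log ‖x‖) * Y x

lemma cylF_lap {n : ℕ} {k : ℕ} {μ : ℝ} {h : ℝ → ℝ} {Y : EuclideanSpace ℝ (Fin n) → ℝ}
    {x : EuclideanSpace ℝ (Fin n)} (hx : x ≠ 0) (hμ : μ = k + ((n:ℝ) - 2) / 2)
    (hh : ContDiffAt ℝ 2 h (-Real.log ‖x‖)) (hY : HH k Y) :
    ContDiffAt ℝ 2 (cylF μ h Y) x ∧
    lapE (cylF μ h Y) x = ‖x‖ ^ (-μ - 2) *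
      (deriv (deriv h) (-Real.log ‖x‖) - μ ^ 2 * h (-Real.log ‖x‖)) * Y x := by
  have hr : 0 < ‖x‖ := norm_pos_iff.2 hx
  set m : ℝ → ℝ := fun q => q ^ (-μ) * h (-Real.log q) with hm
  have hlog : ∀ q : ℝ, 0 < q → ContDiffAt ℝ 2 (fun q => -Real.log q) q := fun q hq =>
    (Real.contDiffAt_log.2 hq.ne').neg
  have hmc : ContDiffAt ℝ 2 m ‖x‖ := by
    apply ContDiffAt.mul
    · exact Real.contDiffAt_rpow_const_of_ne hr.ne'
    · exact ContDiffAt.comp ‖x‖ (g := h) (f := fun q => -Real.log q) hh (hlog _ hr)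
  obtain ⟨h1, h2⟩ := lapE_normfun_mul hx hmc hY
  have hfun : cylF μ h Y = fun y => m ‖y‖ * Y y := by
    funext y; simp [cylF, hm]
  refine ⟨by rw [hfun]; exact h1, ?_⟩
  rw [hfun, h2]
  set r := ‖x‖ with hrdef
  have hev : ∀ᶠ q in nhds r, ContDiffAt ℝ 2 h (-Real.log q) :=
    ((hlog r hr).continuousAt).eventually (hh.eventually (by simp))
  have hpos : ∀ᶠ q in nhds r, 0 < q := lt_mem_nhds hr
  have hD : ∀ q : ℝ, 0 < q → ∀ (g : ℝ → ℝ) (ν : ℝ), DifferentiableAt ℝ g (-Real.log q) →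
      HasDerivAt (fun q => q ^ (-ν) * g (-Real.log q))
        (q ^ (-ν - 1) * (-ν * g (-Real.log q) - deriv g (-Real.log q))) q := by
    intro q hq g ν hg
    have e1 : HasDerivAt (fun q : ℝ => q ^ (-ν)) (-ν * q ^ (-ν - 1)) q :=
      Real.hasDerivAt_rpow_const (Or.inl hq.ne')
    have e2 : HasDerivAt (fun q => g (-Real.log q)) (deriv g (-Real.log q) * (-q⁻¹)) q :=
      hg.hasDerivAt.comp q (Real.hasDerivAt_log hq.ne').neg
    refine (e1.mul e2).congr_deriv ?_
    have : q ^ (-ν) = q ^ (-ν - 1) * q := by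
      rw [← Real.rpow_add_one hq.ne']; congr 1; ring
    rw [this]; field_simp; ring
  have hd : deriv m =ᶠ[nhds r]
      fun q => q ^ (-(μ + 1)) * (fun t => -μ * h t - deriv h t) (-Real.log q) := by
    filter_upwards [hev, hpos] with q g1 g2
    rw [(hD q g2 h μ (g1.differentiableAt (by norm_num))).deriv]
    congr 2; ring
  have hh1 : DifferentiableAt ℝ (deriv h) (-Real.log r) := by
    have h2 : ContDiffAt ℝ 1 (fun q => fderiv ℝ h q 1) (-Real.log r) :=
      (hh.fderiv_right (m := 1) (by norm_num)).clm_apply contDiffAt_const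
    exact h2.differentiableAt (by norm_num)
  have hh0 : DifferentiableAt ℝ h (-Real.log r) := hh.differentiableAt (by norm_num)
  have hg : HasDerivAt (fun t => -μ * h t - deriv h t)
      (-μ * deriv h (-Real.log r) - deriv (deriv h) (-Real.log r)) (-Real.log r) :=
    (hh0.hasDerivAt.const_mul (-μ)).sub hh1.hasDerivAt
  rw [hd.deriv_eq, hd.eq_of_nhds, (hD r hr _ (μ+1) hg.differentiableAt).deriv, hg.deriv]
  have e3 : r ^ (-(μ + 1)) = r ^ (-μ - 2) * r := by
    rw [← Real.rpow_add_one hr.ne']; congr 1; ring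
  have e4 : r ^ (-(μ + 1) - 1) = r ^ (-μ - 2) := by congr 1; ring
  rw [e3, e4]
  field_simp
  rw [hμ]; ring

/-- Gegenbauer polynomials, two-variable homogeneous form -/
def zp (a : ℝ) : ℕ → ℝ → ℝ → ℝ
  | 0, _, _ => 1
  | 1, u, _ => 2 * a * u
  | (k+2), u, v => (2 * (k + 1 + a) * u * zp a (k+1) u v - (k + 2 * a) * v * zp a k u v) / (k + 2)

/-- zonal kernel -/
def Zk {n : ℕ} (k : ℕ) (x y : EuclideanSpace ℝ (Fin n)) : ℝ :=
  zp (((n:ℝ) - 2) / 2) k (inner ℝ x y) (‖x‖ ^ 2 * ‖y‖ ^ 2)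

lemma zp_rec (a : ℝ) (k : ℕ) (u v : ℝ) : ((k:ℝ) + 2) * zp a (k+2) u v =
    2 * (k + 1 + a) * u * zp a (k+1) u v - (k + 2 * a) * v * zp a k u v := by
  rw [zp]; field_simp

lemma zp_homog (a : ℝ) (c u v : ℝ) : ∀ k, zp a k (c * u) (c ^ 2 * v) = c ^ k * zp a k u v
  | 0 => by simp [zp]
  | 1 => by simp [zp]; ring
  | (k+2) => by rw [zp, zp, zp_homog a c u v (k+1), zp_homog a c u v k]; ring

lemma Zk_symm {n : ℕ} (k : ℕ) (x y : EuclideanSpace ℝ (Fin n)) : Zk k x y = Zk k y x := by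
  unfold Zk; rw [real_inner_comm, mul_comm]

lemma Zk_homog {n : ℕ} (k : ℕ) (c : ℝ) (x y : EuclideanSpace ℝ (Fin n)) :
    Zk k (c • x) y = c ^ k * Zk k x y := by
  unfold Zk
  rw [← zp_homog, real_inner_smul_left, norm_smul, mul_pow, mul_assoc]; simp

lemma Zk_homog_right {n : ℕ} (k : ℕ) (c : ℝ) (x y : EuclideanSpace ℝ (Fin n)) :
    Zk k x (c • y) = c ^ k * Zk k x y := by
  rw [Zk_symm, Zk_homog, Zk_symm]

lemma zp_contDiff (a : ℝ) : ∀ k, ContDiff ℝ (⊤ : ℕ∞) (fun q : ℝ × ℝ => zp a k q.1 q.2)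
  | 0 => by simp only [zp]; fun_prop
  | 1 => by simp only [zp]; fun_prop
  | (k+2) => by
    simp only [zp]
    have h1 := zp_contDiff a (k+1)
    have h2 := zp_contDiff a k
    fun_prop

lemma Zk_contDiff {n : ℕ} (k : ℕ) :
    ContDiff ℝ (⊤ : ℕ∞) (fun q : EuclideanSpace ℝ (Fin n) × EuclideanSpace ℝ (Fin n) => Zk k q.1 q.2) := by
  have : ContDiff ℝ (⊤ : ℕ∞) (fun q : EuclideanSpace ℝ (Fin n) × EuclideanSpace ℝ (Fin n) =>
      (inner ℝ q.1 q.2, ‖q.1‖ ^ 2 * ‖q.2‖ ^ 2)) := by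
    refine ContDiff.prodMk (contDiff_fst.inner ℝ contDiff_snd) ?_
    exact (contDiff_fst.norm_sq ℝ).mul (contDiff_snd.norm_sq ℝ)
  exact (zp_contDiff _ k).comp this

lemma Zk_contDiff_left {n : ℕ} (k : ℕ) (y : EuclideanSpace ℝ (Fin n)) :
    ContDiff ℝ (⊤ : ℕ∞) (fun x : EuclideanSpace ℝ (Fin n) => Zk k x y) :=
  (Zk_contDiff k).comp (f := fun x : EuclideanSpace ℝ (Fin n) => (x, y)) (by fun_prop)

lemma Zk_cd2 {n : ℕ} (k : ℕ) (y : EuclideanSpace ℝ (Fin n)) :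
    ContDiff ℝ 2 (fun x : EuclideanSpace ℝ (Fin n) => Zk k x y) :=
  (contDiff_infty.1 (Zk_contDiff_left k y) 2)

lemma Zk_diff {n : ℕ} (k : ℕ) (y x : EuclideanSpace ℝ (Fin n)) :
    DifferentiableAt ℝ (fun x : EuclideanSpace ℝ (Fin n) => Zk k x y) x :=
  ((Zk_cd2 k y).differentiable (by norm_num)) x

lemma Zk_rec {n : ℕ} (k : ℕ) (x y : EuclideanSpace ℝ (Fin n)) : Zk (k+2) x y =
    (2 * (k + 1 + ((n:ℝ)-2)/2) / (k + 2)) * (inner ℝ x y * Zk (k+1) x y) +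
      (- ((k + ((n:ℝ)-2)) / (k+2))) * ((‖x‖^2 * ‖y‖ ^ 2) * Zk k x y) := by
  unfold Zk; rw [zp]; ring

lemma hasFDerivAt_inner_left {n : ℕ} (x y : EuclideanSpace ℝ (Fin n)) :
    HasFDerivAt (fun x : EuclideanSpace ℝ (Fin n) => inner ℝ x y) (innerSL ℝ y) x := by
  have : (fun x : EuclideanSpace ℝ (Fin n) => inner ℝ x y) = fun x => innerSL ℝ y x := by
    funext x; simp [real_inner_comm]
  rw [this]; exact (innerSL ℝ y).hasFDerivAt

lemma Zk_dir {n : ℕ} (x y : EuclideanSpace ℝ (Fin n)) : ∀ k : ℕ,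
    fderiv ℝ (fun x : EuclideanSpace ℝ (Fin n) => Zk (k+1) x y) x y
      = (k + ((n:ℝ) - 2)) * ‖y‖ ^ 2 * Zk k x y := by
  intro k
  refine Nat.strong_induction_on k (fun k IH => ?_)
  rcases k with _ | k
  · skip
    have : (fun x : EuclideanSpace ℝ (Fin n) => Zk 1 x y) = fun x => ((n:ℝ)-2) * inner ℝ x y := by
      funext x; simp only [Zk, zp]; ring
    rw [this, ((hasFDerivAt_inner_left x y).const_mul _).fderiv]
    simp [Zk, zp]
  · skip
    have hfun : (fun x : EuclideanSpace ℝ (Fin n) => Zk (k+2) x y) = fun x =>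
        (2 * (k + 1 + ((n:ℝ)-2)/2) / (k + 2)) * (inner ℝ x y * Zk (k+1) x y) +
      (- ((k + ((n:ℝ)-2)) / (k+2))) * ((‖x‖^2 * ‖y‖ ^ 2) * Zk k x y) := by
      funext x; exact Zk_rec k x y
    have h1 := (((hasFDerivAt_inner_left x y).mul (Zk_diff (k+1) y x).hasFDerivAt).const_mul
      (2 * (k + 1 + ((n:ℝ)-2)/2) / (k + 2))).add
      ((((hasFDerivAt_normSq x).mul_const (‖y‖^2)).mul (Zk_diff k y x).hasFDerivAt).const_mul
      (- ((k + ((n:ℝ)-2)) / (k+2))))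
    have e1 := IH k (by omega)
    have e0 : k = 0 ∧ fderiv ℝ (fun x : EuclideanSpace ℝ (Fin n) => Zk k x y) x y = 0 ∨
      ∃ j, k = j + 1 ∧ fderiv ℝ (fun x : EuclideanSpace ℝ (Fin n) => Zk k x y) x y
        = (j + ((n:ℝ) - 2)) * ‖y‖ ^ 2 * Zk j x y := by
      rcases k with _ | j
      · left; refine ⟨rfl, ?_⟩
        have : (fun x : EuclideanSpace ℝ (Fin n) => Zk 0 x y) = fun _ => 1 := by funext; simp [Zk, zp]
        rw [this]; simp
      · right; exact ⟨j, rfl, IH j (by omega)⟩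
    rw [show k + 1 + 1 = k + 2 from rfl, hfun]
    refine (congrArg (fun L => L y) h1.fderiv).trans ?_
    simp only [add_apply, smul_apply, innerSL_apply_apply,
      smul_eq_mul, nsmul_eq_mul, e1, real_inner_self_eq_norm_sq]
    rcases e0 with ⟨rfl, e0⟩ | ⟨j, rfl, e0⟩
    · rw [e0]
      have : Zk 0 x y = 1 := by simp [Zk, zp]
      have h1 : Zk 1 x y = ((n:ℝ)-2) * inner ℝ x y := by simp only [Zk, zp]; ring
      simp [this, h1]; ring
    · rw [e0]
      have := Zk_rec j x y
      have h2 : (‖x‖^2 * ‖y‖ ^ 2) * ((j + ((n:ℝ) - 2)) * Zk j x y)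
        = 2 * (j + 1 + ((n:ℝ)-2)/2) * (inner ℝ x y * Zk (j+1) x y) - (j+2) * Zk (j+2) x y := by
        rw [this]; field_simp; ring
      have h3 : (‖x‖^2 * ‖y‖ ^ 2) * ((j + ((n:ℝ) - 2)) * ‖y‖^2 * Zk j x y)
        = ‖y‖^2 * (2 * (j + 1 + ((n:ℝ)-2)/2) * (inner ℝ x y * Zk (j+1) x y) - (j+2) * Zk (j+2) x y) := by
        rw [← h2]; ring
      simp only [show j + 1 + 1 = j + 2 from rfl]
      rw [h3]
      push_cast
      field_simp
      simp [real_inner_comm y x]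
      ring
  
lemma Zk_HH {n : ℕ} (y : EuclideanSpace ℝ (Fin n)) : ∀ k : ℕ,
    HH k (fun x : EuclideanSpace ℝ (Fin n) => Zk k x y)
  | 0 => by
    refine ⟨Zk_cd2 0 y, fun c x => Zk_homog 0 c x y, fun x => ?_⟩
    have : (fun x : EuclideanSpace ℝ (Fin n) => Zk 0 x y) = fun _ => 1 := by funext; simp [Zk, zp]
    rw [this]; rw [lapE_eq_pd contDiffAt_const]
    have h2 : ∀ i : Fin n, pd i (fun _ : EuclideanSpace ℝ (Fin n) => (1:ℝ)) = fun _ => 0 := by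
      intro i; funext z; simp [pd]
    simp only [h2]; simp [pd]
  | 1 => by
    refine ⟨Zk_cd2 1 y, fun c x => Zk_homog 1 c x y, fun x => ?_⟩
    have : (fun x : EuclideanSpace ℝ (Fin n) => Zk 1 x y) = fun x => innerSL ℝ (((n:ℝ)-2) • y) x := by
      funext x; simp only [Zk, zp, innerSL_apply_apply, inner_smul_left, real_inner_comm x y]; simp; ring_nf; simp
    rw [this, lapE_eq_pd (innerSL ℝ (((n:ℝ)-2) • y)).contDiff.contDiffAt]
    apply Finset.sum_eq_zero
    intro i _
    have h2 : pd i (fun x : EuclideanSpace ℝ (Fin n) => innerSL ℝ (((n:ℝ)-2) • y) x)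
        = fun _ => innerSL ℝ (((n:ℝ)-2) • y) (EuclideanSpace.single i 1) := by
      funext z; unfold pd; rw [(innerSL ℝ (((n:ℝ)-2) • y)).hasFDerivAt.fderiv]
    rw [h2]; simp [pd]
  | (k+2) => by
    have H1 := Zk_HH y (k+1)
    have H0 := Zk_HH y k
    refine ⟨Zk_cd2 _ y, fun c x => Zk_homog _ c x y, fun x => ?_⟩
    have hfun : (fun x : EuclideanSpace ℝ (Fin n) => Zk (k+2) x y) = fun x =>
        (2 * (k + 1 + ((n:ℝ)-2)/2) / (k + 2)) * (inner ℝ x y * Zk (k+1) x y) +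
      (- ((k + ((n:ℝ)-2)) / (k+2))) * ((fun q => q * ‖y‖ ^ 2) (‖x‖^2) * Zk k x y) := by
      funext x; exact Zk_rec k x y
    have ci : ContDiff ℝ 2 (fun x : EuclideanSpace ℝ (Fin n) => inner ℝ x y) :=
      contDiff_id.inner ℝ contDiff_const
    have c1 : ContDiffAt ℝ 2 (fun x : EuclideanSpace ℝ (Fin n) => inner ℝ x y * Zk (k+1) x y) x :=
      (ci.mul (Zk_cd2 _ y)).contDiffAt
    have cA : ContDiffAt ℝ 2 (fun q => q * ‖y‖ ^ 2) (‖x‖^2) := by fun_prop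
    have c2 : ContDiffAt ℝ 2 (fun x : EuclideanSpace ℝ (Fin n) => (fun q => q * ‖y‖ ^ 2) (‖x‖^2) * Zk k x y) x :=
      (contDiffAt_radial cA).mul (Zk_cd2 _ y).contDiffAt
    rw [hfun, lapE_add (contDiffAt_const.mul c1) (contDiffAt_const.mul c2), lapE_const_mul _ c1,
      lapE_const_mul _ c2, lapE_radial_mul cA H0, lapE_mul ci.contDiffAt (Zk_cd2 _ y).contDiffAt, H1.harm]
    have hl : lapE (fun x : EuclideanSpace ℝ (Fin n) => inner ℝ x y) x = 0 := by
      rw [lapE_eq_pd ci.contDiffAt]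
      apply Finset.sum_eq_zero
      intro i _
      have h2 : pd i (fun x : EuclideanSpace ℝ (Fin n) => inner ℝ x y)
        = fun _ => innerSL ℝ y (EuclideanSpace.single i 1) := by
        funext z; unfold pd; rw [(hasFDerivAt_inner_left z y).fderiv]
      rw [h2]; simp [pd]
    have hs : ∑ i, pd i (fun x : EuclideanSpace ℝ (Fin n) => inner ℝ x y) x *
        pd i (fun x : EuclideanSpace ℝ (Fin n) => Zk (k+1) x y) x
        = (k + ((n:ℝ) - 2)) * ‖y‖ ^ 2 * Zk k x y := by
      rw [← Zk_dir x y k]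
      have hy : y = ∑ i, y i • EuclideanSpace.single i (1:ℝ) := by
        ext j; simp [Pi.single_apply]
      conv_rhs => arg 2; rw [hy]
      rw [map_sum]
      refine Finset.sum_congr rfl fun i _ => ?_
      simp only [pd]
      rw [(hasFDerivAt_inner_left x y).fderiv]
      simp [EuclideanSpace.inner_single_right]
    rw [hl, hs]
    have hd1 : deriv (fun q : ℝ => q * ‖y‖ ^ 2) = fun _ => ‖y‖^2 := by
      funext q; simp
    rw [hd1]
    simp only [deriv_const]
    field_simp
    ring

/-- binomial coefficients of `(1-z)^{-a}` -/
def bet (a : ℝ) : ℕ → ℝ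
  | 0 => 1
  | (j+1) => (a + j) / (j + 1) * bet a j

lemma bet_pos {a : ℝ} (ha : 0 < a) : ∀ j, 0 < bet a j
  | 0 => by simp [bet]
  | (j+1) => by rw [bet]; have := bet_pos ha j; positivity

/-- majorant of the Gegenbauer polynomials -/
def BB (a : ℝ) (k : ℕ) : ℝ := ∑ q ∈ Finset.HasAntidiagonal.antidiagonal k, bet a q.1 * bet a q.2

lemma BB_nonneg {a : ℝ} (ha : 0 < a) (k : ℕ) : 0 ≤ BB a k :=
  Finset.sum_nonneg fun q _ => (mul_pos (bet_pos ha _) (bet_pos ha _)).le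

open PowerSeries in
lemma zp_eq_complex (a c : ℝ) (z w : ℂ) (hzw : z * w = 1) (hs : z + w = 2 * c) (k : ℕ) :
    (zp a k c 1 : ℂ) =
      ∑ q ∈ Finset.HasAntidiagonal.antidiagonal k, ((bet a q.1 : ℂ) * z ^ q.1) * ((bet a q.2 : ℂ) * w ^ q.2) := by
  set F : ℂ → PowerSeries ℂ := fun z => PowerSeries.mk fun j => (bet a j : ℂ) * z ^ j with hF
  have hFd : ∀ z, (1 - PowerSeries.C z * X) * (PowerSeries.derivative ℂ (F z))
      = PowerSeries.C (a * z) * F z := by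
    intro z
    ext j
    rw [sub_mul, one_mul, map_sub, mul_assoc, PowerSeries.coeff_C_mul, PowerSeries.coeff_C_mul]
    rcases j with _ | j
    · simp [hF, PowerSeries.coeff_derivative, bet]
    · rw [PowerSeries.coeff_succ_X_mul]
      simp only [hF, PowerSeries.coeff_derivative, PowerSeries.coeff_mk]
      rw [bet]; push_cast
      have : ((j:ℂ) + 1 + 1) ≠ 0 := by exact_mod_cast Nat.succ_ne_zero (j+1)
      field_simp
      ring
  set G := F z * F w with hG
  have hGd : (1 - PowerSeries.C (2*c : ℂ) * X + X^2) * (PowerSeries.derivative ℂ G)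
      = PowerSeries.C (2 * a * c : ℂ) * G - PowerSeries.C (2 * a : ℂ) * (X * G) := by
    have e1 : (1 - PowerSeries.C z * X) * (1 - PowerSeries.C w * X)
        = 1 - PowerSeries.C (2*c : ℂ) * X + X^2 := by
      rw [← hs]
      have : PowerSeries.C z * PowerSeries.C w = 1 := by rw [← map_mul, hzw, map_one]
      rw [map_add]
      linear_combination (X^2 : PowerSeries ℂ) * this
    have e2 : PowerSeries.derivative ℂ G
        = F z * PowerSeries.derivative ℂ (F w) + F w * PowerSeries.derivative ℂ (F z) := by
      rw [hG, Derivation.leibniz]; rfl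
    have e3 : PowerSeries.C z * PowerSeries.C w = (1 : PowerSeries ℂ) := by
      rw [← map_mul, hzw, map_one]
    have e4 : PowerSeries.C (2 * a * c : ℂ) = PowerSeries.C (a : ℂ) * (PowerSeries.C z + PowerSeries.C w) := by
      rw [← map_add, ← map_mul, hs]; congr 1; ring
    have e5 : PowerSeries.C (2 * a : ℂ) = 2 * PowerSeries.C (a : ℂ) := by
      rw [map_mul]; congr 1
    have hz := hFd z
    have hw := hFd w
    rw [map_mul] at hz hw
    rw [← e1, e2, e4, e5, hG]
    linear_combination (1 - PowerSeries.C z * X) * F z * hw + (1 - PowerSeries.C w * X) * F w * hz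
      - 2 * PowerSeries.C (a:ℂ) * X * F z * F w * e3
  have hrec : ∀ j : ℕ, ((j:ℂ) + 2) * coeff (j+2) G
      = 2 * (j + 1 + a) * c * coeff (j+1) G - (j + 2 * a) * coeff j G := by
    intro j
    have := congrArg (coeff (j+1)) hGd
    rw [pow_two, add_mul, sub_mul, one_mul, map_add, map_sub, map_sub, mul_assoc, PowerSeries.coeff_C_mul,
      PowerSeries.coeff_C_mul, PowerSeries.coeff_C_mul, PowerSeries.coeff_succ_X_mul,
      PowerSeries.coeff_succ_X_mul, mul_assoc X X, PowerSeries.coeff_succ_X_mul,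
      PowerSeries.coeff_derivative, PowerSeries.coeff_derivative] at this
    have h3 : coeff j (X * PowerSeries.derivative ℂ G) = (j:ℂ) * coeff j G := by
      rcases j with _ | j
      · simp
      · rw [PowerSeries.coeff_succ_X_mul, PowerSeries.coeff_derivative]; push_cast; ring
    rw [h3] at this
    push_cast at this
    linear_combination this
  have key : ∀ k, (zp a k c 1 : ℂ) = coeff k G := by
    intro k
    refine Nat.strong_induction_on k fun k IH => ?_
    rcases k with _ | _ | k
    · simp [zp, hG, hF, bet]
    · have := congrArg (coeff 0) hGd
      simp at this
      have h1 : coeff 1 G = constantCoeff ((PowerSeries.derivative ℂ) G) := by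
        rw [← PowerSeries.coeff_zero_eq_constantCoeff_apply, PowerSeries.coeff_derivative]; simp
      rw [zero_add, h1, this]
      simp [zp, hG, hF, bet]
    · have h1 := hrec k
      rw [← IH k (by omega), ← IH (k+1) (by omega)] at h1
      have h2 : (((k:ℂ) + 2) * zp a (k+2) c 1) =
        2 * (k + 1 + a) * c * zp a (k+1) c 1 - (k + 2 * a) * zp a k c 1 := by
        have := zp_rec a k c 1
        exact_mod_cast (by linarith : ((k:ℝ) + 2) * zp a (k+2) c 1 =
          2 * (k + 1 + a) * c * zp a (k+1) c 1 - (k + 2 * a) * zp a k c 1)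
      have h3 : ((k:ℂ) + 2) ≠ 0 := by exact_mod_cast Nat.succ_ne_zero (k+1)
      exact mul_left_cancel₀ h3 (h2.trans h1.symm)
  rw [key, hG, PowerSeries.coeff_mul]
  simp [hF]

lemma zp_bound1 {a : ℝ} (ha : 0 < a) {c : ℝ} (hc : |c| ≤ 1) (k : ℕ) : |zp a k c 1| ≤ BB a k := by
  have hc2 : 0 ≤ 1 - c ^ 2 := by nlinarith [abs_le.1 hc, sq_abs c, abs_nonneg c]
  set z : ℂ := ⟨c, Real.sqrt (1 - c^2)⟩ with hz
  set w : ℂ := ⟨c, -Real.sqrt (1 - c^2)⟩ with hw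
  have hsq := Real.mul_self_sqrt hc2
  have hzw : z * w = 1 := by
    apply Complex.ext <;> simp [hz, hw] <;> nlinarith
  have hs : z + w = 2 * c := by
    apply Complex.ext <;> simp [hz, hw]; ring
  have hnz : ‖z‖ = 1 := by
    rw [← pow_left_inj₀ (norm_nonneg z) zero_le_one two_ne_zero, ← Complex.normSq_eq_norm_sq]
    simp [Complex.normSq, hz]; nlinarith
  have hnw : ‖w‖ = 1 := by
    rw [← pow_left_inj₀ (norm_nonneg w) zero_le_one two_ne_zero, ← Complex.normSq_eq_norm_sq]
    simp [Complex.normSq, hw]; nlinarith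
  have h := zp_eq_complex a c z w hzw hs k
  have h2 : |zp a k c 1| = ‖(zp a k c 1 : ℂ)‖ := by simp
  rw [h2, h, BB]
  refine (norm_sum_le _ _).trans (Finset.sum_le_sum fun q _ => ?_)
  simp [hnz, hnw, abs_of_pos (bet_pos ha _)]

lemma zp_bound {a : ℝ} (ha : 0 < a) {u q : ℝ} (hu : |u| ≤ q) (k : ℕ) :
    |zp a k u (q^2)| ≤ BB a k * q ^ k := by
  have hq : 0 ≤ q := (abs_nonneg u).trans hu
  obtain ⟨c, hc, rfl⟩ : ∃ c, |c| ≤ 1 ∧ u = q * c := by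
    rcases hq.eq_or_lt with h | h
    · subst h; exact ⟨0, by simp, by simpa using hu⟩
    · refine ⟨u / q, ?_, by field_simp⟩
      rw [abs_div, abs_of_pos h]; exact (div_le_one h).2 hu
  have := zp_homog a q c 1 k
  rw [mul_one] at this
  rw [this, abs_mul, abs_of_nonneg (by positivity), mul_comm]
  gcongr
  exact zp_bound1 ha hc k

lemma Zk_bound {n : ℕ} (hn : 3 ≤ n) (k : ℕ) (x y : EuclideanSpace ℝ (Fin n)) :
    |Zk k x y| ≤ BB (((n:ℝ)-2)/2) k * (‖x‖ * ‖y‖) ^ k := by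
  unfold Zk
  rw [← mul_pow]
  refine zp_bound ?_ (abs_real_inner_le_norm x y) k
  have : (3:ℝ) ≤ n := by exact_mod_cast hn
  linarith

lemma bet_summable {a : ℝ} (ha : 0 < a) {s : ℝ} (h0 : 0 < s) (h1 : s < 1) :
    Summable fun j => bet a j * s ^ j := by
  refine summable_of_ratio_test_tendsto_lt_one (l := s) h1 ?_ ?_
  · exact Eventually.of_forall fun j => (mul_pos (bet_pos ha j) (pow_pos h0 j)).ne'
  · have : (fun j : ℕ => ‖bet a (j+1) * s ^ (j+1)‖ / ‖bet a j * s ^ j‖)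
        = fun j : ℕ => s * (1 + (a - 1) * (1 / ((j:ℝ) + 1))) := by
      funext j
      have hb := bet_pos ha j
      have hb' := bet_pos ha (j+1)
      rw [Real.norm_of_nonneg (by positivity), Real.norm_of_nonneg (by positivity), bet]
      field_simp
      ring
    rw [this]
    have := ((tendsto_one_div_add_atTop_nhds_zero_nat (𝕜 := ℝ)).const_mul (a-1)).const_add 1
    simpa using this.const_mul s

lemma BB_summable {a : ℝ} (ha : 0 < a) {s : ℝ} (h0 : 0 ≤ s) (h1 : s < 1) :
    Summable fun k => BB a k * s ^ k := by
  have main : ∀ s : ℝ, 0 < s → s < 1 → Summable fun k => BB a k * s ^ k := by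
    intro s h0 h1
    have hb := bet_summable ha h0 h1
    have hn : Summable fun j => ‖bet a j * s ^ j‖ := hb.norm
    have := (summable_norm_sum_mul_antidiagonal_of_summable_norm hn hn).of_norm
    refine this.congr fun k => ?_
    rw [BB, Finset.sum_mul]
    refine Finset.sum_congr rfl fun q hq => ?_
    rw [← Finset.HasAntidiagonal.mem_antidiagonal.1 hq, pow_add]; ring
  refine Summable.of_nonneg_of_le (fun k => mul_nonneg (BB_nonneg ha k) (by positivity))
    (fun k => ?_) (main ((1+s)/2) (by linarith) (by linarith))
  have := BB_nonneg ha k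
  gcongr; linarith

lemma BB_summable' {a : ℝ} (ha : 0 < a) {s : ℝ} (h0 : 0 ≤ s) (h1 : s < 1) :
    Summable fun k : ℕ => ((k:ℝ)+1) * BB a (k+1) * s ^ k := by
  set t := (1+s)/2 with ht
  have ht0 : 0 < t := by simp only [ht]; linarith
  have ht1 : t < 1 := by simp only [ht]; linarith
  have hst : s < t := by simp only [ht]; linarith
  clear_value t
  obtain ⟨C, hC⟩ := (BB_summable ha ht0.le ht1).tendsto_atTop_zero.bddAbove_range
  have hr : ‖s / t‖ < 1 := by
    rw [Real.norm_of_nonneg (by positivity)]; exact (div_lt_one ht0).2 hst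
  have h1 := (summable_pow_mul_geometric_of_norm_lt_one 1 hr).add (summable_geometric_of_norm_lt_one hr)
  have h2 := h1.mul_left (C / t)
  refine Summable.of_nonneg_of_le (fun k => ?_) (fun k => ?_) h2
  · have := BB_nonneg ha (k+1); positivity
  · have h3 : BB a (k+1) * t^(k+1) ≤ C := hC ⟨k+1, rfl⟩
    have h4 : BB a (k+1) ≤ C / t^(k+1) := by rw [le_div_iff₀ (by positivity)]; exact h3
    calc ((k:ℝ)+1) * BB a (k+1) * s ^ k ≤ ((k:ℝ)+1) * (C / t^(k+1)) * s ^ k := by gcongr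
      _ = C / t * (k^1 * (s/t)^k + (s/t)^k) := by rw [div_pow, pow_succ, pow_one]; field_simp

lemma gen_fun {a : ℝ} (ha : 0 < a) {c : ℝ} (hc : |c| ≤ 1) {s : ℝ} (h0 : 0 ≤ s) (h1 : s < 1) :
    HasSum (fun k => zp a k c 1 * s ^ k) ((1 - 2 * c * s + s ^ 2) ^ (-a)) := by
  set z : ℕ → ℝ := fun k => zp a k c 1 with hz
  have hzb : ∀ k, |z k| ≤ BB a k := zp_bound1 ha hc
  have hS : ∀ y : ℝ, |y| < 1 → Summable fun k => z k * y ^ k := by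
    intro y hy
    refine Summable.of_norm_bounded (BB_summable ha (abs_nonneg y) hy) fun k => ?_
    rw [norm_mul, norm_pow]; simp only [Real.norm_eq_abs]
    have := hzb k; gcongr
  have hS' : ∀ y : ℝ, |y| < 1 → Summable fun k : ℕ => ((k:ℝ)+1) * z (k+1) * y ^ k := by
    intro y hy
    refine Summable.of_norm_bounded (BB_summable' ha (abs_nonneg y) hy) fun k => ?_
    rw [norm_mul, norm_pow, norm_mul]; simp only [Real.norm_eq_abs]
    rw [abs_of_nonneg (by positivity : (0:ℝ) ≤ (k:ℝ)+1)]
    have := hzb (k+1); gcongr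
  set g : ℝ → ℝ := fun y => ∑' k, z k * y ^ k with hg
  set g' : ℝ → ℝ := fun y => ∑' k : ℕ, ((k:ℝ)+1) * z (k+1) * y ^ k with hg'
  have hder : ∀ y : ℝ, |y| < 1 → HasDerivAt g (g' y) y := by
    intro y hy
    set R := (1 + |y|)/2 with hR
    have hR1 : R < 1 := by simp only [hR]; linarith
    have hyR : |y| < R := by simp only [hR]; linarith
    have hR0 : 0 ≤ R := (abs_nonneg y).trans hyR.le
    have hsum : Summable fun k : ℕ => (k:ℝ) * BB a k * R ^ (k-1) := by
      rw [← summable_nat_add_iff 1]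
      simpa using BB_summable' ha hR0 hR1
    have := hasDerivAt_tsum_of_isPreconnected (g := fun k y => z k * y ^ k)
      (g' := fun (k:ℕ) y => z k * (k * y ^ (k-1))) (u := fun k : ℕ => (k:ℝ) * BB a k * R ^ (k-1))
      (t := Ioo (-R) R) hsum isOpen_Ioo isPreconnected_Ioo
      (fun k y _ => (hasDerivAt_pow k y).const_mul (z k)) (fun k y hy => ?_) (y₀ := 0) (y := y)
      ⟨by linarith [abs_nonneg y], by linarith [abs_nonneg y]⟩ (hS 0 (by simp)) (abs_lt.1 hyR)
    · refine this.congr_deriv ?_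
      rw [Summable.tsum_eq_zero_add]
      · simp only [hg']; simp
        refine tsum_congr fun k => ?_
        ring
      · rw [← summable_nat_add_iff 1]
        refine (hS' y hy).congr fun k => ?_
        simp only [Nat.add_sub_cancel]; push_cast; ring
    · rw [norm_mul, norm_mul, norm_pow]; simp only [Real.norm_eq_abs, Nat.abs_cast]
      have hh := hzb k
      have h3 : |y| ≤ R := (abs_lt.2 hy).le
      calc |z k| * (k * |y|^(k-1)) ≤ BB a k * (k * R ^(k-1)) := by gcongr; exact (abs_nonneg _).trans hh
        _ = _ := by ring
  have hode : ∀ y : ℝ, |y| < 1 → (1 - 2 * c * y + y^2) * g' y = 2 * a * (c - y) * g y := by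
    intro y hy
    have A1 := hS y hy
    have A2 := hS' y hy
    have B1 : g y = 1 + ∑' j, z (j+1) * y ^ (j+1) := by
      simp only [hg]; rw [A1.tsum_eq_zero_add]; simp [hz, zp]
    have B2 : g' y = 2 * a * c + ∑' j : ℕ, ((j:ℝ)+2) * z (j+2) * y ^ (j+1) := by
      simp only [hg']; rw [A2.tsum_eq_zero_add]; simp [hz, zp]
      refine tsum_congr fun j => ?_
      ring
    have S1 : Summable fun j => z (j+1) * y ^ (j+1) := (summable_nat_add_iff 1).2 A1
    have S2 : Summable fun j : ℕ => ((j:ℝ)+2) * z (j+2) * y ^ (j+1) := by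
      refine ((summable_nat_add_iff 1).2 A2).congr fun j => ?_
      push_cast; ring
    have B3 : y * g y = ∑' j, z j * y ^ (j+1) := by
      simp only [hg]; rw [← tsum_mul_left]; refine tsum_congr fun j => ?_; ring
    have S3 : Summable fun j => z j * y ^ (j+1) := (A1.mul_left y).congr fun j => by ring
    have B4 : y * g' y = ∑' j : ℕ, ((j:ℝ)+1) * z (j+1) * y ^ (j+1) := by
      simp only [hg']; rw [← tsum_mul_left]; refine tsum_congr fun j => ?_; ring
    have S4 : Summable fun j : ℕ => ((j:ℝ)+1) * z (j+1) * y ^ (j+1) := (A2.mul_left y).congr fun j => by ring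
    have S5 : Summable fun j : ℕ => (j:ℝ) * z j * y ^ (j+1) := by
      rw [← summable_nat_add_iff 1]
      refine (A2.mul_left (y^2)).congr fun j => ?_
      push_cast; ring
    have B5 : y^2 * g' y = ∑' j : ℕ, (j:ℝ) * z j * y ^ (j+1) := by
      rw [S5.tsum_eq_zero_add]
      simp only [hg']; rw [← tsum_mul_left]; simp; refine tsum_congr fun j => ?_; ring
    have key : (∑' j : ℕ, ((j:ℝ)+2) * z (j+2) * y ^ (j+1)) - 2 * c * (∑' j : ℕ, ((j:ℝ)+1) * z (j+1) * y ^ (j+1))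
        + (∑' j : ℕ, (j:ℝ) * z j * y ^ (j+1)) = 2 * a * c * (∑' j, z (j+1) * y ^ (j+1)) - 2 * a * ∑' j, z j * y ^ (j+1) := by
      rw [← tsum_mul_left, ← tsum_mul_left, ← tsum_mul_left, ← S2.tsum_sub (S4.mul_left _),
        ← (S2.sub (S4.mul_left _)).tsum_add S5, ← (S1.mul_left _).tsum_sub (S3.mul_left _)]
      refine tsum_congr fun j => ?_
      have := zp_rec a j c 1
      simp only [hz]
      linear_combination y^(j+1) * this
    have : (1 - 2 * c * y + y^2) * g' y = g' y - 2 * c * (y * g' y) + y^2 * g' y := by ring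
    rw [this, B5, B4, B2]
    have : 2 * a * (c - y) * g y = 2 * a * c * g y - 2 * a * (y * g y) := by ring
    rw [this, B3, B1]
    linear_combination key
  have hqpos : ∀ y : ℝ, |y| < 1 → 0 < 1 - 2 * c * y + y^2 := by
    intro y hy
    have h2 : c * y ≤ |y| := by
      calc c * y ≤ |c * y| := le_abs_self _
        _ = |c| * |y| := abs_mul _ _
        _ ≤ 1 * |y| := by gcongr
        _ = |y| := one_mul _
    nlinarith [sq_abs y, abs_nonneg y]
  have hconst : ∀ y ∈ Icc 0 s, g y * (1 - 2 * c * y + y^2) ^ a = g 0 * (1 - 2 * c * 0 + 0^2) ^ a := by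
    have hd : ∀ y : ℝ, |y| < 1 → HasDerivAt (fun y => g y * (1 - 2 * c * y + y^2) ^ a) 0 y := by
      intro y hy
      have hp := hqpos y hy
      have e1 : HasDerivAt (fun y : ℝ => 1 - 2 * c * y + y^2) (-(2*c) + 2 * y) y := by
        have := (((hasDerivAt_id y).const_mul (2*c)).const_sub 1).add (hasDerivAt_pow 2 y)
        refine this.congr_deriv ?_
        simp
      have e2 := e1.rpow_const (p := a) (Or.inl hp.ne')
      refine ((hder y hy).mul e2).congr_deriv ?_
      have e3 : (1 - 2 * c * y + y^2) ^ a = (1 - 2 * c * y + y^2) ^ (a-1) * (1 - 2 * c * y + y^2) := by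
        rw [← Real.rpow_add_one hp.ne']; simp
      rw [e3]
      linear_combination (1 - 2 * c * y + y^2) ^ (a-1) * hode y hy
    have habs : ∀ y ∈ Icc 0 s, |y| < 1 := fun y hy => by rw [abs_of_nonneg hy.1]; linarith [hy.2]
    exact constant_of_has_deriv_right_zero (fun y hy => (hd y (habs y hy)).continuousAt.continuousWithinAt)
      (fun y hy => (hd y (habs y ⟨hy.1, hy.2.le⟩)).hasDerivWithinAt)
  have hsabs : |s| < 1 := by rw [abs_of_nonneg h0]; exact h1
  have hfin := hconst s ⟨h0, le_rfl⟩
  have hg0 : g 0 = 1 := by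
    simp only [hg]; rw [(hS 0 (by simp)).tsum_eq_zero_add]; simp [hz, zp]
  rw [hg0] at hfin
  have hgs : g s = (1 - 2 * c * s + s ^ 2) ^ (-a) := by
    rw [Real.rpow_neg (hqpos s hsabs).le]
    have := Real.rpow_pos_of_pos (hqpos s hsabs) a
    norm_num at hfin
    exact eq_inv_of_mul_eq_one_left hfin
  rw [← hgs]
  exact (hS s hsabs).hasSum

/-- Newton kernel -/
def Gm {n : ℕ} (z : EuclideanSpace ℝ (Fin n)) : ℝ := (‖z‖ ^ (n-2))⁻¹

lemma pow_rpow_half {n : ℕ} (hn : 3 ≤ n) {r : ℝ} (hr : 0 ≤ r) :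
    (r ^ 2) ^ (-(((n:ℝ)-2)/2)) = (r ^ (n-2))⁻¹ := by
  rw [← Real.rpow_natCast, ← Real.rpow_mul hr, ← Real.rpow_natCast, ← Real.rpow_neg hr]
  congr 1
  rw [Nat.cast_sub (by omega)]; push_cast; ring

lemma Gm_eq {n : ℕ} (hn : 3 ≤ n) (z : EuclideanSpace ℝ (Fin n)) :
    Gm z = (‖z‖ ^ 2) ^ (-(((n:ℝ)-2)/2)) := (pow_rpow_half hn (norm_nonneg z)).symm

lemma Gm_nonneg {n : ℕ} (z : EuclideanSpace ℝ (Fin n)) : 0 ≤ Gm z := by unfold Gm; positivity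

lemma half_pos' {n : ℕ} (hn : 3 ≤ n) : 0 < ((n:ℝ)-2)/2 := by
  have : (3:ℝ) ≤ n := by exact_mod_cast hn
  linarith

lemma Zk_gen {n : ℕ} (hn : 3 ≤ n) {x y : EuclideanSpace ℝ (Fin n)} (h : ‖y‖ < ‖x‖) :
    HasSum (fun k => Zk k x y / ‖x‖ ^ (2*k+(n-2))) (Gm (x - y)) := by
  have hx : 0 < ‖x‖ := (norm_nonneg y).trans_lt h
  set q := ‖x‖ * ‖y‖ with hq
  obtain ⟨c, hc, hu⟩ : ∃ c, |c| ≤ 1 ∧ inner ℝ x y = q * c := by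
    have hle := abs_real_inner_le_norm x y
    rcases (by positivity : 0 ≤ q).eq_or_lt with h | h
    · exact ⟨0, by simp, by rw [← hq, ← h] at hle; simpa using hle⟩
    · refine ⟨inner ℝ x y / q, ?_, by field_simp⟩
      rw [abs_div, abs_of_pos h]; exact (div_le_one h).2 hle
  set s := ‖y‖ / ‖x‖ with hs
  have hs1 : s < 1 := (div_lt_one hx).2 h
  have hs0 : 0 ≤ s := by positivity
  have hsy : ‖y‖ = s * ‖x‖ := by rw [hs]; field_simp
  have hG := (gen_fun (half_pos' hn) hc hs0 hs1).mul_right ((‖x‖ ^ (n-2))⁻¹)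
  have e1 : ∀ k, Zk k x y / ‖x‖ ^ (2*k+(n-2)) = zp (((n:ℝ)-2)/2) k c 1 * s ^ k * (‖x‖ ^ (n-2))⁻¹ := by
    intro k
    have h1 : Zk k x y = q ^ k * zp (((n:ℝ)-2)/2) k c 1 := by
      unfold Zk
      rw [hu, ← zp_homog, mul_one, hq, mul_pow]
    rw [h1, hq, hs, pow_add, mul_pow, div_pow, two_mul, pow_add]
    field_simp
  have e2 : Gm (x - y) = (1 - 2 * c * s + s ^ 2) ^ (-(((n:ℝ)-2)/2)) * (‖x‖ ^ (n-2))⁻¹ := by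
    rw [← pow_rpow_half hn hx.le, ← Real.mul_rpow ?_ (by positivity), Gm_eq hn]
    · congr 1
      rw [@norm_sub_sq_real, hu, hsy, hq, hsy]; ring
    · nlinarith [abs_le.1 hc, sq_abs c, sq_nonneg (1 - s)]
  rw [e2]
  simpa only [e1] using hG

/-- homogeneous harmonic functions form a submodule -/
def HHsub (n k : ℕ) : Submodule ℝ (EuclideanSpace ℝ (Fin n) → ℝ) where
  carrier := {Y | HH k Y}
  zero_mem' := by
    refine ⟨contDiff_const, fun c x => by simp, fun x => ?_⟩
    simp [lapE]
  add_mem' := by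
    rintro f g hf hg
    refine ⟨hf.smooth.add hg.smooth, fun c x => ?_, fun x => ?_⟩
    · simp [hf.homog, hg.homog]; ring
    · have := lapE_add (x := x) hf.smooth.contDiffAt hg.smooth.contDiffAt
      rw [hf.harm, hg.harm, add_zero] at this
      exact this
  smul_mem' := by
    rintro c f hf
    refine ⟨contDiff_const.smul hf.smooth, fun c x => ?_, fun x => ?_⟩
    · simp [hf.homog]; ring
    · have := lapE_const_mul (x := x) c hf.smooth.contDiffAt
      rw [hf.harm, mul_zero] at this
      exact this

/-- finite rank kernels -/
def FR {n : ℕ} (Z : EuclideanSpace ℝ (Fin n) → EuclideanSpace ℝ (Fin n) → ℝ) : Prop :=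
  ∃ (N : ℕ) (u v : Fin N → EuclideanSpace ℝ (Fin n) → ℝ), (∀ i, Continuous (v i)) ∧
    ∀ x y, Z x y = ∑ i, u i x * v i y

lemma FR_of {n : ℕ} {ι : Type} [Fintype ι] {Z : EuclideanSpace ℝ (Fin n) → EuclideanSpace ℝ (Fin n) → ℝ}
    (u v : ι → EuclideanSpace ℝ (Fin n) → ℝ) (hv : ∀ i, Continuous (v i))
    (h : ∀ x y, Z x y = ∑ i, u i x * v i y) : FR Z := by
  let e := Fintype.equivFin ι
  refine ⟨Fintype.card ι, fun i => u (e.symm i), fun i => v (e.symm i), fun i => hv _, fun x y => ?_⟩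
  rw [h]
  exact (Equiv.sum_comp e.symm (fun i => u i x * v i y)).symm

lemma FR.add {n : ℕ} {Z Z' : EuclideanSpace ℝ (Fin n) → EuclideanSpace ℝ (Fin n) → ℝ}
    (h : FR Z) (h' : FR Z') : FR (fun x y => Z x y + Z' x y) := by
  obtain ⟨N, u, v, hv, h⟩ := h
  obtain ⟨N', u', v', hv', h'⟩ := h'
  refine FR_of (ι := Fin N ⊕ Fin N') (Sum.elim u u') (Sum.elim v v') ?_ ?_
  · rintro (i | i) <;> simp [hv, hv']
  · intro x y; simp [h, h']

lemma FR.mul {n : ℕ} {Z Z' : EuclideanSpace ℝ (Fin n) → EuclideanSpace ℝ (Fin n) → ℝ}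
    (h : FR Z) (h' : FR Z') : FR (fun x y => Z x y * Z' x y) := by
  obtain ⟨N, u, v, hv, h⟩ := h
  obtain ⟨N', u', v', hv', h'⟩ := h'
  refine FR_of (ι := Fin N × Fin N') (fun i x => u i.1 x * u' i.2 x) (fun i x => v i.1 x * v' i.2 x)
    (fun i => (hv _).mul (hv' _)) ?_
  intro x y; simp only [h, h', Fintype.sum_prod_type, Finset.sum_mul_sum]
  refine Finset.sum_congr rfl fun i _ => Finset.sum_congr rfl fun j _ => ?_
  ring

lemma FR_simple {n : ℕ} (f g : EuclideanSpace ℝ (Fin n) → ℝ) (hg : Continuous g) :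
    FR (fun x y => f x * g y) :=
  FR_of (ι := Unit) (fun _ => f) (fun _ => g) (fun _ => hg) (by simp)

lemma FR_inner {n : ℕ} : FR (fun x y : EuclideanSpace ℝ (Fin n) => inner ℝ x y) := by
  refine ⟨n, fun i x => x i, fun i x => x i, fun i => by fun_prop, fun x y => ?_⟩
  simp [PiLp.inner_apply, mul_comm]

lemma FR_Zk {n : ℕ} : ∀ k, FR (fun x y : EuclideanSpace ℝ (Fin n) => Zk k x y) := by
  intro k
  refine Nat.strong_induction_on k fun k IH => ?_
  rcases k with _ | _ | k
  · have := FR_simple (n := n) (fun _ => 1) (fun _ => 1) continuous_const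
    simpa [Zk, zp] using this
  · have := (FR_simple (n := n) (fun _ => 2 * (((n:ℝ)-2)/2)) (fun _ => 1) continuous_const).mul FR_inner
    simpa [Zk, zp] using this
  · have h1 := (FR_simple (n := n) (fun _ => (2 * (k + 1 + ((n:ℝ)-2)/2) / (k + 2))) (fun _ => 1)
      continuous_const).mul (FR_inner.mul (IH (k+1) (by omega)))
    have h2 := (FR_simple (n := n) (fun _ => (- ((k + ((n:ℝ)-2)) / (k+2)))) (fun _ => 1)
      continuous_const).mul ((FR_simple (n := n) (fun x => ‖x‖^2) (fun x => ‖x‖^2) (by fun_prop)).mul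
        (IH k (by omega)))
    have h3 := h1.add h2
    refine cast ?_ h3
    congr 1
    funext x y
    rw [Zk_rec]; ring

lemma Zk_sep (n k : ℕ) : ∃ (N : ℕ) (Y b : Fin N → EuclideanSpace ℝ (Fin n) → ℝ),
    (∀ i, HH k (Y i)) ∧ (∀ i, Continuous (b i)) ∧ ∀ x y, Zk k x y = ∑ i, Y i x * b i y := by
  obtain ⟨N, u, v, hv, h⟩ := FR_Zk (n := n) k
  obtain ⟨pr, hpr⟩ := LinearMap.exists_leftInverse_of_injective (HHsub n k).subtype
    (LinearMap.ker_eq_bot.2 (HHsub n k).injective_subtype)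
  refine ⟨N, fun i => (pr (u i) : EuclideanSpace ℝ (Fin n) → ℝ), v, fun i => (pr (u i)).2, hv, ?_⟩
  intro x y
  have e1 : (fun x => Zk k x y) = ∑ i, v i y • u i := by
    funext x; have := h x y; simp only at this; rw [this]; simp [mul_comm]
  have e2 : pr (fun x => Zk k x y) = ⟨fun x => Zk k x y, Zk_HH y k⟩ :=
    LinearMap.congr_fun hpr ⟨fun x => Zk k x y, Zk_HH y k⟩
  have e3 : Zk k x y = (pr (fun x => Zk k x y) : EuclideanSpace ℝ (Fin n) → ℝ) x := by rw [e2]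
  rw [e3, e1, map_sum]
  simp [mul_comm]

section P6
open MeasureTheory Topology
open scoped Convolution

lemma conv_unif_bound {n : ℕ} {F G H : Type*} [NormedAddCommGroup F] [NormedSpace ℝ F]
    [NormedAddCommGroup G] [NormedSpace ℝ G] [NormedAddCommGroup H] [NormedSpace ℝ H]
    (L : F →L[ℝ] G →L[ℝ] H) {h : EuclideanSpace ℝ (Fin n) → F} {M : ℝ}
    (hm : AEStronglyMeasurable h volume) (hM : ∀ y, ‖h y‖ ≤ M)
    {k κ : EuclideanSpace ℝ (Fin n) → G} (hk : Integrable k volume) (hκ : Integrable κ volume)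
    (x : EuclideanSpace ℝ (Fin n)) :
    ‖(h ⋆[L, volume] k) x - (h ⋆[L, volume] κ) x‖ ≤ ‖L‖ * M * ∫ z, ‖k z - κ z‖ := by
  have hM0 : 0 ≤ M := (norm_nonneg _).trans (hM 0)
  have hItg : ∀ {k : EuclideanSpace ℝ (Fin n) → G}, Integrable k volume →
      Integrable (fun y => L (h y) (k (x - y))) volume := by
    intro k hk
    have h1 : Integrable (fun y => k (x - y)) volume := hk.comp_sub_left x
    refine Integrable.mono' (g := fun y => ‖L‖ * M * ‖k (x - y)‖) (h1.norm.const_mul _) ?_ ?_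
    · exact L.aestronglyMeasurable_comp₂ hm h1.aestronglyMeasurable
    · refine Eventually.of_forall fun y => ?_
      calc ‖L (h y) (k (x - y))‖ ≤ ‖L‖ * ‖h y‖ * ‖k (x-y)‖ := L.le_opNorm₂ _ _
        _ ≤ _ := by gcongr; exact hM y
  unfold convolution
  rw [← integral_sub (hItg hk) (hItg hκ)]
  have h2 : ∫ z, ‖k z - κ z‖ = ∫ y, ‖k (x - y) - κ (x - y)‖ :=
    (integral_sub_left_eq_self (fun z => ‖k z - κ z‖) volume x).symm
  rw [h2, ← integral_const_mul]
  refine norm_integral_le_of_norm_le (((hk.sub hκ).comp_sub_left x).norm.const_mul _) ?_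
  refine Eventually.of_forall fun y => ?_
  rw [← map_sub]
  calc ‖L (h y) (k (x - y) - κ (x - y))‖ ≤ ‖L‖ * ‖h y‖ * ‖k (x - y) - κ (x - y)‖ := L.le_opNorm₂ _ _
    _ ≤ _ := by gcongr; exact hM y

lemma conv_tendsto_unif {n : ℕ} {F G H : Type*} [NormedAddCommGroup F] [NormedSpace ℝ F]
    [NormedAddCommGroup G] [NormedSpace ℝ G] [NormedAddCommGroup H] [NormedSpace ℝ H]
    (L : F →L[ℝ] G →L[ℝ] H) {h : EuclideanSpace ℝ (Fin n) → F} {M : ℝ}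
    (hm : AEStronglyMeasurable h volume) (hM : ∀ y, ‖h y‖ ≤ M)
    {k : ℕ → EuclideanSpace ℝ (Fin n) → G}
    {κ : EuclideanSpace ℝ (Fin n) → G} (hk : ∀ m, Integrable (k m) volume) (hκ : Integrable κ volume)
    (ht : Tendsto (fun m => ∫ z, ‖k m z - κ z‖) atTop (𝓝 0)) :
    TendstoUniformlyOn (fun m => h ⋆[L, volume] (k m)) (h ⋆[L, volume] κ) atTop univ := by
  rw [Metric.tendstoUniformlyOn_iff]
  intro ε hε
  have h1 := ht.const_mul (‖L‖ * M)
  rw [mul_zero] at h1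
  filter_upwards [h1.eventually (gt_mem_nhds hε)] with m hm' x _
  rw [dist_comm, dist_eq_norm]
  exact (conv_unif_bound L hm hM (hk m) hκ x).trans_lt hm'

/-- kernel which is an L^1 limit of smooth kernels together with the gradient -/
structure GoodKer {n : ℕ} (k : ℕ → EuclideanSpace ℝ (Fin n) → ℝ) (κ : EuclideanSpace ℝ (Fin n) → ℝ)
    (J : EuclideanSpace ℝ (Fin n) → (EuclideanSpace ℝ (Fin n) →L[ℝ] ℝ)) : Prop where
  smooth : ∀ m, ContDiff ℝ 2 (k m)
  supp : ∀ m, HasCompactSupport (k m)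
  int : Integrable κ volume
  intJ : Integrable J volume
  lim : Tendsto (fun m => ∫ z, ‖k m z - κ z‖) atTop (𝓝 0)
  limJ : Tendsto (fun m => ∫ z, ‖fderiv ℝ (k m) z - J z‖) atTop (𝓝 0)

variable {n : ℕ} {k : ℕ → EuclideanSpace ℝ (Fin n) → ℝ} {κ : EuclideanSpace ℝ (Fin n) → ℝ}
    {J : EuclideanSpace ℝ (Fin n) → (EuclideanSpace ℝ (Fin n) →L[ℝ] ℝ)}

lemma GoodKer.intk (hk : GoodKer k κ J) (m : ℕ) : Integrable (k m) volume :=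
  (hk.smooth m).continuous.integrable_of_hasCompactSupport (hk.supp m)

lemma GoodKer.intkJ (hk : GoodKer k κ J) (m : ℕ) : Integrable (fderiv ℝ (k m)) volume :=
  ((hk.smooth m).continuous_fderiv (by norm_num)).integrable_of_hasCompactSupport ((hk.supp m).fderiv ℝ)

lemma bdd_locInt {F : Type*} [NormedAddCommGroup F] {h : EuclideanSpace ℝ (Fin n) → F} {M : ℝ}
    (hm : AEStronglyMeasurable h volume) (hM : ∀ y, ‖h y‖ ≤ M) : LocallyIntegrable h volume := by
  have : LocallyIntegrable (fun _ : EuclideanSpace ℝ (Fin n) => M) volume := locallyIntegrable_const M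
  exact this.mono hm (Eventually.of_forall fun y => (hM y).trans (le_abs_self M))

lemma GoodKer.hasFDerivAt (hk : GoodKer k κ J) {F H : Type*} [NormedAddCommGroup F] [NormedSpace ℝ F]
    [NormedAddCommGroup H] [NormedSpace ℝ H]
    (L : F →L[ℝ] ℝ →L[ℝ] H) {h : EuclideanSpace ℝ (Fin n) → F} {M : ℝ}
    (hm : AEStronglyMeasurable h volume) (hM : ∀ y, ‖h y‖ ≤ M) (x : EuclideanSpace ℝ (Fin n)) :
    HasFDerivAt (h ⋆[L, volume] κ) ((h ⋆[L.precompR (EuclideanSpace ℝ (Fin n)), volume] J) x) x := by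
  refine hasFDerivAt_of_tendstoUniformlyOn isOpen_univ
    (conv_tendsto_unif (L.precompR (EuclideanSpace ℝ (Fin n))) hm hM hk.intkJ hk.intJ hk.limJ)
    (f := fun m => h ⋆[L, volume] (k m)) ?_ ?_ (mem_univ x)
  · intro m x _
    exact (hk.supp m).hasFDerivAt_convolution_right L (bdd_locInt hm hM) ((hk.smooth m).of_le (by norm_num)) x
  · intro x _
    exact (conv_tendsto_unif L hm hM hk.intk hk.int hk.lim).tendsto_at (mem_univ x)

lemma GoodKer.contDiff_one (hk : GoodKer k κ J) {F H : Type*} [NormedAddCommGroup F] [NormedSpace ℝ F]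
    [NormedAddCommGroup H] [NormedSpace ℝ H]
    (L : F →L[ℝ] ℝ →L[ℝ] H) {h : EuclideanSpace ℝ (Fin n) → F} {M : ℝ}
    (hm : AEStronglyMeasurable h volume) (hM : ∀ y, ‖h y‖ ≤ M) :
    ContDiff ℝ 1 (h ⋆[L, volume] κ) := by
  rw [contDiff_one_iff_hasFDerivAt]
  refine ⟨_, ?_, hk.hasFDerivAt L hm hM⟩
  have h1 := conv_tendsto_unif (L.precompR (EuclideanSpace ℝ (Fin n))) hm hM hk.intkJ hk.intJ hk.limJ
  rw [← continuousOn_univ]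
  refine h1.continuousOn (Frequently.of_forall fun m => Continuous.continuousOn ?_)
  exact ((hk.supp m).fderiv ℝ).continuous_convolution_right _ (bdd_locInt hm hM)
    ((hk.smooth m).continuous_fderiv (by norm_num))

/-- scalar bilinear map -/
abbrev mulL : ℝ →L[ℝ] ℝ →L[ℝ] ℝ := ContinuousLinearMap.mul ℝ ℝ

lemma mulL_flip : mulL.flip = mulL := by
  ext; simp

lemma GoodKer.fderiv_conv {h κ : EuclideanSpace ℝ (Fin n) → ℝ} (hκ : LocallyIntegrable κ volume)
    (hc : HasCompactSupport h) (hh : ContDiff ℝ 1 h) (x : EuclideanSpace ℝ (Fin n)) :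
    HasFDerivAt (h ⋆[mulL, volume] κ)
      ((fderiv ℝ h ⋆[(mulL.precompR (EuclideanSpace ℝ (Fin n))).flip, volume] κ) x) x := by
  have h1 := hc.hasFDerivAt_convolution_right mulL hκ hh x
  have e1 : h ⋆[mulL, volume] κ = κ ⋆[mulL, volume] h := by
    conv_lhs => rw [← mulL_flip]
    exact convolution_flip mulL
  rw [e1, convolution_flip]
  exact h1

lemma GoodKer.contDiff_two (hk : GoodKer k κ J) {h : EuclideanSpace ℝ (Fin n) → ℝ}
    (hc : HasCompactSupport h) (hh : ContDiff ℝ 1 h) :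
    ContDiff ℝ 2 (h ⋆[mulL, volume] κ) := by
  have h2 := GoodKer.fderiv_conv hk.int.locallyIntegrable hc hh
  have e : (2 : WithTop ℕ∞) = 1 + 1 := by norm_num
  rw [e, contDiff_succ_iff_fderiv]
  refine ⟨fun x => (h2 x).differentiableAt, by simp, ?_⟩
  have e2 : fderiv ℝ (h ⋆[mulL, volume] κ)
    = (fderiv ℝ h ⋆[(mulL.precompR (EuclideanSpace ℝ (Fin n))).flip, volume] κ) :=
    funext fun x => (h2 x).fderiv
  rw [e2]
  have hc' := hh.continuous_fderiv (by norm_num)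
  obtain ⟨M, hM⟩ := hc'.bounded_above_of_compact_support (hc.fderiv ℝ)
  exact hk.contDiff_one _ hc'.aestronglyMeasurable hM

lemma GoodKer.fderiv_tendsto (hk : GoodKer k κ J) {F H : Type*} [NormedAddCommGroup F] [NormedSpace ℝ F]
    [NormedAddCommGroup H] [NormedSpace ℝ H]
    (L : F →L[ℝ] ℝ →L[ℝ] H) {h : EuclideanSpace ℝ (Fin n) → F} {M : ℝ}
    (hm : AEStronglyMeasurable h volume) (hM : ∀ y, ‖h y‖ ≤ M) (x : EuclideanSpace ℝ (Fin n)) :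
    Tendsto (fun m => fderiv ℝ (h ⋆[L, volume] (k m)) x) atTop (𝓝 (fderiv ℝ (h ⋆[L, volume] κ) x)) := by
  have h4 := (conv_tendsto_unif (L.precompR (EuclideanSpace ℝ (Fin n))) hm hM hk.intkJ hk.intJ hk.limJ).tendsto_at (mem_univ x)
  rw [(hk.hasFDerivAt L hm hM x).fderiv]
  refine h4.congr fun m => ?_
  exact ((hk.supp m).hasFDerivAt_convolution_right L (bdd_locInt hm hM) ((hk.smooth m).of_le (by norm_num)) x).fderiv.symm

lemma GoodKer.lap_tendsto (hk : GoodKer k κ J) {h : EuclideanSpace ℝ (Fin n) → ℝ}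
    (hc : HasCompactSupport h) (hh : ContDiff ℝ 1 h) (x : EuclideanSpace ℝ (Fin n)) :
    Tendsto (fun m => lapE (h ⋆[mulL, volume] (k m)) x) atTop (𝓝 (lapE (h ⋆[mulL, volume] κ) x)) := by
  have hc' := hh.continuous_fderiv (by norm_num)
  obtain ⟨M, hM⟩ := hc'.bounded_above_of_compact_support (hc.fderiv ℝ)
  have h2 := GoodKer.fderiv_conv hk.int.locallyIntegrable hc hh
  have h3 := fun m => GoodKer.fderiv_conv (hk.intk m).locallyIntegrable hc hh
  have h4 := hk.fderiv_tendsto (mulL.precompR (EuclideanSpace ℝ (Fin n))).flip hc'.aestronglyMeasurable hM x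
  rw [← funext fun x => (h2 x).fderiv] at h4
  have e1 := fun m => funext fun x => (h3 m x).fderiv
  simp only [← e1] at h4
  unfold lapE
  refine tendsto_finsetSum _ fun i _ => ?_
  simp only [iteratedFDeriv_two_apply]
  simp only [Matrix.cons_val_zero, Matrix.cons_val_one]
  have h5 : Continuous (fun A : EuclideanSpace ℝ (Fin n) →L[ℝ] EuclideanSpace ℝ (Fin n) →L[ℝ] ℝ => A (EuclideanSpace.single i 1) (EuclideanSpace.single i 1)) := by fun_prop
  exact (h5.tendsto _).comp h4

lemma pd_conv (i : Fin n) {h g : EuclideanSpace ℝ (Fin n) → ℝ} (hh : LocallyIntegrable h volume)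
    (hc : HasCompactSupport g) (hg : ContDiff ℝ 1 g) :
    pd i (h ⋆[mulL, volume] g) = h ⋆[mulL, volume] (pd i g) := by
  funext x
  unfold pd
  rw [(hc.hasFDerivAt_convolution_right mulL hh hg x).fderiv]
  rw [convolution_precompR_apply mulL hh (hc.fderiv ℝ) (hg.continuous_fderiv (by norm_num))]

lemma lapE_conv {h g : EuclideanSpace ℝ (Fin n) → ℝ} (hh : LocallyIntegrable h volume)
    (hc : HasCompactSupport g) (hg : ContDiff ℝ 2 g) (x : EuclideanSpace ℝ (Fin n)) :
    ContDiff ℝ 2 (h ⋆[mulL, volume] g) ∧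
    lapE (h ⋆[mulL, volume] g) x = ∫ y, h y * lapE g (x - y) := by
  have hs : ContDiff ℝ 2 (h ⋆[mulL, volume] g) :=
    hc.contDiff_convolution_right (n := 2) mulL hh hg
  refine ⟨hs, ?_⟩
  rw [lapE_eq_pd hs.contDiffAt]
  have hp : ∀ i, ContDiff ℝ 1 (pd i g) := by
    intro i
    have : ContDiff ℝ 1 (fderiv ℝ g) := hg.fderiv_right (by norm_num)
    unfold pd; fun_prop
  have hpc : ∀ i, HasCompactSupport (pd i g) := by
    intro i
    exact hc.fderiv_apply ℝ (EuclideanSpace.single i 1)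
  have hp2 : ∀ i, HasCompactSupport (pd i (pd i g)) := by
    intro i
    exact (hpc i).fderiv_apply ℝ (EuclideanSpace.single i 1)
  have hp3 : ∀ i, Continuous (pd i (pd i g)) := by
    intro i
    have := (hp i).continuous_fderiv (by norm_num)
    have e : pd i (pd i g) = fun x => fderiv ℝ (pd i g) x (EuclideanSpace.single i 1) := rfl
    rw [e]; fun_prop
  have e1 : ∀ i, pd i (pd i (h ⋆[mulL, volume] g)) x = ∫ y, h y * pd i (pd i g) (x - y) := by
    intro i
    rw [pd_conv i hh hc (hg.of_le (by norm_num)), pd_conv i hh (hpc i) (hp i)]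
    rfl
  simp only [e1]
  rw [← integral_finsetSum]
  · congr 1; funext y
    rw [lapE_eq_pd hg.contDiffAt, Finset.mul_sum]
  · intro i _
    exact (hp2 i).convolutionExists_right mulL hh (hp3 i) x
end P6

section P7
open MeasureTheory Topology
open scoped Convolution

variable {n : ℕ}

/-- regularised Newton kernel -/
def gam (e : ℝ) (z : EuclideanSpace ℝ (Fin n)) : ℝ := (‖z‖^2 + e) ^ (-(((n:ℝ)-2)/2))

/-- its differential -/
def dgam (e : ℝ) (z : EuclideanSpace ℝ (Fin n)) : EuclideanSpace ℝ (Fin n) →L[ℝ] ℝ :=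
  (-((n:ℝ)-2) * (‖z‖^2 + e) ^ (-((n:ℝ)/2))) • innerSL ℝ z

lemma gam_fderiv {e : ℝ} {z : EuclideanSpace ℝ (Fin n)} (h : 0 < ‖z‖^2 + e) :
    HasFDerivAt (gam e) (dgam e z) z := by
  have h1 : HasDerivAt (fun q : ℝ => (q + e) ^ (-(((n:ℝ)-2)/2)))
      ((-(((n:ℝ)-2)/2)) * (‖z‖^2 + e) ^ (-(((n:ℝ)-2)/2) - 1)) (‖z‖^2) := by
    have := ((hasDerivAt_id (‖z‖^2)).add_const e).rpow_const (p := -(((n:ℝ)-2)/2)) (Or.inl h.ne')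
    simpa using this
  have h2 := h1.comp_hasFDerivAt z (hasFDerivAt_normSq z)
  refine h2.congr_fderiv ?_
  unfold dgam
  have e1 : -(((n:ℝ)-2)/2) - 1 = -((n:ℝ)/2) := by ring
  rw [e1]
  ext v; simp; ring

lemma gam_contDiffAt {m : WithTop ℕ∞} {e : ℝ} {z : EuclideanSpace ℝ (Fin n)} (h : 0 < ‖z‖^2 + e) :
    ContDiffAt ℝ m (gam e) z := by
  have h1 : ContDiffAt ℝ m (fun q : ℝ => (q + e) ^ (-(((n:ℝ)-2)/2))) (‖z‖^2) :=
    (contDiffAt_id.add contDiffAt_const).rpow_const_of_ne h.ne'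
  exact contDiffAt_radial h1

lemma gam_lap {e : ℝ} {z : EuclideanSpace ℝ (Fin n)} (h : 0 < ‖z‖^2 + e) :
    lapE (gam e) z = -(n * ((n:ℝ)-2)) * e * (‖z‖^2 + e) ^ (-(((n:ℝ)+2)/2)) := by
  have h1 : ContDiffAt ℝ 2 (fun q : ℝ => (q + e) ^ (-(((n:ℝ)-2)/2))) (‖z‖^2) :=
    (contDiffAt_id.add contDiffAt_const).rpow_const_of_ne h.ne'
  have h2 := lapE_radial (x := z) h1
  have e0 : gam e = fun y : EuclideanSpace ℝ (Fin n) => (‖y‖^2 + e) ^ (-(((n:ℝ)-2)/2)) := rfl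
  rw [e0, h2]
  have d1 : ∀ s q : ℝ, 0 < q + e → HasDerivAt (fun q : ℝ => (q+e)^s) (s * (q+e)^(s-1)) q := by
    intro s q hq
    simpa using ((hasDerivAt_id q).add_const e).rpow_const (p := s) (Or.inl hq.ne')
  have ev : ∀ᶠ q in 𝓝 (‖z‖^2), 0 < q + e :=
    (continuousAt_id.add continuousAt_const).eventually (lt_mem_nhds h)
  have d2 : deriv (fun q : ℝ => (q+e)^(-(((n:ℝ)-2)/2))) =ᶠ[𝓝 (‖z‖^2)]
      fun q => (-(((n:ℝ)-2)/2)) * (q+e)^(-(((n:ℝ)-2)/2) - 1) := by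
    filter_upwards [ev] with q hq using (d1 _ q hq).deriv
  rw [d2.deriv_eq, d2.eq_of_nhds, ((d1 _ _ h).const_mul _).deriv]
  have e1 : -(((n:ℝ)-2)/2) - 1 = -(((n:ℝ)+2)/2) + 1 := by ring
  have e2 : -(((n:ℝ)-2)/2) - 1 - 1 = -(((n:ℝ)+2)/2) := by ring
  rw [e2, e1, Real.rpow_add h, Real.rpow_one]
  ring

/-- cut-off -/
def psi : ContDiffBump (0 : EuclideanSpace ℝ (Fin n)) := ⟨3, 4, by norm_num, by norm_num⟩

def kG (e : ℝ) (z : EuclideanSpace ℝ (Fin n)) : ℝ := psi z * gam e z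
def jG (e : ℝ) (z : EuclideanSpace ℝ (Fin n)) : EuclideanSpace ℝ (Fin n) →L[ℝ] ℝ :=
  psi z • dgam e z + gam e z • fderiv ℝ psi z

lemma psi_cd {m : ℕ∞} : ContDiff ℝ m (psi : EuclideanSpace ℝ (Fin n) → ℝ) := psi.contDiff

lemma kG_fderiv {e : ℝ} {z : EuclideanSpace ℝ (Fin n)} (h : 0 < ‖z‖^2 + e) :
    HasFDerivAt (kG e) (jG e z) z :=
  HasFDerivAt.mul ((psi_cd (m := 1)).differentiable (by norm_num) z).hasFDerivAt (gam_fderiv h)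

lemma kG_zero {e : ℝ} {z : EuclideanSpace ℝ (Fin n)} (h : 4 < ‖z‖) : kG e z = 0 ∧ jG e z = 0 := by
  have h0 : ∀ w : EuclideanSpace ℝ (Fin n), 4 < ‖w‖ → psi w = 0 := by
    intro w hw
    refine psi.zero_of_le_dist ?_
    rw [dist_zero_right]; exact hw.le
  have h1 : fderiv ℝ psi z = 0 := by
    have : (psi : EuclideanSpace ℝ (Fin n) → ℝ) =ᶠ[𝓝 z] fun _ => 0 := by
      filter_upwards [continuous_norm.continuousAt.eventually (lt_mem_nhds h)] with w hw using h0 w hw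
    rw [this.fderiv_eq]; simp
  simp [kG, jG, h0 z h, h1]

lemma kG_bound (hn : 3 ≤ n) : ∃ C : ℝ, 0 ≤ C ∧ ∀ e : ℝ, 0 ≤ e → ∀ z : EuclideanSpace ℝ (Fin n), z ≠ 0 →
    ‖kG e z‖ ≤ indicator (ball 0 5) (fun z => C * ‖z‖ ^ (-((n:ℝ)-1))) z ∧
    ‖jG e z‖ ≤ indicator (ball 0 5) (fun z => C * ‖z‖ ^ (-((n:ℝ)-1))) z := by
  have hn' : (3:ℝ) ≤ n := by exact_mod_cast hn
  obtain ⟨B, hB⟩ := ((psi_cd (n := n) (m := 1)).continuous_fderiv (by norm_num)).bounded_above_of_compact_support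
    ((psi (n := n)).hasCompactSupport.fderiv ℝ)
  have hB0 : 0 ≤ B := (norm_nonneg _).trans (hB 0)
  have hC0 : 0 ≤ 5 + (((n:ℝ)-2) + 5 * B) := by linarith
  refine ⟨5 + (((n:ℝ)-2) + 5 * B), hC0, fun e he z hz => ?_⟩
  by_cases hzb : 4 < ‖z‖
  · rw [(kG_zero hzb).1, (kG_zero hzb).2]
    simp only [norm_zero]
    constructor <;> exact indicator_nonneg (fun w _ => mul_nonneg hC0 (by positivity)) z
  have hzn : 0 < ‖z‖ := norm_pos_iff.2 hz
  rw [indicator_of_mem (by rw [mem_ball_zero_iff]; linarith)]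
  set r := ‖z‖ with hr
  have hp0 : 0 ≤ psi z := psi.nonneg
  have hp1 : psi z ≤ 1 := psi.le_one
  have g0 : 0 ≤ gam e z := by unfold gam; positivity
  have g1 : gam e z ≤ 5 * r ^ (-((n:ℝ)-1)) := by
    unfold gam
    calc (‖z‖^2 + e) ^ (-(((n:ℝ)-2)/2)) ≤ (‖z‖^2) ^ (-(((n:ℝ)-2)/2)) := by
          apply Real.rpow_le_rpow_of_nonpos (by positivity) (by linarith) (by linarith)
      _ = r ^ (-((n:ℝ)-2)) := by
          rw [← hr, ← Real.rpow_natCast, ← Real.rpow_mul hzn.le]; congr 1; push_cast; ring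
      _ = r * r ^ (-((n:ℝ)-1)) := by
          nth_rw 2 [← Real.rpow_one r]
          rw [← Real.rpow_add hzn]; congr 1; ring
      _ ≤ _ := by gcongr; linarith
  have d1 : ‖dgam e z‖ ≤ ((n:ℝ)-2) * r ^ (-((n:ℝ)-1)) := by
    unfold dgam
    rw [norm_smul, innerSL_apply_norm, Real.norm_eq_abs, abs_mul, abs_neg, abs_of_nonneg (by linarith),
      abs_of_nonneg (by positivity), mul_assoc]
    refine mul_le_mul_of_nonneg_left ?_ (by linarith)
    calc (‖z‖^2 + e) ^ (-((n:ℝ)/2)) * ‖z‖ ≤ (‖z‖^2) ^ (-((n:ℝ)/2)) * ‖z‖ := by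
          gcongr ?_ * _
          apply Real.rpow_le_rpow_of_nonpos (by positivity) (by linarith) (by linarith)
      _ = r ^ (-(n:ℝ)) * r ^ (1:ℝ) := by
          rw [← hr, ← Real.rpow_natCast, ← Real.rpow_mul hzn.le, Real.rpow_one]; congr 2; push_cast; ring
      _ = r ^ (-((n:ℝ)-1)) := by
          rw [← Real.rpow_add hzn]; congr 1; ring
  set X := r ^ (-((n:ℝ)-1)) with hX
  have hX0 : 0 ≤ X := by positivity
  constructor
  · unfold kG
    rw [norm_mul, Real.norm_of_nonneg hp0, Real.norm_of_nonneg g0]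
    have : 0 ≤ (((n:ℝ)-2) + 5 * B) * X := by have := sub_nonneg.2 (show (2:ℝ) ≤ n by linarith); positivity
    nlinarith
  · unfold jG
    calc ‖psi z • dgam e z + gam e z • fderiv ℝ psi z‖ ≤ psi z * ‖dgam e z‖ + gam e z * ‖fderiv ℝ psi z‖ := by
          refine (norm_add_le _ _).trans ?_
          rw [norm_smul, norm_smul, Real.norm_of_nonneg hp0, Real.norm_of_nonneg g0]
      _ ≤ 1 * (((n:ℝ)-2) * X) + (5 * X) * B := by
          gcongr
          exact hB z
      _ ≤ _ := by nlinarith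

lemma bd_int (hn : 3 ≤ n) (C : ℝ) :
    Integrable (indicator (ball (0:EuclideanSpace ℝ (Fin n)) 5) (fun z => C * ‖z‖ ^ (-((n:ℝ)-1)))) volume := by
  rw [integrable_indicator_iff measurableSet_ball]
  refine integrableOn_ball_of_norm_le_rpow (C := |C|) (α := (n:ℝ)-1) (by simp; omega) (by simp) ?_ ?_
  · refine Eventually.of_forall fun z => ?_
    rw [norm_mul, Real.norm_eq_abs, Real.norm_of_nonneg (by positivity)]
  · exact (Measurable.const_mul (by fun_prop) C).aestronglyMeasurable

lemma kG_meas (e : ℝ) : AEStronglyMeasurable (kG (n := n) e) volume := by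
  have : Measurable (psi : EuclideanSpace ℝ (Fin n) → ℝ) := psi.continuous.measurable
  unfold kG gam
  exact (Measurable.mul this (by fun_prop)).aestronglyMeasurable

lemma jG_meas (e : ℝ) : AEStronglyMeasurable (jG (n := n) e) volume := by
  have h1 : Continuous (psi : EuclideanSpace ℝ (Fin n) → ℝ) := psi.continuous
  have h2 := ((psi_cd (n := n) (m := 1)).continuous_fderiv (by norm_num))
  have h3 : Continuous (fun z : EuclideanSpace ℝ (Fin n) => innerSL ℝ z) := (innerSL ℝ).continuous
  have m1 : AEStronglyMeasurable (fun z : EuclideanSpace ℝ (Fin n) => -((n:ℝ)-2) * (‖z‖^2 + e) ^ (-((n:ℝ)/2))) volume :=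
    (Measurable.const_mul (by fun_prop) _).aestronglyMeasurable
  have m2 : AEStronglyMeasurable (gam (n := n) e) volume := by
    unfold gam; exact Measurable.aestronglyMeasurable (by fun_prop)
  have m3 : AEStronglyMeasurable (dgam (n := n) e) volume := m1.smul h3.aestronglyMeasurable
  exact (h1.aestronglyMeasurable.smul m3).add (m2.smul h2.aestronglyMeasurable)

lemma ae_ne_zero (hn : 3 ≤ n) : ∀ᵐ z : EuclideanSpace ℝ (Fin n), z ≠ 0 := by
  have : Nontrivial (EuclideanSpace ℝ (Fin n)) :=
    Module.nontrivial_of_finrank_pos (R := ℝ) (by simp; omega)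
  exact Measure.ae_ne volume 0

/-- the sequence of regularised kernels -/
def kS (m : ℕ) : EuclideanSpace ℝ (Fin n) → ℝ := kG (1 / ((m:ℝ) + 1))

lemma kS_good (hn : 3 ≤ n) : GoodKer (n := n) kS (kG 0) (jG 0) := by
  obtain ⟨C, hC, hb⟩ := kG_bound hn
  have hae := ae_ne_zero (n := n) hn
  have hpos : ∀ m : ℕ, 0 < 1 / ((m:ℝ) + 1) := fun m => by positivity
  have hlim : Tendsto (fun m : ℕ => 1 / ((m:ℝ)+1)) atTop (𝓝 0) := tendsto_one_div_add_atTop_nhds_zero_nat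
  have hfd : ∀ m, fderiv ℝ (kS (n := n) m) = jG (1 / ((m:ℝ)+1)) := fun m =>
    funext fun z => (kG_fderiv (by have := hpos m; positivity)).fderiv
  have hcont : ∀ (s : ℝ) (z : EuclideanSpace ℝ (Fin n)), z ≠ 0 →
      Tendsto (fun m : ℕ => (‖z‖^2 + 1 / ((m:ℝ)+1)) ^ s) atTop (𝓝 ((‖z‖^2 + 0)^s)) := by
    intro s z hz
    have hz' := norm_pos_iff.2 hz
    exact (tendsto_const_nhds.add hlim).rpow_const (Or.inl (by positivity))
  refine ⟨fun m => ?_, fun m => ?_, ?_, ?_, ?_, ?_⟩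
  · have h1 : ContDiff ℝ 2 (gam (n := n) (1 / ((m:ℝ)+1))) :=
      contDiff_iff_contDiffAt.2 fun z => gam_contDiffAt (by have := hpos m; positivity)
    exact (psi_cd (m := 2)).mul h1
  · exact (psi (n := n)).hasCompactSupport.mul_right
  · exact (bd_int hn C).mono' (kG_meas 0) (by filter_upwards [hae] with z hz using (hb 0 le_rfl z hz).1)
  · exact (bd_int hn C).mono' (jG_meas 0) (by filter_upwards [hae] with z hz using (hb 0 le_rfl z hz).2)
  · have := tendsto_integral_of_dominated_convergence (μ := volume) (F := fun m z => ‖kS (n := n) m z - kG 0 z‖)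
      (f := fun _ => (0:ℝ)) _ (fun m => ((kG_meas _).sub (kG_meas 0)).norm)
      ((bd_int hn C).add (bd_int hn C)) ?_ ?_
    · simpa using this
    · intro m
      filter_upwards [hae] with z hz
      rw [norm_norm]
      exact (norm_sub_le _ _).trans (add_le_add (hb _ (hpos m).le z hz).1 (hb 0 le_rfl z hz).1)
    · filter_upwards [hae] with z hz
      rw [← tendsto_iff_norm_sub_tendsto_zero]
      exact (hcont _ z hz).const_mul _
  · simp only [hfd]
    have := tendsto_integral_of_dominated_convergence (μ := volume) (F := fun (m:ℕ) z => ‖jG (n := n) (1 / ((m:ℝ)+1)) z - jG 0 z‖)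
      (f := fun _ => (0:ℝ)) _ (fun m => ((jG_meas _).sub (jG_meas 0)).norm)
      ((bd_int hn C).add (bd_int hn C)) ?_ ?_
    · simpa using this
    · intro m
      filter_upwards [hae] with z hz
      rw [norm_norm]
      exact (norm_sub_le _ _).trans (add_le_add (hb _ (hpos m).le z hz).2 (hb 0 le_rfl z hz).2)
    · filter_upwards [hae] with z hz
      rw [← tendsto_iff_norm_sub_tendsto_zero]
      exact ((((hcont _ z hz).const_mul _).smul_const _).const_smul _).add ((hcont _ z hz).smul_const _)

/-- the constant in the Poisson equation -/
def cN (n : ℕ) : ℝ := n * ((n:ℝ)-2) * ∫ w : EuclideanSpace ℝ (Fin n), (1 + ‖w‖^2) ^ (-((n:ℝ)+2)/2)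

lemma cN_int : Integrable (fun w : EuclideanSpace ℝ (Fin n) => (1 + ‖w‖^2) ^ (-((n:ℝ)+2)/2)) volume :=
  integrable_rpow_neg_one_add_norm_sq (by simp)

lemma cN_pos (hn : 3 ≤ n) : 0 < cN n := by
  have hn' : (3:ℝ) ≤ n := by exact_mod_cast hn
  refine mul_pos (mul_pos (by linarith) (by linarith)) ?_
  refine integral_pos_of_integrable_nonneg_nonzero (x := 0) ?_ cN_int (fun w => by positivity) (by simp)
  refine Continuous.rpow_const (by fun_prop) fun w => Or.inl (by positivity)

lemma approx_id (hn : 3 ≤ n) {h : EuclideanSpace ℝ (Fin n) → ℝ} (hh : Continuous h) {M : ℝ} (hM : ∀ y, ‖h y‖ ≤ M)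
    (x : EuclideanSpace ℝ (Fin n)) :
    Tendsto (fun m : ℕ => ∫ y, h y * (-(n * ((n:ℝ)-2)) * (1 / ((m:ℝ)+1)) * (‖x - y‖^2 + 1 / ((m:ℝ)+1)) ^ (-(((n:ℝ)+2)/2))))
      atTop (𝓝 (-cN n * h x)) := by
  have e1 : ∀ e : ℝ, 0 < e → ∫ y, h y * (-(n * ((n:ℝ)-2)) * e * (‖x - y‖^2 + e) ^ (-(((n:ℝ)+2)/2)))
      = -(n * ((n:ℝ)-2)) * ∫ w : EuclideanSpace ℝ (Fin n), h (x - √e • w) * (1 + ‖w‖^2) ^ (-((n:ℝ)+2)/2) := by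
    intro e he
    rw [← integral_sub_left_eq_self _ volume x]
    simp only [sub_sub_cancel]
    have h1 := Measure.integral_comp_smul volume (fun z => h (x - z) * (-(n * ((n:ℝ)-2)) * e * (‖z‖^2 + e) ^ (-(((n:ℝ)+2)/2)))) (√e)
    have hs : 0 < √e := Real.sqrt_pos.2 he
    have hs2 : √e ^ 2 = e := Real.sq_sqrt he.le
    rw [abs_of_pos (by positivity), finrank_euclideanSpace_fin, smul_eq_mul] at h1
    have h2 : ∀ A B : ℝ, A = (√e ^ n)⁻¹ * B → B = √e ^ n * A := by
      intro A B h; rw [h]; field_simp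
    rw [h2 _ _ h1, ← integral_const_mul, ← integral_const_mul]
    congr 1; funext w
    rw [norm_smul, Real.norm_of_nonneg hs.le, mul_pow, hs2]
    have e2 : e * ‖w‖^2 + e = e * (1 + ‖w‖^2) := by ring
    rw [e2, Real.mul_rpow he.le (by positivity)]
    have e3 : -((n:ℝ)+2)/2 = -(((n:ℝ)+2)/2) := by ring
    have e4 : √e ^ n * (e * e ^ (-(((n:ℝ)+2)/2))) = 1 := by
      have : √e ^ n = e ^ ((n:ℝ)/2) := by
        rw [Real.sqrt_eq_rpow, ← Real.rpow_natCast, ← Real.rpow_mul he.le]; congr 1; ring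
      rw [this]
      nth_rw 2 [← Real.rpow_one e]
      rw [← Real.rpow_add he, ← Real.rpow_add he]
      have : (n:ℝ)/2 + (1 + -(((n:ℝ)+2)/2)) = 0 := by ring
      rw [this, Real.rpow_zero]
    rw [e3]
    linear_combination (h (x - √e • w) * (-(n * ((n:ℝ)-2))) * (1 + ‖w‖^2) ^ (-(((n:ℝ)+2)/2))) * e4
  have e2 : -cN n * h x = -(n * ((n:ℝ)-2)) * ∫ w : EuclideanSpace ℝ (Fin n), h x * (1 + ‖w‖^2) ^ (-((n:ℝ)+2)/2) := by
    rw [integral_const_mul]; unfold cN; ring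
  rw [e2]
  have hlim : Tendsto (fun m : ℕ => 1 / ((m:ℝ)+1)) atTop (𝓝 0) := tendsto_one_div_add_atTop_nhds_zero_nat
  have hg : Continuous (fun w : EuclideanSpace ℝ (Fin n) => (1 + ‖w‖^2) ^ (-((n:ℝ)+2)/2)) :=
    Continuous.rpow_const (by fun_prop) fun w => Or.inl (by positivity)
  refine Tendsto.congr (fun m => (e1 _ (by positivity)).symm) (Tendsto.const_mul _ ?_)
  refine tendsto_integral_of_dominated_convergence _ ?_ (cN_int.const_mul M) ?_ ?_
  · intro m
    exact (Continuous.mul (hh.comp (by fun_prop)) hg).aestronglyMeasurable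
  · intro m
    refine Eventually.of_forall fun w => ?_
    rw [norm_mul, Real.norm_of_nonneg (r := (1 + ‖w‖^2) ^ (-((n:ℝ)+2)/2)) (by positivity)]
    gcongr
    exact hM _
  · refine Eventually.of_forall fun w => ?_
    have h3 : Tendsto (fun m : ℕ => x - √(1 / ((m:ℝ)+1)) • w) atTop (𝓝 x) := by
      have h4 := (((Real.continuous_sqrt.tendsto 0).comp hlim).smul_const w).const_sub x
      simpa using h4
    exact ((hh.tendsto x).comp h3).mul_const _

/-- Near part: C^1 compactly supported density. -/
lemma kG_lap (hn : 3 ≤ n) {h : EuclideanSpace ℝ (Fin n) → ℝ}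
    (hc : HasCompactSupport h) (hh : ContDiff ℝ 1 h) (x : EuclideanSpace ℝ (Fin n))
    (hx : ∀ y, h y ≠ 0 → ‖x - y‖ < 3) :
    lapE (h ⋆[mulL, volume] (kG 0)) x = -cN n * h x := by
  have hk := kS_good (n := n) hn
  obtain ⟨M, hM⟩ := hh.continuous.bounded_above_of_compact_support hc
  refine tendsto_nhds_unique (hk.lap_tendsto hc hh x) ?_
  refine (approx_id hn hh.continuous hM x).congr fun m => ?_
  rw [(lapE_conv hh.continuous.locallyIntegrable (hk.supp m) (hk.smooth m) x).2]
  congr 1; funext y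
  by_cases hy : h y = 0
  · simp [hy]
  congr 1
  rw [← gam_lap (by positivity)]
  refine lapE_congr ?_
  filter_upwards [isOpen_ball.mem_nhds (mem_ball_zero_iff.2 (hx y hy))] with w hw
  have : psi w = 1 := psi.one_of_mem_closedBall (ball_subset_closedBall hw)
  simp [kS, kG, this]
end P7

section P8
open MeasureTheory Topology
open scoped Convolution

variable {n : ℕ}

/-- Newton potential -/
def NP (f : EuclideanSpace ℝ (Fin n) → ℝ) (x : EuclideanSpace ℝ (Fin n)) : ℝ := ∫ y, Gm (x - y) * f y

lemma bump_mul_contDiff {m : ℕ∞} {Ω : Set (EuclideanSpace ℝ (Fin n))} (hΩ : IsOpen Ω)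
    {x₀ : EuclideanSpace ℝ (Fin n)} (χ : ContDiffBump x₀) (hχ : closedBall x₀ χ.rOut ⊆ Ω)
    {f : EuclideanSpace ℝ (Fin n) → ℝ} (hf : ContDiffOn ℝ m f Ω) :
    ContDiff ℝ m (fun y => χ y * f y) := by
  rw [contDiff_iff_contDiffAt]
  intro y
  by_cases hy : y ∈ Ω
  · exact χ.contDiff.contDiffAt.mul (hf.contDiffAt (hΩ.mem_nhds hy))
  · have hy2 : y ∈ (closedBall x₀ χ.rOut)ᶜ := fun h => hy (hχ h)
    have : (fun y => χ y * f y) =ᶠ[𝓝 y] fun _ => 0 := by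
      filter_upwards [isClosed_closedBall.isOpen_compl.mem_nhds hy2] with w hw
      have : χ w = 0 := χ.zero_of_le_dist (by
        simp only [mem_compl_iff, mem_closedBall, not_le] at hw; exact hw.le)
      simp [this]
    exact contDiffAt_const.congr_of_eventuallyEq this

lemma newton_split (hn : 3 ≤ n) {f : EuclideanSpace ℝ (Fin n) → ℝ} {Ω : Set (EuclideanSpace ℝ (Fin n))}
    (hΩ : IsOpen Ω) (hΩ1 : Ω ⊆ ball 0 1) (hf : Integrable f volume) (hs : ∀ y, y ∉ ball (0:EuclideanSpace ℝ (Fin n)) 1 → f y = 0)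
    (hcont : ContinuousOn f Ω) {x₀ : EuclideanSpace ℝ (Fin n)} (hx₀ : x₀ ∈ Ω) :
    ∃ (χ : ContDiffBump x₀) (v : EuclideanSpace ℝ (Fin n) → ℝ), closedBall x₀ χ.rOut ⊆ Ω ∧
      ContDiff ℝ 2 v ∧ lapE v x₀ = 0 ∧
      NP f =ᶠ[𝓝 x₀] fun x => ((fun y => χ y * f y) ⋆[mulL, volume] (kG 0)) x + v x := by
  obtain ⟨δ, hδ, hδΩ⟩ := Metric.nhds_basis_closedBall.mem_iff.1 (hΩ.mem_nhds hx₀)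
  let χ : ContDiffBump x₀ := ⟨δ/2, δ, by positivity, by linarith⟩
  let η : ContDiffBump (0 : EuclideanSpace ℝ (Fin n)) := ⟨δ/8, δ/4, by positivity, by linarith⟩
  let kF : EuclideanSpace ℝ (Fin n) → ℝ := fun z => (1 - η z) * kG 0 z
  have hχΩ : closedBall x₀ χ.rOut ⊆ Ω := hδΩ
  have hkc : HasCompactSupport kF := by
    exact ((psi (n := n)).hasCompactSupport.mul_right).mul_left
  have hkF : ContDiff ℝ 2 kF := by
    rw [contDiff_iff_contDiffAt]
    intro z
    by_cases hz : z = 0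
    · have : kF =ᶠ[𝓝 z] fun _ => 0 := by
        rw [hz]
        filter_upwards [η.eventuallyEq_one] with w hw
        simp [kF, hw]
      exact contDiffAt_const.congr_of_eventuallyEq this
    · have hz' := norm_pos_iff.2 hz
      exact (contDiffAt_const.sub (η.contDiff (n := 2)).contDiffAt).mul
        ((psi_cd (m := 2)).contDiffAt.mul (gam_contDiffAt (by positivity)))
  have hf2 : Integrable (fun y => (1 - χ y) * f y) volume := by
    refine hf.bdd_mul (c := 1) (continuous_const.sub χ.continuous).aestronglyMeasurable
      (Eventually.of_forall fun y => ?_)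
    have h1 := χ.nonneg (x := y); have h2 := χ.le_one (x := y)
    rw [Real.norm_eq_abs, abs_le]; constructor <;> linarith
  have hl := fun x => lapE_conv hf2.locallyIntegrable hkc hkF x
  refine ⟨χ, (fun y => (1 - χ y) * f y) ⋆[mulL, volume] kF, hχΩ, (hl 0).1, ?_, ?_⟩
  · rw [(hl x₀).2]
    have : ∀ y, (1 - χ y) * f y * lapE kF (x₀ - y) = 0 := by
      intro y
      by_cases hy : f y = 0
      · simp [hy]
      by_cases hy2 : 1 - χ y = 0
      · simp [hy2]
      have hy1 : ‖y‖ < 1 := by by_contra h; exact hy (hs y (by simpa using h))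
      have hx1 : ‖x₀‖ < 1 := by simpa using hΩ1 hx₀
      have hd : δ / 2 < ‖x₀ - y‖ := by
        by_contra h
        apply hy2
        rw [χ.one_of_mem_closedBall, sub_self]
        rw [mem_closedBall, dist_comm, dist_eq_norm]; exact not_lt.1 h
      have hd2 : ‖x₀ - y‖ < 3 := by linarith [norm_sub_le x₀ y]
      have e1 : kF =ᶠ[𝓝 (x₀ - y)] gam 0 := by
        filter_upwards [isOpen_ball.mem_nhds (mem_ball_zero_iff.2 hd2),
          continuous_norm.continuousAt.eventually (lt_mem_nhds hd)] with w hw hw2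
        have h1 : psi w = 1 := psi.one_of_mem_closedBall (ball_subset_closedBall hw)
        have h2 : η w = 0 := η.zero_of_le_dist (by rw [dist_zero_right]; show δ/4 ≤ _; linarith)
        simp [kF, kG, h1, h2]
      rw [lapE_congr e1, gam_lap (by have : 0 < ‖x₀ - y‖ := by linarith
                                     positivity)]
      ring
    simp only [this, integral_zero]
  · filter_upwards [hΩ.mem_nhds hx₀, isOpen_ball.mem_nhds (mem_ball_self (show 0 < δ/4 by positivity))] with x hx hx2
    have hx1 : ‖x‖ < 1 := by simpa using hΩ1 hx
    have hfc : Continuous (fun y => χ y * f y) :=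
      (bump_mul_contDiff (m := 0) hΩ χ hχΩ (contDiffOn_zero.2 hcont)).continuous
    have i1 : Integrable (fun y => (χ y * f y) * kG 0 (x - y)) volume := by
      have hg := ((kS_good (n := n) hn).int).comp_sub_left x
      obtain ⟨M, hM⟩ := hfc.bounded_above_of_compact_support χ.hasCompactSupport.mul_right
      exact hg.bdd_mul (c := M) hfc.aestronglyMeasurable (Eventually.of_forall hM)
    have i2 : Integrable (fun y => ((1 - χ y) * f y) * kF (x - y)) volume :=
      hkc.convolutionExists_right mulL hf2.locallyIntegrable hkF.continuous x
    show NP f x = (∫ y, (χ y * f y) * kG 0 (x - y)) + ∫ y, ((1 - χ y) * f y) * kF (x - y)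
    rw [← integral_add i1 i2]
    unfold NP
    congr 1; funext y
    by_cases hy : f y = 0
    · simp [hy]
    have hy1 : ‖y‖ < 1 := by by_contra h; exact hy (hs y (by simpa using h))
    have hd2 : ‖x - y‖ < 3 := by linarith [norm_sub_le x y]
    have hG : kG 0 (x - y) = Gm (x - y) := by
      have h1 : psi (x - y) = 1 := psi.one_of_mem_closedBall (by rw [mem_closedBall_zero_iff]; exact hd2.le)
      rw [kG, h1, one_mul, Gm_eq hn, gam, add_zero]
    by_cases hy2 : 1 - χ y = 0
    · have : χ y = 1 := by linarith
      simp [this, hG, mul_comm]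
    have hd : δ / 2 < ‖x₀ - y‖ := by
      by_contra h
      apply hy2
      rw [χ.one_of_mem_closedBall, sub_self]
      rw [mem_closedBall, dist_comm, dist_eq_norm]; exact not_lt.1 h
    have hx3 : ‖x₀ - x‖ < δ/4 := by rw [← dist_eq_norm, dist_comm]; exact hx2
    have hd3 : δ / 4 ≤ ‖x - y‖ := by
      have := norm_add_le (x₀ - x) (x - y)
      rw [sub_add_sub_cancel] at this; linarith
    have h2 : η (x - y) = 0 := η.zero_of_le_dist (by rw [dist_zero_right]; exact hd3)
    simp only [kF, h2, hG]; ring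

theorem newton_C1 (hn : 3 ≤ n) {f : EuclideanSpace ℝ (Fin n) → ℝ} {Ω : Set (EuclideanSpace ℝ (Fin n))}
    (hΩ : IsOpen Ω) (hΩ1 : Ω ⊆ ball 0 1) (hf : Integrable f volume) (hs : ∀ y, y ∉ ball (0:EuclideanSpace ℝ (Fin n)) 1 → f y = 0)
    (hcont : ContinuousOn f Ω) : ContDiffOn ℝ 1 (NP f) Ω := by
  intro x₀ hx₀
  obtain ⟨χ, v, hχ, hv, -, he⟩ := newton_split hn hΩ hΩ1 hf hs hcont hx₀
  have hfc : Continuous (fun y => χ y * f y) :=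
    (bump_mul_contDiff (m := 0) hΩ χ hχ (contDiffOn_zero.2 hcont)).continuous
  obtain ⟨M, hM⟩ := hfc.bounded_above_of_compact_support χ.hasCompactSupport.mul_right
  have h1 := (kS_good (n := n) hn).contDiff_one mulL hfc.aestronglyMeasurable hM
  exact ((h1.add (hv.of_le (by norm_num))).contDiffAt.congr_of_eventuallyEq he).contDiffWithinAt

theorem newton_C2 (hn : 3 ≤ n) {f : EuclideanSpace ℝ (Fin n) → ℝ} {Ω : Set (EuclideanSpace ℝ (Fin n))}
    (hΩ : IsOpen Ω) (hΩ1 : Ω ⊆ ball 0 1) (hf : Integrable f volume) (hs : ∀ y, y ∉ ball (0:EuclideanSpace ℝ (Fin n)) 1 → f y = 0)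
    (hC : ContDiffOn ℝ 1 f Ω) {x₀ : EuclideanSpace ℝ (Fin n)} (hx₀ : x₀ ∈ Ω) :
    ContDiffAt ℝ 2 (NP f) x₀ ∧ lapE (NP f) x₀ = -cN n * f x₀ := by
  obtain ⟨χ, v, hχ, hv, hv0, he⟩ := newton_split hn hΩ hΩ1 hf hs hC.continuousOn hx₀
  have hfc := bump_mul_contDiff (m := 1) hΩ χ hχ hC
  have hcs : HasCompactSupport (fun y => χ y * f y) := χ.hasCompactSupport.mul_right
  have h2 := (kS_good (n := n) hn).contDiff_two hcs hfc
  refine ⟨(h2.add hv).contDiffAt.congr_of_eventuallyEq he, ?_⟩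
  rw [lapE_congr he, lapE_add h2.contDiffAt hv.contDiffAt, hv0, kG_lap hn hcs hfc x₀, χ.one_of_mem_closedBall]
  · ring
  · simp [χ.rIn_pos.le]
  · intro y hy
    have hy1 : ‖y‖ < 1 := by
      by_contra h; apply hy; simp [hs y (by simpa using h)]
    have hx1 : ‖x₀‖ < 1 := by simpa using hΩ1 hx₀
    linarith [norm_sub_le x₀ y]
end P8

section P9
open MeasureTheory Topology

variable {n : ℕ}

/-- normalised zonal terms -/
def TT (k : ℕ) (e z : EuclideanSpace ℝ (Fin n)) : ℝ := Zk k e z / (max ‖e‖ ‖z‖) ^ (2*k+(n-2))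

def sgm (z : EuclideanSpace ℝ (Fin n)) : ℝ := min ‖z‖ ‖z‖⁻¹

def qgm (z : EuclideanSpace ℝ (Fin n)) : ℝ := ((max 1 ‖z‖) ^ (n-2))⁻¹

def Glm (l : ℝ) (e z : EuclideanSpace ℝ (Fin n)) : ℝ := if ‖z‖ < 1 then Gm (e - l • z) else Gm (z - l • e)

lemma sgm_nonneg (z : EuclideanSpace ℝ (Fin n)) : 0 ≤ sgm z := le_min (norm_nonneg _) (by positivity)

lemma sgm_le_one (z : EuclideanSpace ℝ (Fin n)) : sgm z ≤ 1 := by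
  unfold sgm
  rcases le_total ‖z‖ 1 with h | h
  · exact (min_le_left _ _).trans h
  · exact (min_le_right _ _).trans (inv_le_one_of_one_le₀ h)

lemma sgm_lt_one {z : EuclideanSpace ℝ (Fin n)} (h : ‖z‖ ≠ 1) : sgm z < 1 := by
  unfold sgm
  rcases lt_or_gt_of_ne h with h | h
  · exact (min_le_left _ _).trans_lt h
  · exact (min_le_right _ _).trans_lt (inv_lt_one_of_one_lt₀ h)

lemma qgm_nonneg (z : EuclideanSpace ℝ (Fin n)) : 0 ≤ qgm z := by unfold qgm; positivity

lemma sgm_of_le {z : EuclideanSpace ℝ (Fin n)} (h0 : z ≠ 0) (h : ‖z‖ ≤ 1) : sgm z = ‖z‖ :=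
  min_eq_left (h.trans ((one_le_inv₀ (norm_pos_iff.2 h0)).2 h))

lemma sgm_of_ge {z : EuclideanSpace ℝ (Fin n)} (h : 1 ≤ ‖z‖) : sgm z = ‖z‖⁻¹ :=
  min_eq_right ((inv_le_one_of_one_le₀ h).trans h)

lemma TT_bound (hn : 3 ≤ n) {e z : EuclideanSpace ℝ (Fin n)} (he : ‖e‖ = 1) (hz : z ≠ 0) (k : ℕ) :
    |TT k e z| ≤ BB (((n:ℝ)-2)/2) k * sgm z ^ k * qgm z := by
  have hb := Zk_bound hn k e z
  rw [he, one_mul] at hb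
  have hz0 := norm_pos_iff.2 hz
  unfold TT qgm
  rw [he, abs_div, abs_of_nonneg (by positivity : (0:ℝ) ≤ (max 1 ‖z‖) ^ (2*k+(n-2)))]
  rcases le_total ‖z‖ 1 with h | h
  · rw [sgm_of_le hz h, max_eq_left h]; simpa using hb
  · rw [sgm_of_ge h, max_eq_right h, div_le_iff₀ (by positivity)]
    refine hb.trans (le_of_eq ?_)
    rw [pow_add, two_mul, pow_add, inv_pow]
    field_simp

lemma TT_sum (hn : 3 ≤ n) {e z : EuclideanSpace ℝ (Fin n)} (he : ‖e‖ = 1) (hz : ‖z‖ ≠ 1) {l : ℝ}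
    (h0 : 0 ≤ l) (h1 : l ≤ 1) : HasSum (fun k => l ^ k * TT k e z) (Glm l e z) := by
  unfold Glm TT
  rcases lt_or_gt_of_ne hz with h | h
  · rw [if_pos h]
    have : ‖l • z‖ < ‖e‖ := by
      rw [norm_smul, he, Real.norm_of_nonneg h0]
      nlinarith [norm_nonneg z]
    have := Zk_gen hn this
    simp only [Zk_homog_right, he, one_pow, div_one] at this
    simpa only [he, max_eq_left h.le, one_pow, div_one] using this
  · rw [if_neg (by linarith)]
    have : ‖l • e‖ < ‖z‖ := by
      rw [norm_smul, he, Real.norm_of_nonneg h0]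
      nlinarith [norm_nonneg z]
    have := Zk_gen hn this
    simp only [Zk_homog_right] at this
    simp only [he, max_eq_right h.le]
    convert this using 2 with k
    rw [Zk_symm k e z, mul_div_assoc]

lemma Glm_one {e z : EuclideanSpace ℝ (Fin n)} : Glm 1 e z = Gm (e - z) := by
  unfold Glm Gm
  rw [one_smul, one_smul, norm_sub_rev z e, ite_self]

lemma Gm_le_of {v w : EuclideanSpace ℝ (Fin n)} (hv : v ≠ 0) (h : ‖v‖ ≤ 2 * ‖w‖) :
    Gm w ≤ 2 ^ (n-2) * Gm v := by
  unfold Gm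
  have hv := norm_pos_iff.2 hv
  have hw : 0 < ‖w‖ := by linarith
  rw [← div_eq_mul_inv, le_div_iff₀ (by positivity), ← div_eq_inv_mul, div_le_iff₀ (by positivity), ← mul_pow]
  exact pow_le_pow_left₀ hv.le h _

lemma Glm_le {e z : EuclideanSpace ℝ (Fin n)} (he : ‖e‖ = 1) (hz : ‖z‖ ≠ 1) {l : ℝ}
    (h0 : 0 ≤ l) (h1 : l ≤ 1) : Glm l e z ≤ 2 ^ (n-2) * Gm (e - z) := by
  have hez : e - z ≠ 0 := by
    intro h; apply hz; rw [← sub_eq_zero.1 h, he]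
  unfold Glm
  split_ifs with h
  · apply Gm_le_of hez
    have e1 : e - z = (e - l • z) - (1 - l) • z := by module
    have e2 : ‖e‖ ≤ ‖e - l • z‖ + ‖l • z‖ := by
      have := norm_add_le (e - l • z) (l • z); simpa using this
    have e3 : ‖e - z‖ ≤ ‖e - l • z‖ + ‖(1 - l) • z‖ := by
      rw [e1]; exact norm_sub_le _ _
    rw [norm_smul, Real.norm_of_nonneg h0, he] at e2
    rw [norm_smul, Real.norm_of_nonneg (by linarith)] at e3
    nlinarith [norm_nonneg z]
  · apply Gm_le_of hez
    push Not at h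
    have e1 : e - z = (1 - l) • e - (z - l • e) := by module
    have e2 : ‖z‖ ≤ ‖z - l • e‖ + ‖l • e‖ := by
      have := norm_add_le (z - l • e) (l • e); simpa using this
    have e3 : ‖e - z‖ ≤ ‖(1 - l) • e‖ + ‖z - l • e‖ := by
      rw [e1]; exact norm_sub_le _ _
    rw [norm_smul, Real.norm_of_nonneg h0, he] at e2
    rw [norm_smul, Real.norm_of_nonneg (by linarith), he] at e3
    nlinarith [norm_nonneg z]

lemma tail_bound (hn : 3 ≤ n) {m D : ℕ} (hmD : m ≤ D)
    {f : ℕ → ℝ} {S s l : ℝ} (hf : HasSum f S) (h0 : 0 ≤ l) (h1 : l < 1)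
    (hq : ∀ k, D ≤ k → |f k| ≤ BB (((n:ℝ)-2)/2) k * l ^ (k - m) * s) :
    |S - ∑ k ∈ Finset.range D, f k| ≤ (∑' k, BB (((n:ℝ)-2)/2) (k+D) * l ^ (k + (D - m))) * s := by
  have hsum : Summable (fun k => BB (((n:ℝ)-2)/2) (k+D) * l ^ (k + (D - m))) := by
    rcases h0.eq_or_lt with h | h
    · subst h
      apply summable_of_ne_finset_zero (s := {0})
      intro b hb
      rw [zero_pow, mul_zero]
      simp at hb; omega
    · have := (summable_nat_add_iff D).2 (BB_summable (half_pos' hn) h0 h1)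
      have := this.mul_right ((l ^ m)⁻¹)
      refine this.congr fun k => ?_
      have : k + D = k + (D - m) + m := by omega
      rw [mul_assoc]; congr 1
      rw [this, pow_add l _ m]; field_simp
  have h2 : S - ∑ k ∈ Finset.range D, f k = ∑' k, f (k + D) := by
    rw [← hf.tsum_eq, ← hf.summable.sum_add_tsum_nat_add D]; ring
  rw [h2, ← Real.norm_eq_abs, ← tsum_mul_right]
  apply tsum_of_norm_bounded (hsum.mul_right s).hasSum
  intro k
  have := hq (k + D) (by omega)
  rwa [show k + D - m = k + (D - m) by omega] at this

/-- the remainder `∑_{k ≥ m} (1 - l^k) T_k` -/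
def Arem (m : ℕ) (e : EuclideanSpace ℝ (Fin n)) (l : ℝ) (z : EuclideanSpace ℝ (Fin n)) : ℝ :=
  Gm (e - z) - Glm l e z - ∑ k ∈ Finset.range m, (1 - l ^ k) * TT k e z

lemma Arem_sum (hn : 3 ≤ n) {e z : EuclideanSpace ℝ (Fin n)} (he : ‖e‖ = 1) (hz : ‖z‖ ≠ 1) {l : ℝ}
    (h0 : 0 ≤ l) (h1 : l ≤ 1) :
    HasSum (fun k => (1 - l ^ k) * TT k e z) (Gm (e - z) - Glm l e z) := by
  have a1 := TT_sum hn he hz zero_le_one le_rfl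
  rw [Glm_one] at a1
  have a2 := TT_sum hn he hz h0 h1
  have a3 := a1.sub a2
  have : (fun k => (1 - l ^ k) * TT k e z) = fun k => 1 ^ k * TT k e z - l ^ k * TT k e z := by
    ext k; rw [one_pow]; ring
  rw [this]; exact a3

lemma Arem_bound1 (hn : 3 ≤ n) (m : ℕ) : ∃ C : ℝ, 0 ≤ C ∧ ∀ (e z : EuclideanSpace ℝ (Fin n)), ‖e‖ = 1 → z ≠ 0 →
    sgm z ≤ 1/2 → ∀ l, 0 ≤ l → l ≤ 1 → |Arem m e l z| ≤ C * (sgm z ^ m * qgm z) := by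
  refine ⟨∑' k, BB (((n:ℝ)-2)/2) (k+m) * (1/2) ^ (k + (m - m)), tsum_nonneg fun k => mul_nonneg (BB_nonneg (half_pos' hn) _) (pow_nonneg (by norm_num) _),
    fun e z he hz hs l h0 h1 => ?_⟩
  have hz1 : ‖z‖ ≠ 1 := by
    intro h
    rw [sgm_of_ge h.ge, h] at hs; norm_num at hs
  refine tail_bound (l := 1/2) hn (le_refl m) (Arem_sum hn he hz1 h0 h1) (by norm_num) (by norm_num) fun k hk => ?_
  rw [abs_mul]
  have h2 : |1 - l ^ k| ≤ 1 := by
    have := pow_le_one₀ h0 h1 (n := k)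
    have := pow_nonneg h0 k
    rw [abs_le]; constructor <;> linarith
  have hb := BB_nonneg (half_pos' hn) k
  calc |1 - l ^ k| * |TT k e z| ≤ 1 * (BB (((n:ℝ)-2)/2) k * sgm z ^ k * qgm z) := by
        gcongr
        exact TT_bound hn he hz k
    _ = BB (((n:ℝ)-2)/2) k * sgm z ^ (k-m) * (sgm z ^ m * qgm z) := by
        rw [← Nat.sub_add_cancel hk, pow_add]; simp; ring
    _ ≤ _ := by
        have := sgm_nonneg z
        have := qgm_nonneg z
        gcongr

lemma Arem_bound2 (hn : 3 ≤ n) (m : ℕ) : ∃ C : ℝ, 0 ≤ C ∧ ∀ (e z : EuclideanSpace ℝ (Fin n)), ‖e‖ = 1 → z ≠ 0 →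
    ‖z‖ ≠ 1 → ∀ l, 0 ≤ l → l ≤ 1 → |Arem m e l z| ≤ (1 + 2 ^ (n-2)) * Gm (e - z) + C := by
  refine ⟨∑ k ∈ Finset.range m, BB (((n:ℝ)-2)/2) k, Finset.sum_nonneg fun k _ => BB_nonneg (half_pos' hn) k,
    fun e z he hz hz1 l h0 h1 => ?_⟩
  unfold Arem
  have g1 := Glm_le he hz1 h0 h1
  have g0 : 0 ≤ Glm l e z := by unfold Glm; split_ifs <;> exact Gm_nonneg _
  have g2 := Gm_nonneg (e - z)
  have : |∑ k ∈ Finset.range m, (1 - l ^ k) * TT k e z| ≤ ∑ k ∈ Finset.range m, BB (((n:ℝ)-2)/2) k := by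
    refine (Finset.abs_sum_le_sum_abs _ _).trans (Finset.sum_le_sum fun k _ => ?_)
    rw [abs_mul]
    have h2 : |1 - l ^ k| ≤ 1 := by
      have := pow_le_one₀ h0 h1 (n := k)
      have := pow_nonneg h0 k
      rw [abs_le]; constructor <;> linarith
    have hb := BB_nonneg (half_pos' hn) k
    have hq : qgm z ≤ 1 := by
      unfold qgm
      exact inv_le_one_of_one_le₀ (one_le_pow₀ (le_max_left _ _))
    have := sgm_nonneg z
    have := qgm_nonneg z
    have := pow_le_one₀ (sgm_nonneg z) (sgm_le_one z) (n := k)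
    calc |1 - l ^ k| * |TT k e z| ≤ 1 * (BB (((n:ℝ)-2)/2) k * sgm z ^ k * qgm z) := by
          gcongr
          exact TT_bound hn he hz k
      _ ≤ 1 * (BB (((n:ℝ)-2)/2) k * 1 * 1) := by gcongr
      _ = _ := by ring
  rw [abs_le] at this ⊢
  constructor <;> nlinarith

lemma Arem_tendsto (m : ℕ) {e z : EuclideanSpace ℝ (Fin n)} (he : ‖e‖ = 1)
    (hz1 : ‖z‖ ≠ 1) : Tendsto (fun l => Arem m e l z) (𝓝[<] 1) (𝓝 0) := by
  have hez : e - z ≠ 0 := by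
    intro h; apply hz1; rw [← sub_eq_zero.1 h, he]
  have hc : ContinuousAt (fun l => Arem m e l z) 1 := by
    unfold Arem Glm
    refine ContinuousAt.sub (ContinuousAt.sub continuousAt_const ?_) (by fun_prop)
    split_ifs
    · unfold Gm
      refine ContinuousAt.inv₀ (by fun_prop) ?_
      rw [one_smul]; exact pow_ne_zero _ (norm_ne_zero_iff.2 hez)
    · unfold Gm
      refine ContinuousAt.inv₀ (by fun_prop) ?_
      rw [one_smul, norm_sub_rev]
      exact pow_ne_zero _ (norm_ne_zero_iff.2 hez)
  have h0 : Arem m e 1 z = 0 := by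
    unfold Arem; rw [Glm_one]; simp
  have := hc.tendsto
  rw [h0] at this
  exact this.mono_left nhdsWithin_le_nhds

lemma sgm_meas : Measurable (sgm : EuclideanSpace ℝ (Fin n) → ℝ) := by
  unfold sgm; fun_prop

lemma qgm_meas : Measurable (qgm : EuclideanSpace ℝ (Fin n) → ℝ) := by
  unfold qgm; fun_prop

lemma Gm_meas : Measurable (Gm : EuclideanSpace ℝ (Fin n) → ℝ) := by
  unfold Gm; fun_prop

lemma TT_meas (k : ℕ) (e : EuclideanSpace ℝ (Fin n)) : Measurable (TT k e) := by
  unfold TT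
  have h : Continuous (fun z => Zk k e z) := by
    simp_rw [Zk_symm k e]
    exact (Zk_contDiff_left k e).continuous
  exact h.measurable.div (by fun_prop)

lemma Arem_meas (m : ℕ) (e : EuclideanSpace ℝ (Fin n)) (l : ℝ) : Measurable (Arem m e l) := by
  unfold Arem Glm
  refine Measurable.sub (Measurable.sub (Gm_meas.comp (by fun_prop)) ?_) ?_
  · refine Measurable.ite (measurableSet_lt (by fun_prop) (by fun_prop)) (Gm_meas.comp (by fun_prop)) (Gm_meas.comp (by fun_prop))
  · exact Finset.measurable_sum _ fun k _ => (TT_meas k e).const_mul _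

/-- weight integrable -/
lemma wt_int (hn : 3 ≤ n) (γ : ℝ) {m : ℕ} (hm : |γ| + n + 1 ≤ m) :
    Integrable (fun z : EuclideanSpace ℝ (Fin n) => sgm z ^ m * qgm z * ‖z‖ ^ γ) volume := by
  have h1 : Integrable (fun z : EuclideanSpace ℝ (Fin n) => (1 + ‖z‖^2) ^ (-((n:ℝ)+1)/2)) volume :=
    integrable_rpow_neg_one_add_norm_sq (by simp)
  refine (h1.const_mul (2 ^ (((n:ℝ)+1)/2))).mono'
    (((sgm_meas.pow_const m).mul qgm_meas).mul (by fun_prop)).aestronglyMeasurable ?_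
  filter_upwards [ae_ne_zero hn] with z hz
  have hz0 := norm_pos_iff.2 hz
  have s0 := sgm_nonneg z
  have q0 := qgm_nonneg z
  have hq1 : qgm z ≤ 1 := by
      unfold qgm
      exact inv_le_one_of_one_le₀ (one_le_pow₀ (le_max_left _ _))
  rw [Real.norm_of_nonneg (by positivity), neg_div, Real.rpow_neg (by positivity), ← div_eq_mul_inv,
    ← Real.div_rpow (by norm_num) (by positivity)]
  have hg1 := neg_abs_le γ
  have hg2 := le_abs_self γ
  have hn0 : (0:ℝ) ≤ n := Nat.cast_nonneg n
  rcases le_total ‖z‖ 1 with h | h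
  · have : sgm z ^ m * qgm z * ‖z‖ ^ γ ≤ 1 := by
      rw [sgm_of_le hz h, mul_right_comm, ← Real.rpow_natCast, ← Real.rpow_add hz0]
      have := Real.rpow_le_one hz0.le h (z := m + γ) (by linarith)
      have := Real.rpow_nonneg hz0.le (m + γ)
      nlinarith
    refine this.trans (Real.one_le_rpow ?_ (by positivity))
    rw [le_div_iff₀ (by positivity)]; nlinarith
  · calc sgm z ^ m * qgm z * ‖z‖ ^ γ ≤ sgm z ^ m * 1 * ‖z‖ ^ γ := by gcongr
      _ = ‖z‖ ^ (-(m:ℝ) + γ) := by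
        rw [sgm_of_ge h, mul_one, Real.rpow_add hz0, Real.rpow_neg hz0.le, Real.rpow_natCast, inv_pow]
      _ ≤ ‖z‖ ^ (-((n:ℝ)+1)) := Real.rpow_le_rpow_of_exponent_le h (by linarith)
      _ = ((‖z‖^2)⁻¹) ^ (((n:ℝ)+1)/2) := by
        rw [← Real.rpow_natCast, ← Real.rpow_neg hz0.le, ← Real.rpow_mul hz0.le]
        congr 1; push_cast; ring
      _ ≤ _ := by
        gcongr
        rw [inv_le_comm₀ (by positivity) (by positivity), inv_div]
        nlinarith
end P9

section P10
open MeasureTheory Topology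

variable {n : ℕ}

def GG (D : ℕ) (κ : ℕ → ℝ) (x y : EuclideanSpace ℝ (Fin n)) : ℝ :=
  Gm (x - y) - ∑ k ∈ Finset.range D, κ k * TT k x y

lemma Gm_ind_int (hn : 3 ≤ n) (e : EuclideanSpace ℝ (Fin n)) (r : ℝ) :
    Integrable (fun z : EuclideanSpace ℝ (Fin n) => (ball (0:EuclideanSpace ℝ (Fin n)) r).indicator Gm (e - z)) volume := by
  have : IntegrableOn (Gm : EuclideanSpace ℝ (Fin n) → ℝ) (ball 0 r) volume := by
    refine integrableOn_ball_of_norm_le_rpow (C := 1) (α := (n:ℝ)-2) (by simp; omega) (by simp) ?_ Gm_meas.aestronglyMeasurable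
    refine Eventually.of_forall fun x => ?_
    rw [Real.norm_of_nonneg (Gm_nonneg x), one_mul]
    unfold Gm
    rw [Real.rpow_neg (norm_nonneg x), ← Real.rpow_natCast, Nat.cast_sub (by omega)]
    simp
  exact ((integrable_indicator_iff measurableSet_ball).2 this).comp_sub_left e

lemma ae_norm_ne (hn : 3 ≤ n) : ∀ᵐ z : EuclideanSpace ℝ (Fin n), ‖z‖ ≠ 1 := by
  have : Nontrivial (EuclideanSpace ℝ (Fin n)) := by
    apply Module.nontrivial_of_finrank_pos (R := ℝ); simp; omega
  have := Measure.addHaar_sphere (volume : Measure (EuclideanSpace ℝ (Fin n))) 0 1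
  rw [ae_iff]
  convert this using 2
  ext z; simp

lemma Arem_dom (hn : 3 ≤ n) (γ : ℝ) {m : ℕ} (hm : |γ| + n + 1 ≤ m) {e : EuclideanSpace ℝ (Fin n)}
    (he : ‖e‖ = 1) : ∃ b : EuclideanSpace ℝ (Fin n) → ℝ, Integrable b volume ∧
    ∀ l, 0 ≤ l → l ≤ 1 → ∀ᵐ z, ‖(|Arem m e l z| * ‖z‖ ^ γ)‖ ≤ b z := by
  obtain ⟨C1, hC1, h1⟩ := Arem_bound1 hn m
  obtain ⟨C2, hC2, h2⟩ := Arem_bound2 hn m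
  refine ⟨fun z => (C1 + C2 * 2 ^ m * 2 ^ (n-2)) * (sgm z ^ m * qgm z * ‖z‖ ^ γ) +
    ((1 + 2 ^ (n-2)) * 2 ^ |γ|) * (ball (0:EuclideanSpace ℝ (Fin n)) 3).indicator Gm (e - z),
    ((wt_int hn γ hm).const_mul _).add ((Gm_ind_int hn e 3).const_mul _), fun l h0 hl1 => ?_⟩
  filter_upwards [ae_ne_zero hn, ae_norm_ne hn] with z hz hz1
  have hz0 := norm_pos_iff.2 hz
  have s0 := sgm_nonneg z
  have q0 := qgm_nonneg z
  have i0 : 0 ≤ (ball (0:EuclideanSpace ℝ (Fin n)) 3).indicator Gm (e - z) :=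
    indicator_nonneg (fun _ _ => Gm_nonneg _) _
  rw [Real.norm_of_nonneg (by positivity)]
  rcases le_or_gt (sgm z) (1/2) with hs | hs
  · have := h1 e z he hz hs l h0 hl1
    calc |Arem m e l z| * ‖z‖ ^ γ ≤ C1 * (sgm z ^ m * qgm z) * ‖z‖ ^ γ := by gcongr
      _ = C1 * (sgm z ^ m * qgm z * ‖z‖ ^ γ) + 0 := by ring
      _ ≤ _ := by
        gcongr ?_ * _ + ?_
        · have : 0 ≤ C2 * 2 ^ m * 2 ^ (n-2) := by positivity
          linarith
        · positivity
  · have hA := h2 e z he hz hz1 l h0 hl1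
    have hs1 : 1/2 < ‖z‖ := hs.trans_le (min_le_left _ _)
    have hs2 : ‖z‖ < 2 := by
      have : 1/2 < ‖z‖⁻¹ := hs.trans_le (min_le_right _ _)
      rw [lt_inv_comm₀ (by norm_num) hz0] at this; linarith
    have hin : e - z ∈ ball (0:EuclideanSpace ℝ (Fin n)) 3 := by
      rw [mem_ball_zero_iff]
      have := norm_sub_le e z
      linarith
    rw [indicator_of_mem hin]
    have hzg : ‖z‖ ^ γ ≤ 2 ^ |γ| := by
      rcases le_total 1 ‖z‖ with h | h
      · calc ‖z‖ ^ γ ≤ ‖z‖ ^ |γ| := Real.rpow_le_rpow_of_exponent_le h (le_abs_self γ)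
          _ ≤ 2 ^ |γ| := by gcongr
      · calc ‖z‖ ^ γ ≤ ‖z‖ ^ (-|γ|) := Real.rpow_le_rpow_of_exponent_ge hz0 h (neg_abs_le γ)
          _ = (‖z‖⁻¹) ^ |γ| := by rw [Real.rpow_neg hz0.le, Real.inv_rpow hz0.le]
          _ ≤ 2 ^ |γ| := by
            gcongr
            rw [inv_le_comm₀ hz0 (by norm_num)]; linarith
    have hC : C2 ≤ C2 * 2 ^ m * 2 ^ (n-2) * (sgm z ^ m * qgm z) := by
      have a1 : 1 ≤ 2 ^ m * sgm z ^ m := by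
        rw [← mul_pow]; exact one_le_pow₀ (by linarith)
      have a2 : 1 ≤ 2 ^ (n-2) * qgm z := by
        unfold qgm
        rw [← div_eq_mul_inv, le_div_iff₀ (by positivity), one_mul]
        gcongr
        exact max_le (by norm_num) hs2.le
      have := one_le_mul_of_one_le_of_one_le a1 a2
      nlinarith
    have g0 := Gm_nonneg (e - z)
    calc |Arem m e l z| * ‖z‖ ^ γ ≤ ((1 + 2 ^ (n-2)) * Gm (e - z) + C2) * ‖z‖ ^ γ := by gcongr
      _ = C2 * ‖z‖ ^ γ + (1 + 2 ^ (n-2)) * ‖z‖ ^ γ * Gm (e - z) := by ring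
      _ ≤ C2 * 2 ^ m * 2 ^ (n-2) * (sgm z ^ m * qgm z) * ‖z‖ ^ γ + (1 + 2 ^ (n-2)) * 2 ^ |γ| * Gm (e - z) := by
        gcongr
      _ ≤ _ := by
        have : 0 ≤ C1 * (sgm z ^ m * qgm z * ‖z‖ ^ γ) := by positivity
        nlinarith

lemma estB_unit (hn : 3 ≤ n) (γ : ℝ) {ε : ℝ} (hε : 0 < ε) {e : EuclideanSpace ℝ (Fin n)}
    (he : ‖e‖ = 1) : ∃ (D : ℕ) (κ : ℕ → ℝ), Integrable (fun z => |GG D κ e z| * ‖z‖ ^ γ) volume ∧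
      ∫ z, |GG D κ e z| * ‖z‖ ^ γ ≤ ε := by
  obtain ⟨m, hm⟩ := exists_nat_ge (|γ| + n + 1)
  obtain ⟨b, hb, hdom⟩ := Arem_dom hn γ hm he
  have hwm : Measurable (fun z : EuclideanSpace ℝ (Fin n) => ‖z‖ ^ γ) := by fun_prop
  have hmeas : ∀ l, AEStronglyMeasurable (fun z => |Arem m e l z| * ‖z‖ ^ γ) volume := fun l =>
    (((Arem_meas m e l).abs).mul hwm).aestronglyMeasurable
  have hlim : Tendsto (fun l => ∫ z, |Arem m e l z| * ‖z‖ ^ γ) (𝓝[<] 1) (𝓝 (∫ z : EuclideanSpace ℝ (Fin n), 0)) := by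
    refine tendsto_integral_filter_of_dominated_convergence b (Eventually.of_forall hmeas) ?_ hb ?_
    · filter_upwards [Ioo_mem_nhdsLT (show (0:ℝ) < 1 by norm_num)] with l hl
      exact hdom l hl.1.le hl.2.le
    · filter_upwards [ae_norm_ne hn] with z hz
      have := ((Arem_tendsto m he hz).abs).mul_const (‖z‖ ^ γ)
      simpa using this
  rw [integral_zero] at hlim
  obtain ⟨l, hl, hl2⟩ := ((Ioo_mem_nhdsLT (show (0:ℝ) < 1 by norm_num))|> fun h =>
    ((eventually_mem_set.2 h).and (hlim.eventually (gt_mem_nhds (half_pos hε)))).exists)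
  set I := ∫ z : EuclideanSpace ℝ (Fin n), sgm z ^ m * qgm z * ‖z‖ ^ γ with hI
  have hI0 : 0 ≤ I := integral_nonneg fun z => by
    have s0 := sgm_nonneg z
    have q0 := qgm_nonneg z
    positivity
  have htl := tendsto_sum_nat_add (fun k => BB (((n:ℝ)-2)/2) k * l ^ k)
  have hδ : 0 < ε / (2 * (I + 1)) := by positivity
  obtain ⟨D, hD1, hD2⟩ := ((htl.eventually (gt_mem_nhds hδ)).and (eventually_ge_atTop m)).exists
  set τ := ∑' k, BB (((n:ℝ)-2)/2) (k + D) * l ^ (k + D) with hτ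
  have hAint : Integrable (fun z => |Arem m e l z| * ‖z‖ ^ γ) volume :=
    hb.mono' (hmeas l) (hdom l hl.1.le hl.2.le)
  let κ : ℕ → ℝ := fun k => (if k < m then 1 - l ^ k else 0) + l ^ k
  have hGG : ∀ z, GG D κ e z = Arem m e l z + (Glm l e z - ∑ k ∈ Finset.range D, l ^ k * TT k e z) := by
    intro z
    have : ∑ k ∈ Finset.range D, κ k * TT k e z = ∑ k ∈ Finset.range m, (1 - l ^ k) * TT k e z +
        ∑ k ∈ Finset.range D, l ^ k * TT k e z := by
      simp only [κ, add_mul, Finset.sum_add_distrib, ite_mul, zero_mul]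
      congr 1
      rw [← Finset.sum_filter]
      congr 1
      ext k; simp; omega
    unfold GG Arem
    rw [this]; ring
  have hpt : ∀ᵐ z, |GG D κ e z| * ‖z‖ ^ γ ≤ |Arem m e l z| * ‖z‖ ^ γ + τ * (sgm z ^ m * qgm z * ‖z‖ ^ γ) := by
    filter_upwards [ae_ne_zero hn, ae_norm_ne hn] with z hz hz1
    have h2 : |Glm l e z - ∑ k ∈ Finset.range D, l ^ k * TT k e z| ≤ τ * (sgm z ^ m * qgm z) := by
      refine tail_bound (m := 0) hn (Nat.zero_le D) (TT_sum hn he hz1 hl.1.le hl.2.le) hl.1.le hl.2 fun k hk => ?_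
      have := TT_bound hn he hz k
      have hb := BB_nonneg (half_pos' hn) k
      have hl0 := hl.1
      have q0 := qgm_nonneg z
      have hp := pow_le_pow_of_le_one (sgm_nonneg z) (sgm_le_one z) (hD2.trans hk)
      rw [abs_mul, abs_of_nonneg (by positivity), Nat.sub_zero]
      calc l ^ k * |TT k e z| ≤ l ^ k * (BB (((n:ℝ)-2)/2) k * sgm z ^ m * qgm z) := by
            gcongr
            exact this.trans (by gcongr)
        _ = _ := by ring
    rw [hGG]
    have := abs_add_le (Arem m e l z) (Glm l e z - ∑ k ∈ Finset.range D, l ^ k * TT k e z)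
    calc _ ≤ (|Arem m e l z| + τ * (sgm z ^ m * qgm z)) * ‖z‖ ^ γ := by gcongr; linarith
      _ = _ := by ring
  have hbd : Integrable (fun z => |Arem m e l z| * ‖z‖ ^ γ + τ * (sgm z ^ m * qgm z * ‖z‖ ^ γ)) volume :=
    hAint.add ((wt_int hn γ hm).const_mul _)
  have hGm : Measurable (fun z => |GG D κ e z| * ‖z‖ ^ γ) := by
    unfold GG
    refine Measurable.mul (Measurable.abs (Measurable.sub (Gm_meas.comp (by fun_prop))
      (Finset.measurable_sum _ fun k _ => (TT_meas k e).const_mul _))) hwm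
  have hGi : Integrable (fun z => |GG D κ e z| * ‖z‖ ^ γ) volume := by
    refine hbd.mono' hGm.aestronglyMeasurable ?_
    filter_upwards [hpt] with z hz
    rwa [Real.norm_of_nonneg (by positivity)]
  refine ⟨D, κ, hGi, ?_⟩
  refine (integral_mono_ae hGi hbd hpt).trans ?_
  rw [integral_add hAint ((wt_int hn γ hm).const_mul _), integral_const_mul, ← hI]
  have : τ * I ≤ ε / 2 := by
    calc τ * I ≤ ε / (2 * (I + 1)) * I := by gcongr
      _ ≤ ε / 2 := by
        rw [div_mul_eq_mul_div, div_le_div_iff₀ (by positivity) (by norm_num)]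
        nlinarith
  linarith

lemma GG_scale (D : ℕ) (κ : ℕ → ℝ) {r : ℝ} (hr : 0 < r)
    (A : EuclideanSpace ℝ (Fin n) ≃ₗᵢ[ℝ] EuclideanSpace ℝ (Fin n)) (e z : EuclideanSpace ℝ (Fin n)) :
    GG D κ (r • A e) (r • A z) = (r ^ (n-2))⁻¹ * GG D κ e z := by
  have h1 : Gm (r • A e - r • A z) = (r ^ (n-2))⁻¹ * Gm (e - z) := by
    unfold Gm
    rw [← smul_sub, ← map_sub, norm_smul, LinearIsometryEquiv.norm_map, mul_pow, mul_inv, Real.norm_of_nonneg hr.le]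
  have h2 : ∀ k, TT k (r • A e) (r • A z) = (r ^ (n-2))⁻¹ * TT k e z := by
    intro k
    unfold TT
    rw [Zk_homog, Zk_homog_right, norm_smul, norm_smul, LinearIsometryEquiv.norm_map, LinearIsometryEquiv.norm_map,
      Real.norm_of_nonneg hr.le, ← mul_max_of_nonneg _ _ hr.le, mul_pow r, pow_add r, two_mul k, pow_add r k k]
    have : Zk k (A e) (A z) = Zk k e z := by
      unfold Zk; rw [LinearIsometryEquiv.inner_map_map, LinearIsometryEquiv.norm_map, LinearIsometryEquiv.norm_map]
    rw [this]
    have := hr.ne'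
    by_cases h : (max ‖e‖ ‖z‖) ^ (k+k+(n-2)) = 0
    · simp [h]
    · field_simp
  unfold GG
  rw [h1, mul_sub, Finset.mul_sum]
  congr 1
  refine Finset.sum_congr rfl fun k _ => ?_
  rw [h2]; ring

lemma estB (hn : 3 ≤ n) (γ : ℝ) {ε : ℝ} (hε : 0 < ε) : ∃ (D : ℕ) (κ : ℕ → ℝ),
    ∀ x : EuclideanSpace ℝ (Fin n), x ≠ 0 → Integrable (fun y => |GG D κ x y| * ‖y‖ ^ γ) volume ∧
      ∫ y, |GG D κ x y| * ‖y‖ ^ γ ≤ ε * ‖x‖ ^ (γ+2) := by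
  let e : EuclideanSpace ℝ (Fin n) := EuclideanSpace.single ⟨0, by omega⟩ 1
  have he : ‖e‖ = 1 := by simp [e]
  obtain ⟨D, κ, h1, h2⟩ := estB_unit hn γ hε he
  refine ⟨D, κ, fun x hx => ?_⟩
  have hr := norm_pos_iff.2 hx
  set r := ‖x‖ with hrdef
  obtain ⟨A, hA⟩ : ∃ A : EuclideanSpace ℝ (Fin n) ≃ₗᵢ[ℝ] EuclideanSpace ℝ (Fin n), r • A e = x := by
    refine ⟨(ℝ ∙ (e - r⁻¹ • x))ᗮ.reflection, ?_⟩
    rw [Submodule.reflection_sub, smul_inv_smul₀ hr.ne']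
    rw [he, norm_smul, norm_inv, Real.norm_of_nonneg hr.le, inv_mul_cancel₀ hr.ne']
  set f : EuclideanSpace ℝ (Fin n) → ℝ := fun y => |GG D κ x y| * ‖y‖ ^ γ with hf
  have hfe : ∀ z, f (r • A z) = ((r ^ (n-2))⁻¹ * r ^ γ) * (|GG D κ e z| * ‖z‖ ^ γ) := by
    intro z
    have : GG D κ x (r • A z) = (r ^ (n-2))⁻¹ * GG D κ e z := by
      rw [← GG_scale D κ hr A e z, hA]
    simp only [hf]
    rw [this, norm_smul, LinearIsometryEquiv.norm_map, Real.norm_of_nonneg hr.le, Real.mul_rpow hr.le (norm_nonneg z),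
      abs_mul, abs_of_nonneg (by positivity : 0 ≤ (r ^ (n-2))⁻¹)]
    ring
  have hmp := A.measurePreserving
  have hemb : MeasurableEmbedding A := A.toHomeomorph.measurableEmbedding
  have hi : Integrable (fun z => f (r • A z)) volume := by
    simp_rw [hfe]; exact h1.const_mul _
  have hi2 : Integrable (fun w => f (r • w)) volume :=
    (hmp.integrable_comp_emb hemb (g := fun w => f (r • w))).1 hi
  refine ⟨(integrable_comp_smul_iff volume f hr.ne').1 hi2, ?_⟩
  have e1 := Measure.integral_comp_smul_of_nonneg volume f r (hR := hr.le)
  rw [← hmp.integral_comp hemb (fun w => f (r • w))] at e1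
  simp_rw [hfe] at e1
  rw [integral_const_mul, smul_eq_mul, finrank_euclideanSpace_fin] at e1
  have e2 : ∫ y, f y = r ^ n * ((r ^ (n-2))⁻¹ * r ^ γ * ∫ z, |GG D κ e z| * ‖z‖ ^ γ) := by
    rw [e1]; field_simp
  have e3 : r ^ n = r ^ (n-2) * r ^ 2 := by rw [← pow_add]; congr 1; omega
  rw [e2, e3, Real.rpow_add hr, Real.rpow_two]
  have : r ^ (n-2) * r ^ 2 * ((r ^ (n-2))⁻¹ * r ^ γ * ∫ z, |GG D κ e z| * ‖z‖ ^ γ) =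
      (∫ z, |GG D κ e z| * ‖z‖ ^ γ) * (r ^ γ * r ^ 2) := by
    have := hr.ne'
    field_simp
  rw [this]
  gcongr
end P10

section P11
open MeasureTheory Topology

variable {n : ℕ}

/-- integral over the unit sphere at radius `r` -/
def sphI (F : EuclideanSpace ℝ (Fin n) → ℝ) (r : ℝ) : ℝ :=
  ∫ ω : sphere (0 : EuclideanSpace ℝ (Fin n)) 1, F (r • ω.1) ∂(volume : Measure (EuclideanSpace ℝ (Fin n))).toSphere

lemma polar (hn : 3 ≤ n) {F : EuclideanSpace ℝ (Fin n) → ℝ} (hF : Integrable F volume) :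
    IntegrableOn (fun r : ℝ => r ^ (n-1) * sphI F r) (Ioi 0) ∧
    ∫ y, F y = ∫ r in Ioi (0:ℝ), r ^ (n-1) * sphI F r := by
  have : Nontrivial (EuclideanSpace ℝ (Fin n)) := by
    apply Module.nontrivial_of_finrank_pos (R := ℝ); simp; omega
  set μ : Measure (EuclideanSpace ℝ (Fin n)) := volume with hμ
  have hmp := μ.measurePreserving_homeomorphUnitSphereProd
  have hdim : Module.finrank ℝ (EuclideanSpace ℝ (Fin n)) = n := finrank_euclideanSpace_fin
  rw [hdim] at hmp
  have hemb := (homeomorphUnitSphereProd (EuclideanSpace ℝ (Fin n))).measurableEmbedding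
  let G : (sphere (0 : EuclideanSpace ℝ (Fin n)) 1) × (Ioi (0:ℝ)) → ℝ := fun p => F (p.2.1 • p.1.1)
  have hGH : ∀ y : ({0}ᶜ : Set (EuclideanSpace ℝ (Fin n))), G (homeomorphUnitSphereProd _ y) = F y.1 := by
    intro y
    have hy : ‖y.1‖ ≠ 0 := norm_ne_zero_iff.2 y.2
    simp only [G]
    congr 1
    simp [smul_smul, hy]
  have hms : MeasurableSet ({0}ᶜ : Set (EuclideanSpace ℝ (Fin n))) := (measurableSet_singleton _).compl
  have hint1 : Integrable (fun y : ({0}ᶜ : Set (EuclideanSpace ℝ (Fin n))) => F y.1) (μ.comap (↑)) :=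
    (integrableOn_iff_comap_subtypeVal hms).1 hF.integrableOn
  have hint2 : Integrable G (μ.toSphere.prod (Measure.volumeIoiPow (n-1))) := by
    rw [← hmp.integrable_comp_emb hemb]
    refine hint1.congr (Eventually.of_forall fun y => (hGH y).symm)
  have e1 : ∫ y, F y ∂μ = ∫ p, G p ∂(μ.toSphere.prod (Measure.volumeIoiPow (n-1))) := by
    rw [← hmp.integral_comp hemb]
    simp_rw [hGH]
    rw [integral_subtype_comap hms, restrict_compl_singleton]
  have hd : Measurable (fun r : Ioi (0:ℝ) => ENNReal.ofReal (r.1 ^ (n-1))) := by fun_prop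
  have hint3 := hint2.integral_prod_right
  have hsm : ∀ r : Ioi (0:ℝ), (ENNReal.ofReal (r.1 ^ (n-1))).toReal = r.1 ^ (n-1) := fun r =>
    ENNReal.toReal_ofReal (pow_nonneg (le_of_lt r.2) _)
  constructor
  · unfold Measure.volumeIoiPow at hint3
    rw [integrable_withDensity_iff_integrable_smul' hd (by simp)] at hint3
    rw [integrableOn_iff_comap_subtypeVal measurableSet_Ioi]
    refine hint3.congr (Eventually.of_forall fun r => ?_)
    simp only [hsm, smul_eq_mul, comp_apply]
    rfl
  · rw [e1, integral_prod_symm _ hint2]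
    unfold Measure.volumeIoiPow
    rw [integral_withDensity_eq_integral_toReal_smul hd (by simp)]
    simp only [hsm, smul_eq_mul]
    rw [← integral_subtype_comap measurableSet_Ioi]
    rfl

lemma sphI_continuousOn {F : EuclideanSpace ℝ (Fin n) → ℝ} {R : ℝ}
    (hF : ContinuousOn F (ball 0 R \ {0})) : ContinuousOn (sphI F) (Ioo 0 R) := by
  have hK : ContinuousOn (Function.uncurry fun (r : ℝ) (ω : sphere (0 : EuclideanSpace ℝ (Fin n)) 1) => F (r • ω.1)) (Ioo 0 R ×ˢ univ) := by
    refine hF.comp (by fun_prop) ?_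
    rintro ⟨r, ω⟩ ⟨hr, -⟩
    have hω : ‖ω.1‖ = 1 := by simpa using ω.2
    have hr1 : 0 < r := hr.1
    refine ⟨?_, ?_⟩
    · simp only [mem_ball_zero_iff, norm_smul, hω, mul_one, Real.norm_of_nonneg hr1.le]
      exact hr.2
    · simp only [mem_singleton_iff, smul_eq_zero, not_or]
      exact ⟨hr1.ne', fun h => by rw [h] at hω; simp at hω⟩
  have := continuousOn_integral_of_compact_support (μ := (volume : Measure (EuclideanSpace ℝ (Fin n))).toSphere)
    (isCompact_univ (X := sphere (0 : EuclideanSpace ℝ (Fin n)) 1)) hK (fun p x _ h => absurd (mem_univ _) h)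
  exact this

lemma sphI_bound {F : EuclideanSpace ℝ (Fin n) → ℝ} {r B : ℝ} (h : ∀ ω : EuclideanSpace ℝ (Fin n), ‖ω‖ = 1 → |F (r • ω)| ≤ B) :
    |sphI F r| ≤ B * ((volume : Measure (EuclideanSpace ℝ (Fin n))).toSphere univ).toReal := by
  unfold sphI
  rw [← Real.norm_eq_abs]
  refine norm_integral_le_of_norm_le_const (Eventually.of_forall fun ω => ?_)
  exact h ω.1 (by simpa using ω.2)

lemma invpow_deriv (N : ℕ) {q : ℝ} (hq : q ≠ 0) :
    HasDerivAt (fun q : ℝ => (q ^ N)⁻¹) (-(N:ℝ) * (q ^ (N+1))⁻¹) q := by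
  refine ((hasDerivAt_pow N q).inv (pow_ne_zero _ hq)).congr_deriv ?_
  rcases N with _ | N
  · simp
  · rw [Nat.add_sub_cancel]
    field_simp
    ring

/-- one-dimensional calculus for the radial factor -/
lemma radial_m {φ : ℝ → ℝ} {R : ℝ} {N : ℕ} (hItg : IntegrableOn φ (Ioi 0))
    (hc : ContinuousOn φ (Ioo 0 R)) {q : ℝ} (hq : q ∈ Ioo 0 R) :
    let m : ℝ → ℝ := fun q => ∫ r in Ioi (0:ℝ), φ r / (max q r) ^ N
    ContDiffAt ℝ 2 m q ∧ deriv (deriv m) q + (N+1)/q * deriv m q = - N * (q ^ (N+1))⁻¹ * φ q := by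
  intro m
  set Φ : ℝ → ℝ := fun q => ∫ r in (0:ℝ)..q, φ r with hΦ
  have hII : ∀ q, 0 ≤ q → IntervalIntegrable φ volume 0 q := fun q hq0 =>
    (intervalIntegrable_iff_integrableOn_Ioc_of_le hq0).2 (hItg.mono_set Ioc_subset_Ioi_self)
  have hmeas : ∀ q ∈ Ioo 0 R, StronglyMeasurableAtFilter φ (𝓝 q) volume := fun q hq =>
    hc.stronglyMeasurableAtFilter isOpen_Ioo q hq
  have hΦd : ∀ q ∈ Ioo 0 R, HasDerivAt Φ (φ q) q := fun q hq =>
    intervalIntegral.integral_hasDerivAt_right (hII q hq.1.le) (hmeas q hq) (hc.continuousAt (isOpen_Ioo.mem_nhds hq))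
  set ψ : ℝ → ℝ := fun r => φ r / r ^ N with hψ
  have hψc : ContinuousOn ψ (Ioo 0 R) := hc.div (by fun_prop) (fun r hr => pow_ne_zero _ hr.1.ne')
  have hψi : ∀ q0, 0 < q0 → IntegrableOn ψ (Ioi q0) := by
    intro q0 h0
    have : ψ = fun r => (r ^ N)⁻¹ * φ r := by ext r; simp [hψ, div_eq_inv_mul]
    rw [this]
    refine Integrable.bdd_mul (c := (q0 ^ N)⁻¹) (hItg.mono_set (Ioi_subset_Ioi h0.le)) (by fun_prop) ?_
    filter_upwards [ae_restrict_mem measurableSet_Ioi] with r hr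
    have hr : q0 < r := hr
    have hr0 := h0.trans hr
    rw [norm_inv, norm_pow, Real.norm_of_nonneg hr0.le]
    gcongr
  have hmeq : ∀ q0 ∈ Ioo 0 R, ∀ q ∈ Ioo 0 R, m q = (q ^ N)⁻¹ * Φ q + ((∫ r in Ioi q0, ψ r) - ∫ r in q0..q, ψ r) := by
    intro q0 hq0 q hq
    have hi : IntegrableOn (fun r => φ r / (max q r) ^ N) (Ioi 0) := by
      have : (fun r => φ r / (max q r) ^ N) = fun r => ((max q r) ^ N)⁻¹ * φ r := by ext r; simp [div_eq_inv_mul]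
      rw [this]
      refine Integrable.bdd_mul (c := (q ^ N)⁻¹) hItg (by fun_prop) (Eventually.of_forall fun r => ?_)
      have := hq.1
      rw [norm_inv, norm_pow, Real.norm_of_nonneg (this.le.trans (le_max_left _ _))]
      gcongr
      exact le_max_left _ _
    have h1 : m q = (∫ r in (0:ℝ)..q, φ r / (max q r) ^ N) + ∫ r in Ioi q, φ r / (max q r) ^ N :=
      (intervalIntegral.integral_interval_add_Ioi hi (hi.mono_set (Ioi_subset_Ioi hq.1.le))).symm
    have h2 : (∫ r in (0:ℝ)..q, φ r / (max q r) ^ N) = (q ^ N)⁻¹ * Φ q := by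
      rw [hΦ, ← intervalIntegral.integral_const_mul]
      refine intervalIntegral.integral_congr fun r hr => ?_
      rw [uIcc_of_le hq.1.le] at hr
      simp only [max_eq_left hr.2]; rw [div_eq_inv_mul]
    have h3 : (∫ r in Ioi q, φ r / (max q r) ^ N) = ∫ r in Ioi q, ψ r := by
      refine setIntegral_congr_fun measurableSet_Ioi fun r hr => ?_
      simp only [max_eq_right (le_of_lt (mem_Ioi.1 hr)), hψ]
    have h4 := intervalIntegral.integral_interval_add_Ioi (hψi q0 hq0.1) (hψi q hq.1)
    rw [h1, h2, h3, ← h4]; ring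
  have hmd : ∀ q ∈ Ioo 0 R, HasDerivAt m (-(N:ℝ) * (q ^ (N+1))⁻¹ * Φ q) q := by
    intro q hq
    have hq0 : q ≠ 0 := hq.1.ne'
    have d1 : HasDerivAt (fun q : ℝ => (q ^ N)⁻¹) (-(N:ℝ) * (q ^ (N+1))⁻¹) q := invpow_deriv N hq0
    have d2 : HasDerivAt (fun q' => ∫ r in q..q', ψ r) (ψ q) q :=
      intervalIntegral.integral_hasDerivAt_right (by simp) (hψc.stronglyMeasurableAtFilter isOpen_Ioo q hq)
        (hψc.continuousAt (isOpen_Ioo.mem_nhds hq))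
    have d3 := (d1.mul (hΦd q hq)).add ((hasDerivAt_const q (∫ r in Ioi q, ψ r)).sub d2)
    refine (d3.congr_of_eventuallyEq ?_).congr_deriv ?_
    · filter_upwards [isOpen_Ioo.mem_nhds hq] with q' hq'
      exact hmeq q hq q' hq'
    · simp only [hψ]; field_simp; ring
  have hΦ1 : ContDiffOn ℝ 1 Φ (Ioo 0 R) := by
    rw [show (1 : WithTop ℕ∞) = 0 + 1 by norm_num, contDiffOn_succ_iff_deriv_of_isOpen isOpen_Ioo]
    refine ⟨fun q hq => (hΦd q hq).differentiableAt.differentiableWithinAt, by simp, ?_⟩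
    exact contDiffOn_zero.2 (hc.congr fun q hq => (hΦd q hq).deriv)
  have hdm : EqOn (deriv m) (fun q => -(N:ℝ) * (q ^ (N+1))⁻¹ * Φ q) (Ioo 0 R) := fun q hq => (hmd q hq).deriv
  have hm2 : ContDiffOn ℝ 2 m (Ioo 0 R) := by
    rw [show (2 : WithTop ℕ∞) = 1 + 1 by norm_num, contDiffOn_succ_iff_deriv_of_isOpen isOpen_Ioo]
    refine ⟨fun q hq => (hmd q hq).differentiableAt.differentiableWithinAt, by simp, ?_⟩
    refine ContDiffOn.congr ?_ hdm
    refine ContDiffOn.mul (contDiffOn_const.mul (ContDiffOn.inv (by fun_prop) fun q hq => pow_ne_zero _ hq.1.ne')) hΦ1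
  refine ⟨hm2.contDiffAt (isOpen_Ioo.mem_nhds hq), ?_⟩
  have hq0 : q ≠ 0 := hq.1.ne'
  have e2 : deriv (deriv m) q = -(N:ℝ) * (-((N:ℝ)+1) * (q ^ (N+2))⁻¹) * Φ q + -(N:ℝ) * (q ^ (N+1))⁻¹ * φ q := by
    have : deriv m =ᶠ[𝓝 q] (fun q => -(N:ℝ) * (q ^ (N+1))⁻¹ * Φ q) := by
      filter_upwards [isOpen_Ioo.mem_nhds hq] with q' hq'
      exact hdm hq'
    rw [this.deriv_eq]
    have d1 : HasDerivAt (fun q : ℝ => (q ^ (N+1))⁻¹) (-((N:ℝ)+1) * (q ^ (N+2))⁻¹) q := by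
      have := invpow_deriv (N+1) hq0
      push_cast at this; exact this
    exact ((d1.const_mul (-(N:ℝ))).mul (hΦd q hq)).deriv
  rw [e2, hdm hq]
  field_simp
  ring
end P11

section P12
open MeasureTheory Topology

variable {n : ℕ}

lemma Zk_sep2 (n k : ℕ) : ∃ (N : ℕ) (Y b : Fin N → EuclideanSpace ℝ (Fin n) → ℝ) (Cb : ℝ),
    (∀ i, HH k (Y i)) ∧ (∀ i, ContinuousOn (b i) {0}ᶜ) ∧ 0 ≤ Cb ∧ (∀ i y, y ≠ 0 → |b i y| ≤ Cb * ‖y‖ ^ k) ∧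
    ∀ x y, y ≠ 0 → Zk k x y = ∑ i, Y i x * b i y := by
  obtain ⟨N, Y, b, hY, hb, hs⟩ := Zk_sep n k
  have hbd : ∀ i, ∃ C, ∀ y ∈ sphere (0 : EuclideanSpace ℝ (Fin n)) 1, ‖b i y‖ ≤ C := fun i =>
    (isCompact_sphere _ _).exists_bound_of_continuousOn (hb i).continuousOn
  choose C hC using hbd
  refine ⟨N, Y, fun i y => ‖y‖ ^ k * b i (‖y‖⁻¹ • y), ∑ i, |C i|, hY, fun i => ?_, by positivity, fun i y hy => ?_, fun x y hy => ?_⟩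
  · have h1 : ContinuousOn (fun y : EuclideanSpace ℝ (Fin n) => ‖y‖⁻¹ • y) {0}ᶜ :=
      ContinuousOn.smul (continuous_norm.continuousOn.inv₀ fun y hy => norm_ne_zero_iff.2 hy) continuousOn_id
    exact ContinuousOn.mul (by fun_prop) ((hb i).comp_continuousOn h1)
  · have h1 : ‖y‖⁻¹ • y ∈ sphere (0 : EuclideanSpace ℝ (Fin n)) 1 := by
      simp [norm_smul, hy]
    have h2 := hC i _ h1
    rw [abs_mul, abs_of_nonneg (by positivity), mul_comm]
    gcongr
    rw [Real.norm_eq_abs] at h2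
    refine (h2.trans (le_abs_self _)).trans ?_
    exact Finset.single_le_sum (f := fun i => |C i|) (fun i _ => abs_nonneg _) (Finset.mem_univ i)
  · have h1 : y = ‖y‖ • (‖y‖⁻¹ • y) := by rw [smul_inv_smul₀ (norm_ne_zero_iff.2 hy)]
    conv_lhs => rw [h1, Zk_homog_right, hs, Finset.mul_sum]
    refine Finset.sum_congr rfl fun i _ => by ring

/-- the `k`-th truncated potential -/
def Mk (k : ℕ) (g : EuclideanSpace ℝ (Fin n) → ℝ) (x : EuclideanSpace ℝ (Fin n)) : ℝ := ∫ y, TT k x y * g y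

lemma bg_int (hn : 3 ≤ n) {k : ℕ} {b g : EuclideanSpace ℝ (Fin n) → ℝ} {Cb : ℝ} (hb : ContinuousOn b {0}ᶜ)
    (hC : 0 ≤ Cb) (hbd : ∀ y, y ≠ 0 → |b y| ≤ Cb * ‖y‖ ^ k) (hg : Integrable g volume)
    (hs : ∀ y, y ∉ ball (0 : EuclideanSpace ℝ (Fin n)) 1 → g y = 0) :
    Integrable (fun y => b y * g y) volume := by
  have : Nontrivial (EuclideanSpace ℝ (Fin n)) := by
    apply Module.nontrivial_of_finrank_pos (R := ℝ); simp; omega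
  have hbm : AEStronglyMeasurable b volume := by
    have := hb.aestronglyMeasurable (μ := volume) (measurableSet_singleton (0:EuclideanSpace ℝ (Fin n))).compl
    rwa [restrict_compl_singleton] at this
  refine (hg.norm.const_mul Cb).mono' (hbm.mul hg.aestronglyMeasurable) ?_
  filter_upwards [ae_ne_zero hn] with y hy
  by_cases hy1 : y ∈ ball (0 : EuclideanSpace ℝ (Fin n)) 1
  · rw [mem_ball_zero_iff] at hy1
    rw [norm_mul, Real.norm_eq_abs (b y)]
    gcongr
    refine (hbd y hy).trans ?_
    exact mul_le_of_le_one_right hC (pow_le_one₀ (norm_nonneg y) hy1.le)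
  · simp [hs y hy1]

lemma Mk_lap (hn : 3 ≤ n) {k N : ℕ} {Y b : Fin N → EuclideanSpace ℝ (Fin n) → ℝ} {Cb : ℝ}
    (hY : ∀ i, HH k (Y i)) (hb : ∀ i, ContinuousOn (b i) {0}ᶜ) (hC : 0 ≤ Cb)
    (hbd : ∀ i y, y ≠ 0 → |b i y| ≤ Cb * ‖y‖ ^ k)
    (hsep : ∀ x y, y ≠ 0 → Zk k x y = ∑ i, Y i x * b i y)
    {g : EuclideanSpace ℝ (Fin n) → ℝ} (hg : Integrable g volume)
    (hs : ∀ y, y ∉ ball (0 : EuclideanSpace ℝ (Fin n)) 1 → g y = 0) {R : ℝ}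
    (hgc : ContinuousOn g (ball 0 R \ {0})) {x : EuclideanSpace ℝ (Fin n)} (hx : x ∈ ball (0 : EuclideanSpace ℝ (Fin n)) R \ {0}) :
    ContDiffAt ℝ 2 (Mk k g) x ∧ lapE (Mk k g) x =
      - ∑ i, (2 * (k:ℝ) + n - 2) * ((‖x‖ ^ (2*k))⁻¹ * sphI (fun y => b i y * g y) ‖x‖) * Y i x := by
  set F : Fin N → EuclideanSpace ℝ (Fin n) → ℝ := fun i y => b i y * g y with hF
  have hFi : ∀ i, Integrable (F i) volume := fun i => bg_int hn (hb i) hC (hbd i) hg hs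
  have hFc : ∀ i, ContinuousOn (F i) (ball 0 R \ {0}) := fun i =>
    ((hb i).mono (fun y hy => hy.2)).mul hgc
  set φ : Fin N → ℝ → ℝ := fun i r => r ^ (n-1) * sphI (F i) r with hφ
  have hφi : ∀ i, IntegrableOn (φ i) (Ioi 0) := fun i => (polar hn (hFi i)).1
  have hφc : ∀ i, ContinuousOn (φ i) (Ioo 0 R) := fun i => ContinuousOn.mul (by fun_prop) (sphI_continuousOn (hFc i))
  let m : Fin N → ℝ → ℝ := fun i q => ∫ r in Ioi (0:ℝ), φ i r / (max q r) ^ (2*k+(n-2))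
  have hM : ∀ x : EuclideanSpace ℝ (Fin n), x ≠ 0 → Mk k g x = ∑ i, m i ‖x‖ * Y i x := by
    intro x hx
    have hx0 := norm_pos_iff.2 hx
    have hItg : ∀ i, Integrable (fun y => F i y / (max ‖x‖ ‖y‖) ^ (2*k+(n-2))) volume := by
      intro i
      have : (fun y => F i y / (max ‖x‖ ‖y‖) ^ (2*k+(n-2))) = fun y => ((max ‖x‖ ‖y‖) ^ (2*k+(n-2)))⁻¹ * F i y := by
        ext y; rw [div_eq_inv_mul]
      rw [this]
      refine (hFi i).bdd_mul (c := (‖x‖ ^ (2*k+(n-2)))⁻¹) (by fun_prop) (Eventually.of_forall fun y => ?_)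
      rw [norm_inv, norm_pow, Real.norm_of_nonneg (hx0.le.trans (le_max_left _ _))]
      gcongr
      exact le_max_left _ _
    have hm : ∀ i, m i ‖x‖ = ∫ y, F i y / (max ‖x‖ ‖y‖) ^ (2*k+(n-2)) := by
      intro i
      rw [(polar hn (hItg i)).2]
      refine setIntegral_congr_fun measurableSet_Ioi fun r hr => ?_
      have hr : 0 < r := hr
      simp only [hφ, sphI]
      rw [mul_div_assoc]
      congr 1
      rw [← integral_div]
      congr 1
      ext ω
      have hω : ‖ω.1‖ = 1 := by simp
      rw [norm_smul, hω, mul_one, Real.norm_of_nonneg hr.le]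
    simp_rw [hm]
    unfold Mk
    calc ∫ y, TT k x y * g y = ∫ y, ∑ i, F i y / (max ‖x‖ ‖y‖) ^ (2*k+(n-2)) * Y i x := by
          refine integral_congr_ae ?_
          filter_upwards [ae_ne_zero hn] with y hy
          unfold TT
          rw [hsep x y hy, Finset.sum_div, Finset.sum_mul]
          refine Finset.sum_congr rfl fun i _ => ?_
          simp only [hF]; ring
      _ = _ := by
          rw [integral_finsetSum _ fun i _ => (hItg i).mul_const _]
          simp_rw [integral_mul_const]
  have hx0 : x ≠ 0 := hx.2
  have hxq : ‖x‖ ∈ Ioo 0 R := ⟨norm_pos_iff.2 hx0, mem_ball_zero_iff.1 hx.1⟩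
  have hev : Mk k g =ᶠ[𝓝 x] fun y => ∑ i, m i ‖y‖ * Y i y := by
    filter_upwards [isOpen_compl_singleton.mem_nhds hx0] with y hy
    exact hM y hy
  have hrad : ∀ i, ContDiffAt ℝ 2 (m i) ‖x‖ ∧ deriv (deriv (m i)) ‖x‖ + (((2*k+(n-2) : ℕ):ℝ)+1)/‖x‖ * deriv (m i) ‖x‖
    = - ((2*k+(n-2) : ℕ):ℝ) * (‖x‖ ^ (2*k+(n-2)+1))⁻¹ * φ i ‖x‖ := fun i => radial_m (N := 2*k+(n-2)) (hφi i) (hφc i) hxq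
  have hlap := fun i => lapE_normfun_mul (n := n) hx0 (hrad i).1 (hY i)
  refine ⟨ContDiffAt.congr_of_eventuallyEq (ContDiffAt.sum fun i _ => (hlap i).1) hev, ?_⟩
  rw [lapE_congr hev, lapE_sum _ fun i _ => (hlap i).1, ← Finset.sum_neg_distrib]
  refine Finset.sum_congr rfl fun i _ => ?_
  rw [(hlap i).2]
  have h2 := (hrad i).2
  have hcast : ((2*k+(n-2) : ℕ):ℝ) = 2*k + n - 2 := by
    push_cast [Nat.cast_sub (by omega : 2 ≤ n)]; ring
  rw [hcast] at h2
  have e1 : (n:ℝ) - 1 + 2*k = 2*k+n-2+1 := by ring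
  rw [e1, h2]
  have e2 : (‖x‖ ^ (2*k+(n-2)+1))⁻¹ * φ i ‖x‖ = (‖x‖ ^ (2*k))⁻¹ * sphI (F i) ‖x‖ := by
    simp only [hφ]
    rw [show 2*k+(n-2)+1 = 2*k + (n-1) by omega, pow_add]
    have := hxq.1.ne'
    field_simp
  rw [mul_assoc (-(2*(k:ℝ)+n-2)), e2]
  ring
end P12

section P13
open MeasureTheory Topology

lemma tail_deriv {ψ : ℝ → ℝ} {t0 t : ℝ} (hc : ContinuousOn ψ (Ioi t0)) (hi : IntegrableOn ψ (Ioi t0))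
    (ht : t0 < t) : HasDerivAt (fun t => ∫ s in Ioi t, ψ s) (-ψ t) t := by
  have h1 : HasDerivAt (fun t => ∫ s in t0..t, ψ s) (ψ t) t :=
    intervalIntegral.integral_hasDerivAt_right
      ((intervalIntegrable_iff_integrableOn_Ioc_of_le ht.le).2 (hi.mono_set Ioc_subset_Ioi_self))
      (hc.stronglyMeasurableAtFilter isOpen_Ioi t ht) (hc.continuousAt (isOpen_Ioi.mem_nhds ht))
  have h2 : HasDerivAt (fun t => (∫ s in Ioi t0, ψ s) - ∫ s in t0..t, ψ s) (-ψ t) t := by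
    simpa using h1.const_sub (∫ s in Ioi t0, ψ s)
  refine h2.congr_of_eventuallyEq ?_
  filter_upwards [isOpen_Ioi.mem_nhds ht] with s hs
  have := intervalIntegral.integral_interval_add_Ioi hi (hi.mono_set (Ioi_subset_Ioi (le_of_lt hs)))
  linarith

lemma C2_of {h h1 h2 : ℝ → ℝ} {t0 : ℝ} (d1 : ∀ t > t0, HasDerivAt h (h1 t) t)
    (d2 : ∀ t > t0, HasDerivAt h1 (h2 t) t) (hc : ContinuousOn h2 (Ioi t0)) :
    ContDiffOn ℝ 2 h (Ioi t0) ∧ ∀ t > t0, deriv (deriv h) t = h2 t := by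
  have e1 : ∀ t > t0, deriv h t = h1 t := fun t ht => (d1 t ht).deriv
  have ee : ∀ t > t0, deriv h =ᶠ[𝓝 t] h1 := fun t ht => by
    filter_upwards [isOpen_Ioi.mem_nhds ht] with s hs using e1 s hs
  have e2 : ∀ t > t0, deriv (deriv h) t = h2 t := fun t ht => by
    rw [(ee t ht).deriv_eq, (d2 t ht).deriv]
  refine ⟨?_, e2⟩
  rw [show (2 : WithTop ℕ∞) = 1 + 1 by norm_num, contDiffOn_succ_iff_deriv_of_isOpen isOpen_Ioi]
  refine ⟨fun t ht => (d1 t ht).differentiableAt.differentiableWithinAt, by simp, ?_⟩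
  rw [show (1 : WithTop ℕ∞) = 0 + 1 by norm_num, contDiffOn_succ_iff_deriv_of_isOpen isOpen_Ioi]
  refine ⟨fun t ht => ((d2 t ht).congr_of_eventuallyEq (ee t ht)).differentiableAt.differentiableWithinAt, by simp, ?_⟩
  rw [contDiffOn_zero]
  exact hc.congr fun t ht => e2 t ht

/-- A fundamental pair on the positive half line, with Wronskian `w0`. -/
structure FPair (q φ1 ψ1 φ2 ψ2 : ℝ → ℝ) (w0 : ℝ) : Prop where
  qc : ContinuousOn q (Ioi 0)
  d1 : ∀ t > 0, HasDerivAt φ1 (ψ1 t) t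
  d1' : ∀ t > 0, HasDerivAt ψ1 (q t * φ1 t) t
  d2 : ∀ t > 0, HasDerivAt φ2 (ψ2 t) t
  d2' : ∀ t > 0, HasDerivAt ψ2 (q t * φ2 t) t
  w : ∀ t > 0, φ1 t * ψ2 t - ψ1 t * φ2 t = w0
  w0 : w0 ≠ 0

lemma varpar {q φ1 ψ1 φ2 ψ2 : ℝ → ℝ} {w0 : ℝ} (P : FPair q φ1 ψ1 φ2 ψ2 w0) {t0 : ℝ} (ht0 : 0 ≤ t0)
    {F a b : ℝ → ℝ} (hF : ContinuousOn F (Ioi t0))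
    (ha : ∀ t > t0, HasDerivAt a (F t * φ2 t / w0) t) (hb : ∀ t > t0, HasDerivAt b (-(F t * φ1 t / w0)) t) :
    ContDiffOn ℝ 2 (fun t => a t * φ1 t + b t * φ2 t) (Ioi t0) ∧
    ∀ t > t0, - deriv (deriv (fun t => a t * φ1 t + b t * φ2 t)) t + q t * (a t * φ1 t + b t * φ2 t) = F t := by
  have hw := P.w0
  have d1 : ∀ t > t0, HasDerivAt (fun t => a t * φ1 t + b t * φ2 t) (a t * ψ1 t + b t * ψ2 t) t := by
    intro t ht
    have h0 : 0 < t := ht0.trans_lt ht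
    refine (((ha t ht).mul (P.d1 t h0)).add ((hb t ht).mul (P.d2 t h0))).congr_deriv ?_
    field_simp; ring
  have d2 : ∀ t > t0, HasDerivAt (fun t => a t * ψ1 t + b t * ψ2 t) (q t * (a t * φ1 t + b t * φ2 t) - F t) t := by
    intro t ht
    have h0 : 0 < t := ht0.trans_lt ht
    refine (((ha t ht).mul (P.d1' t h0)).add ((hb t ht).mul (P.d2' t h0))).congr_deriv ?_
    have := P.w t h0
    field_simp
    rw [← this]; ring
  have hc : ContinuousOn (fun t => q t * (a t * φ1 t + b t * φ2 t) - F t) (Ioi t0) := by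
    refine ContinuousOn.sub (ContinuousOn.mul (P.qc.mono (Ioi_subset_Ioi ht0)) ?_) hF
    exact fun t ht => (d1 t ht).continuousAt.continuousWithinAt
  obtain ⟨h1, h2⟩ := C2_of d1 d2 hc
  exact ⟨h1, fun t ht => by rw [h2 t ht]; ring⟩

/-- Admissible right-hand side. -/
def Adm (t0 β A : ℝ) (F : ℝ → ℝ) : Prop := ContinuousOn F (Ioi t0) ∧ ∀ t > t0, |F t| ≤ A * exp (-β * t)

lemma Adm.nonneg {t0 β A : ℝ} {F : ℝ → ℝ} (h : Adm t0 β A F) : 0 ≤ A := by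
  have := (abs_nonneg _).trans (h.2 (t0+1) (by linarith))
  exact nonneg_of_mul_nonneg_left this (exp_pos _)

lemma Adm.sub {t0 β A B : ℝ} {F G : ℝ → ℝ} (h : Adm t0 β A F) (h' : Adm t0 β B G) :
    Adm t0 β (A+B) (fun t => F t - G t) := by
  refine ⟨h.1.sub h'.1, fun t ht => ?_⟩
  have h1 := h.2 t ht
  have h2 := h'.2 t ht
  calc |F t - G t| ≤ |F t| + |G t| := abs_sub _ _
    _ ≤ _ := by rw [add_mul]; linarith

def Solvable (q : ℝ → ℝ) (β : ℝ) (W : ℝ → ℝ) : Prop :=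
  ∃ C, 0 ≤ C ∧ ∀ t0, 1 ≤ t0 → ∃ S : (ℝ → ℝ) → (ℝ → ℝ),
    (∀ F A, Adm t0 β A F → ContDiffOn ℝ 2 (S F) (Ioi t0) ∧
      (∀ t > t0, - deriv (deriv (S F)) t + q t * S F t = F t) ∧ ∀ t > t0, |S F t| ≤ C * A * W t) ∧
    ∀ F G A B, Adm t0 β A F → Adm t0 β B G → ∀ t > t0, S (fun s => F s - G s) t = S F t - S G t

lemma Solvable.mono {q : ℝ → ℝ} {β : ℝ} {W W' : ℝ → ℝ} (h : Solvable q β W) (hW : ∀ t > 1, W t ≤ W' t) :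
    Solvable q β W' := by
  obtain ⟨C, hC, h⟩ := h
  refine ⟨C, hC, fun t0 ht0 => ?_⟩
  obtain ⟨S, h1, h2⟩ := h t0 ht0
  refine ⟨S, fun F A hF => ⟨(h1 F A hF).1, (h1 F A hF).2.1, fun t ht => ((h1 F A hF).2.2 t ht).trans ?_⟩, h2⟩
  have := hF.nonneg
  have := hW t (ht0.trans_lt ht)
  gcongr

lemma adm_int {t0 β A α C : ℝ} {F φ : ℝ → ℝ} (ht0 : 0 ≤ t0) (hF : Adm t0 β A F) (hφ : ContinuousOn φ (Ioi 0))
    (hb : ∀ t > t0, |φ t| ≤ C * exp (α * t)) (hα : α < β) (w : ℝ) :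
    IntegrableOn (fun t => F t * φ t / w) (Ioi t0) ∧ ContinuousOn (fun t => F t * φ t / w) (Ioi t0) := by
  have hcont : ContinuousOn (fun t => F t * φ t / w) (Ioi t0) :=
    (hF.1.mul (hφ.mono (Ioi_subset_Ioi ht0))).div_const _
  refine ⟨?_, hcont⟩
  have hi : IntegrableOn (fun t => A * C / |w| * exp ((α - β) * t)) (Ioi t0) :=
    (integrableOn_exp_mul_Ioi (by linarith) _).const_mul _
  refine Integrable.mono' hi (hcont.aestronglyMeasurable measurableSet_Ioi) ?_
  filter_upwards [ae_restrict_mem measurableSet_Ioi] with t ht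
  rw [Real.norm_eq_abs, abs_div, abs_mul]
  calc |F t| * |φ t| / |w| ≤ (A * exp (-β * t)) * (C * exp (α * t)) / |w| := by
        have := hF.2 t ht
        have := hb t ht
        gcongr
        exact (abs_nonneg _).trans (hF.2 t ht)
    _ = _ := by rw [show (α - β) * t = -β * t + α * t by ring, exp_add]; ring

lemma FPair.c1 {q φ1 ψ1 φ2 ψ2 : ℝ → ℝ} {w0 : ℝ} (P : FPair q φ1 ψ1 φ2 ψ2 w0) : ContinuousOn φ1 (Ioi 0) :=
  fun t ht => (P.d1 t ht).continuousAt.continuousWithinAt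
lemma FPair.c2 {q φ1 ψ1 φ2 ψ2 : ℝ → ℝ} {w0 : ℝ} (P : FPair q φ1 ψ1 φ2 ψ2 w0) : ContinuousOn φ2 (Ioi 0) :=
  fun t ht => (P.d2 t ht).continuousAt.continuousWithinAt

lemma int_exp_tail {c t : ℝ} (hc : c < 0) : ∫ s in Ioi t, exp (c * s) = exp (c * t) / (-c) := by
  rw [integral_exp_mul_Ioi hc]; rw [div_neg, neg_div]

/-- Type A. -/
lemma solvA {q φ1 ψ1 φ2 ψ2 : ℝ → ℝ} {w0 α β C : ℝ} (P : FPair q φ1 ψ1 φ2 ψ2 w0) (hC : 0 ≤ C) (hα : α < β)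
    (h1 : ∀ t > 1, |φ1 t| ≤ C * exp (α * t)) (h2 : ∀ t > 1, |φ2 t| ≤ C * exp (α * t))
    (hk : ∀ t > 1, ∀ s > t, |φ1 s * φ2 t - φ1 t * φ2 s| ≤ C * exp (α * (s - t))) :
    Solvable q β (fun t => exp (-β * t)) := by
  refine ⟨C / |w0| / (β - α), by have : 0 < β - α := by linarith
                                 positivity, fun t0 ht0 => ?_⟩
  set S : (ℝ → ℝ) → (ℝ → ℝ) := fun F t =>
    (- ∫ s in Ioi t, F s * φ2 s / w0) * φ1 t + (∫ s in Ioi t, F s * φ1 s / w0) * φ2 t with hS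
  have I1 : ∀ F A, Adm t0 β A F → _ := fun F A hF =>
    adm_int (by linarith) hF P.c1 (fun t ht => h1 t (by linarith)) hα w0
  have I2 : ∀ F A, Adm t0 β A F → _ := fun F A hF =>
    adm_int (by linarith) hF P.c2 (fun t ht => h2 t (by linarith)) hα w0
  refine ⟨S, fun F A hF => ?_, fun F G A B hF hG t ht => ?_⟩
  · obtain ⟨i1, c1⟩ := I1 F A hF
    obtain ⟨i2, c2⟩ := I2 F A hF
    obtain ⟨r1, r2⟩ := varpar P (by linarith : 0 ≤ t0) hF.1 (a := fun t => - ∫ s in Ioi t, F s * φ2 s / w0)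
      (b := fun t => ∫ s in Ioi t, F s * φ1 s / w0)
      (fun t ht => (tail_deriv c2 i2 ht).neg.congr_deriv (neg_neg _)) (fun t ht => tail_deriv c1 i1 ht)
    refine ⟨r1, r2, fun t ht => ?_⟩
    have i1' := i1.mono_set (Ioi_subset_Ioi (le_of_lt ht))
    have i2' := i2.mono_set (Ioi_subset_Ioi (le_of_lt ht))
    have e : S F t = ∫ s in Ioi t, F s * (φ1 s * φ2 t - φ1 t * φ2 s) / w0 := by
      simp only [hS]
      rw [neg_mul, ← integral_mul_const, ← integral_mul_const, neg_add_eq_sub, ← integral_sub (i1'.mul_const _) (i2'.mul_const _)]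
      congr 1; ext s; ring
    rw [e]
    have hle : ∀ s > t, ‖F s * (φ1 s * φ2 t - φ1 t * φ2 s) / w0‖ ≤ A * C / |w0| * exp (-α * t) * exp ((α - β) * s) := by
      intro s hs
      rw [Real.norm_eq_abs, abs_div, abs_mul]
      calc |F s| * |φ1 s * φ2 t - φ1 t * φ2 s| / |w0| ≤ (A * exp (-β * s)) * (C * exp (α * (s - t))) / |w0| := by
            have := hF.2 s (by linarith)
            have := hk t (by linarith) s hs
            have := hF.nonneg
            gcongr
        _ = _ := by
            rw [show α * (s - t) = -α * t + α * s by ring, show (α - β) * s = -β * s + α * s by ring, exp_add, exp_add]; ring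
    have hi : IntegrableOn (fun s => A * C / |w0| * exp (-α * t) * exp ((α - β) * s)) (Ioi t) :=
      (integrableOn_exp_mul_Ioi (by linarith) _).const_mul _
    have := norm_integral_le_of_norm_le hi (ae_restrict_of_forall_mem measurableSet_Ioi hle)
    refine this.trans (le_of_eq ?_)
    simp only []
    rw [integral_const_mul, int_exp_tail (by linarith), show -β * t = -α * t + (α - β) * t by ring, exp_add]
    rw [neg_sub]; ring
  · have e1 := integral_sub ((I1 F A hF).1.mono_set (Ioi_subset_Ioi (le_of_lt ht))) ((I1 G B hG).1.mono_set (Ioi_subset_Ioi (le_of_lt ht)))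
    have e2 := integral_sub ((I2 F A hF).1.mono_set (Ioi_subset_Ioi (le_of_lt ht))) ((I2 G B hG).1.mono_set (Ioi_subset_Ioi (le_of_lt ht)))
    simp only [hS, sub_mul, sub_div]
    rw [e1, e2]; ring

lemma integral_exp_mul_complex_real {c a b : ℝ} (hc : c ≠ 0) : ∫ s in a..b, exp (c * s) = (exp (c * b) - exp (c * a)) / c := by
  rw [intervalIntegral.integral_comp_mul_left (fun x => exp x) hc, integral_exp]
  simp [div_eq_inv_mul]

lemma solvB {q φ1 ψ1 φ2 ψ2 W : ℝ → ℝ} {w0 ρ β C E : ℝ} (P : FPair q φ1 ψ1 φ2 ψ2 w0) (hC : 0 ≤ C) (hE : 0 ≤ E)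
    (hβ : 0 < β) (hρ : 0 < ρ)
    (h1 : ∀ t > 1, |φ1 t| ≤ C * exp (-ρ * t)) (h2 : ∀ t > 1, |φ2 t| ≤ C * exp (ρ * t))
    (hW1 : ∀ t > 1, exp (-β * t) ≤ W t)
    (hW2 : ∀ t0, 1 ≤ t0 → ∀ t > t0, (∫ s in t0..t, exp ((ρ - β) * s)) * exp (-ρ * t) ≤ E * W t) :
    Solvable q β W := by
  refine ⟨C ^ 2 / |w0| * (E + 1 / (β + ρ)), by positivity, fun t0 ht0 => ?_⟩
  set S : (ℝ → ℝ) → (ℝ → ℝ) := fun F t =>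
    (∫ s in t0..t, F s * φ2 s / w0) * φ1 t + (∫ s in Ioi t, F s * φ1 s / w0) * φ2 t with hS
  have I1 : ∀ F A, Adm t0 β A F → _ := fun F A hF =>
    adm_int (by linarith) hF P.c1 (fun t ht => h1 t (by linarith)) (by linarith : -ρ < β) w0
  have C2 : ∀ F A, Adm t0 β A F → ContinuousOn (fun t => F t * φ2 t / w0) (Ioi t0) := fun F A hF =>
    (hF.1.mul (P.c2.mono (Ioi_subset_Ioi (by linarith)))).div_const _
  have B2 : ∀ F A, Adm t0 β A F → ∀ s > t0, ‖F s * φ2 s / w0‖ ≤ A * C / |w0| * exp ((ρ - β) * s) := by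
    intro F A hF s hs
    rw [Real.norm_eq_abs, abs_div, abs_mul]
    calc |F s| * |φ2 s| / |w0| ≤ (A * exp (-β * s)) * (C * exp (ρ * s)) / |w0| := by
          have := hF.2 s hs
          have := h2 s (by linarith)
          have := hF.nonneg
          gcongr
      _ = _ := by rw [show (ρ - β) * s = -β * s + ρ * s by ring, exp_add]; ring
  have I2 : ∀ F A, Adm t0 β A F → ∀ t > t0, IntervalIntegrable (fun t => F t * φ2 t / w0) volume t0 t := by
    intro F A hF t ht
    rw [intervalIntegrable_iff_integrableOn_Ioc_of_le (le_of_lt ht)]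
    have hi : IntegrableOn (fun s => A * C / |w0| * exp ((ρ - β) * s)) (Ioc t0 t) :=
      (Continuous.integrableOn_Ioc (by fun_prop))
    refine Integrable.mono' hi (((C2 F A hF).mono Ioc_subset_Ioi_self).aestronglyMeasurable measurableSet_Ioc) ?_
    exact ae_restrict_of_forall_mem measurableSet_Ioc fun s hs => B2 F A hF s hs.1
  refine ⟨S, fun F A hF => ?_, fun F G A B hF hG t ht => ?_⟩
  · obtain ⟨i1, c1⟩ := I1 F A hF
    have c2 := C2 F A hF
    obtain ⟨r1, r2⟩ := varpar P (by linarith : 0 ≤ t0) hF.1 (a := fun t => ∫ s in t0..t, F s * φ2 s / w0)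
      (b := fun t => ∫ s in Ioi t, F s * φ1 s / w0)
      (fun t ht => intervalIntegral.integral_hasDerivAt_right (I2 F A hF t ht)
        (c2.stronglyMeasurableAtFilter isOpen_Ioi t ht) (c2.continuousAt (isOpen_Ioi.mem_nhds ht)))
      (fun t ht => tail_deriv c1 i1 ht)
    refine ⟨r1, r2, fun t ht => ?_⟩
    have hA := hF.nonneg
    have ht' : t0 < t := ht
    have ht1 : 1 < t := by linarith
    have b1 : |∫ s in t0..t, F s * φ2 s / w0| ≤ A * C / |w0| * ∫ s in t0..t, exp ((ρ - β) * s) := by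
      rw [← intervalIntegral.integral_const_mul, ← Real.norm_eq_abs]
      refine intervalIntegral.norm_integral_le_of_norm_le ht'.le (Eventually.of_forall fun s hs => B2 F A hF s hs.1) ?_
      exact Continuous.intervalIntegrable (by fun_prop) _ _
    have hle : ∀ s > t, ‖F s * φ1 s / w0‖ ≤ A * C / |w0| * exp (-(β + ρ) * s) := by
      intro s hs
      rw [Real.norm_eq_abs, abs_div, abs_mul]
      calc |F s| * |φ1 s| / |w0| ≤ (A * exp (-β * s)) * (C * exp (-ρ * s)) / |w0| := by
            have := hF.2 s (by linarith)
            have := h1 s (by linarith)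
            gcongr
        _ = _ := by rw [show -(β + ρ) * s = -β * s + -ρ * s by ring, exp_add]; ring
    have hi : IntegrableOn (fun s => A * C / |w0| * exp (-(β + ρ) * s)) (Ioi t) :=
      (integrableOn_exp_mul_Ioi (by linarith) _).const_mul _
    have b2 := norm_integral_le_of_norm_le hi (ae_restrict_of_forall_mem measurableSet_Ioi hle)
    rw [integral_const_mul, int_exp_tail (by linarith), Real.norm_eq_abs] at b2
    have hw := hW2 t0 ht0 t ht
    have hw1 := hW1 t ht1
    simp only [hS]
    calc |(∫ s in t0..t, F s * φ2 s / w0) * φ1 t + (∫ s in Ioi t, F s * φ1 s / w0) * φ2 t|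
        ≤ |∫ s in t0..t, F s * φ2 s / w0| * |φ1 t| + |∫ s in Ioi t, F s * φ1 s / w0| * |φ2 t| := by
          rw [← abs_mul, ← abs_mul]; exact abs_add_le _ _
      _ ≤ (A * C / |w0| * ∫ s in t0..t, exp ((ρ - β) * s)) * (C * exp (-ρ * t))
          + (A * C / |w0| * (exp (-(β + ρ) * t) / (-(-(β+ρ))))) * (C * exp (ρ * t)) := by
          have := h1 t ht1
          have := h2 t ht1
          have h0 := (abs_nonneg _).trans b1
          have h0' := (abs_nonneg _).trans b2
          exact add_le_add (mul_le_mul b1 (h1 t ht1) (abs_nonneg _) h0) (mul_le_mul b2 (h2 t ht1) (abs_nonneg _) h0')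
      _ = A * C ^ 2 / |w0| * ((∫ s in t0..t, exp ((ρ - β) * s)) * exp (-ρ * t)) + A * C ^ 2 / |w0| * (1 / (β + ρ)) * exp (-β * t) := by
          rw [show -β * t = -(β + ρ) * t + ρ * t by ring, exp_add, neg_neg]; ring
      _ ≤ A * C ^ 2 / |w0| * (E * W t) + A * C ^ 2 / |w0| * (1 / (β + ρ)) * W t := by gcongr
      _ = _ := by ring
  · have e1 := integral_sub ((I1 F A hF).1.mono_set (Ioi_subset_Ioi (le_of_lt ht))) ((I1 G B hG).1.mono_set (Ioi_subset_Ioi (le_of_lt ht)))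
    have e2 := intervalIntegral.integral_sub (I2 F A hF t ht) (I2 G B hG t ht)
    simp only [hS, sub_mul, sub_div]
    rw [e1, e2]; ring

/-- Exponential pairs. -/
lemma solv_exp {q φ1 ψ1 φ2 ψ2 : ℝ → ℝ} {w0 ρ β C : ℝ} (P : FPair q φ1 ψ1 φ2 ψ2 w0) (hC : 0 ≤ C)
    (hβ : 0 < β) (hρ : 0 < ρ)
    (h1 : ∀ t, |φ1 t| ≤ C * exp (-ρ * t)) (h2 : ∀ t, |φ2 t| ≤ C * exp (ρ * t)) :
    (ρ ≠ β → Solvable q β (fun t => exp (-β * t))) ∧ Solvable q β (fun t => t * exp (-β * t)) := by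
  have hm : ∀ t > 1, (fun t => exp (-β * t)) t ≤ (fun t => t * exp (-β * t)) t := fun t ht => by
    simp only []; nlinarith [exp_pos (-β * t)]
  have hne : ρ ≠ β → Solvable q β (fun t => exp (-β * t)) := by
    intro h
    rcases lt_or_gt_of_ne h with h | h
    · have h1' : ∀ t > 1, |φ1 t| ≤ C * exp (ρ * t) := fun t ht => (h1 t).trans (by gcongr; nlinarith)
      have key : ∀ t > 1, ∀ s > t, |φ1 s * φ2 t - φ1 t * φ2 s| ≤ (2 * C ^ 2) * exp (ρ * (s - t)) := by
        intro t ht s hs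
        have a1 := h1 s
        have a2 := h1 t
        have a3 := h2 t
        have a4 := h2 s
        calc |φ1 s * φ2 t - φ1 t * φ2 s| ≤ |φ1 s| * |φ2 t| + |φ1 t| * |φ2 s| := by
              rw [← abs_mul, ← abs_mul]; exact abs_sub _ _
          _ ≤ (C * exp (-ρ * s)) * (C * exp (ρ * t)) + (C * exp (-ρ * t)) * (C * exp (ρ * s)) := by gcongr
          _ = C ^ 2 * exp (ρ * (t - s)) + C ^ 2 * exp (ρ * (s - t)) := by
              rw [show ρ * (t - s) = -ρ * s + ρ * t by ring, show ρ * (s - t) = -ρ * t + ρ * s by ring, exp_add, exp_add]; ring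
          _ ≤ C ^ 2 * exp (ρ * (s - t)) + C ^ 2 * exp (ρ * (s - t)) := by gcongr <;> linarith
          _ = _ := by ring
      refine solvA (C := max C (2 * C ^ 2)) P (le_max_of_le_left hC) h (fun t ht => (h1' t ht).trans ?_)
        (fun t ht => (h2 t).trans ?_) (fun t ht s hs => (key t ht s hs).trans ?_)
      · gcongr; exact le_max_left _ _
      · gcongr; exact le_max_left _ _
      · gcongr; exact le_max_right _ _
    · refine solvB (E := 1 / (ρ - β)) P hC (by have : 0 < ρ - β := by linarith
                                               positivity) hβ hρ (fun t _ => h1 t) (fun t _ => h2 t) (fun t _ => le_rfl) ?_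
      intro t0 ht0 t ht
      have hp : 0 < ρ - β := by linarith
      rw [integral_exp_mul_complex_real hp.ne']
      calc (exp ((ρ - β) * t) - exp ((ρ - β) * t0)) / (ρ - β) * exp (-ρ * t)
          ≤ exp ((ρ - β) * t) / (ρ - β) * exp (-ρ * t) := by
            gcongr; linarith [exp_pos ((ρ - β) * t0)]
        _ = _ := by rw [show -β * t = (ρ - β) * t + -ρ * t by ring, exp_add]; ring
  refine ⟨hne, ?_⟩
  by_cases h : ρ = β
  · subst h
    refine solvB (E := 1) P hC (by norm_num) hβ hρ (fun t _ => h1 t) (fun t _ => h2 t) hm ?_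
    intro t0 ht0 t ht
    simp only [sub_self, zero_mul, exp_zero, intervalIntegral.integral_const, smul_eq_mul, mul_one, one_mul]
    gcongr; linarith
  · exact (hne h).mono hm
end P13

section P14
open MeasureTheory Topology

section linODE
variable {E : Type*} [NormedAddCommGroup E] [NormedSpace ℝ E]

lemma int_w_bound {h : ℝ → E} {H M : ℝ} (hM : 0 < M) (hh : ∀ s, ‖h s‖ ≤ H) (t : ℝ) :
    ‖∫ s in (0:ℝ)..t, exp (M * |s|) • h s‖ ≤ H / M * exp (M * |t|) := by
  have hH : 0 ≤ H := (norm_nonneg _).trans (hh 0)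
  rcases le_total 0 t with ht | ht
  · have := intervalIntegral.norm_integral_le_of_norm_le (f := fun s => exp (M * |s|) • h s) (g := fun s => H * exp (M * s)) (μ := volume) ht
      (Eventually.of_forall fun s hs => by
        rw [norm_smul, Real.norm_of_nonneg (exp_pos _).le, abs_of_pos hs.1, mul_comm]
        gcongr; exact hh s) (Continuous.intervalIntegrable (by fun_prop) _ _)
    refine this.trans ?_
    rw [intervalIntegral.integral_const_mul, integral_exp_mul_complex_real hM.ne', abs_of_nonneg ht]
    rw [mul_zero, exp_zero, div_mul_eq_mul_div, ← mul_div_assoc]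
    gcongr; linarith
  · rw [intervalIntegral.integral_symm, norm_neg]
    have := intervalIntegral.norm_integral_le_of_norm_le (f := fun s => exp (M * |s|) • h s) (g := fun s => H * exp ((-M) * s)) (μ := volume) ht
      (Eventually.of_forall fun s hs => by
        rw [norm_smul, Real.norm_of_nonneg (exp_pos _).le, abs_of_nonpos hs.2, mul_comm, mul_neg, ← neg_mul]
        gcongr; exact hh s) (Continuous.intervalIntegrable (by fun_prop) _ _)
    refine this.trans ?_
    rw [intervalIntegral.integral_const_mul, integral_exp_mul_complex_real (neg_ne_zero.2 hM.ne'), abs_of_nonpos ht]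
    rw [mul_zero, exp_zero, mul_neg, ← neg_mul]
    have e : H * ((1 - exp (-M * t)) / -M) = H / M * (exp (-M * t) - 1) := by field_simp; ring
    rw [e]; gcongr; linarith

lemma lin_exist [CompleteSpace E] (A : ℝ → E →L[ℝ] E) (hA : Continuous A) {B : ℝ} (hB : ∀ t, ‖A t‖ ≤ B) (y0 : E) :
    ∃ y : ℝ → E, y 0 = y0 ∧ ∀ t, HasDerivAt y (A t (y t)) t := by
  have hB0 : 0 ≤ B := (norm_nonneg _).trans (hB 0)
  set M : ℝ := 2 * (B + 1) with hM
  have hMp : 0 < M := by positivity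
  have hcts : ∀ g : ℝ → E, Continuous g → Continuous (fun s => exp (M * |s|) • A s (g s)) := by
    intro g hg
    have : Continuous fun s => A s (g s) := hA.clm_apply hg
    fun_prop
  have hci : ∀ g : ℝ → E, Continuous g → Continuous (fun t => ∫ s in (0:ℝ)..t, exp (M * |s|) • A s (g s)) := fun g hg =>
    intervalIntegral.continuous_primitive (fun a b => (hcts g hg).intervalIntegrable a b) 0
  have hAg : ∀ g : BoundedContinuousFunction ℝ E, ∀ s, ‖A s (g s)‖ ≤ B * ‖g‖ := fun g s =>
    ((A s).le_opNorm _).trans (mul_le_mul (hB s) (g.norm_coe_le_norm s) (norm_nonneg _) hB0)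
  have hee : ∀ t, exp (-(M * |t|)) * exp (M * |t|) = 1 := fun t => by rw [← exp_add]; simp
  have hle1 : ∀ t, exp (-(M * |t|)) ≤ 1 := fun t => by rw [exp_le_one_iff]; simp; positivity
  let Φ : BoundedContinuousFunction ℝ E → BoundedContinuousFunction ℝ E := fun g =>
    BoundedContinuousFunction.ofNormedAddCommGroup
      (fun t => exp (-(M * |t|)) • (y0 + ∫ s in (0:ℝ)..t, exp (M * |s|) • A s (g s)))
      (by have := hci g g.continuous
          fun_prop) (‖y0‖ + B * ‖g‖ / M) (by
        intro t
        have := int_w_bound hMp (hAg g) t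
        rw [norm_smul, Real.norm_of_nonneg (exp_pos _).le]
        calc exp (-(M * |t|)) * ‖y0 + ∫ s in (0:ℝ)..t, exp (M * |s|) • A s (g s)‖
            ≤ exp (-(M * |t|)) * (‖y0‖ + B * ‖g‖ / M * exp (M * |t|)) := by
              gcongr; exact (norm_add_le _ _).trans (by gcongr)
          _ = exp (-(M * |t|)) * ‖y0‖ + B * ‖g‖ / M * (exp (-(M * |t|)) * exp (M * |t|)) := by ring
          _ ≤ 1 * ‖y0‖ + B * ‖g‖ / M * 1 := by rw [hee]; gcongr; exact hle1 t
          _ = _ := by ring)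
  have hΦ : ∀ g t, Φ g t = exp (-(M * |t|)) • (y0 + ∫ s in (0:ℝ)..t, exp (M * |s|) • A s (g s)) := fun g t => rfl
  have hc : ContractingWith (1/2) Φ := by
    refine ⟨by norm_num, LipschitzWith.of_dist_le_mul fun g g' => ?_⟩
    rw [BoundedContinuousFunction.dist_le (by positivity)]
    intro t
    rw [hΦ, hΦ, dist_eq_norm, ← smul_sub, add_sub_add_left_eq_sub,
      ← intervalIntegral.integral_sub ((hcts g g.continuous).intervalIntegrable _ _) ((hcts g' g'.continuous).intervalIntegrable _ _)]
    have e : (fun s => exp (M * |s|) • A s (g s) - exp (M * |s|) • A s (g' s)) = fun s => exp (M * |s|) • A s ((g - g') s) := by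
      ext s; simp [smul_sub]
    simp only [e]
    have := int_w_bound hMp (hAg (g - g')) t
    rw [norm_smul, Real.norm_of_nonneg (exp_pos _).le, dist_eq_norm]
    calc exp (-(M * |t|)) * ‖∫ s in (0:ℝ)..t, exp (M * |s|) • A s ((g - g') s)‖
        ≤ exp (-(M * |t|)) * (B * ‖g - g'‖ / M * exp (M * |t|)) := by gcongr
      _ = B / M * ‖g - g'‖ * (exp (-(M * |t|)) * exp (M * |t|)) := by ring
      _ ≤ _ := by
          rw [hee, mul_one]; gcongr
          simp only [NNReal.coe_div, NNReal.coe_one, NNReal.coe_ofNat]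
          rw [div_le_div_iff₀ hMp (by norm_num)]; linarith
  set g := hc.fixedPoint Φ with hg
  have hfix : Φ g = g := hc.fixedPoint_isFixedPt
  have hy : ∀ t, exp (M * |t|) • g t = y0 + ∫ s in (0:ℝ)..t, A s (exp (M * |s|) • g s) := by
    intro t
    conv_lhs => rw [← hfix]
    rw [hΦ, smul_smul, mul_comm, hee, one_smul]
    simp only [map_smul]
  refine ⟨fun t => exp (M * |t|) • g t, ?_, fun t => ?_⟩
  · have := hy 0
    rw [intervalIntegral.integral_same, add_zero] at this
    exact this
  · have hcc : Continuous fun s => A s (exp (M * |s|) • g s) := by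
      have := hcts g g.continuous
      simpa using this
    have h1 : HasDerivAt (fun t => y0 + ∫ s in (0:ℝ)..t, A s (exp (M * |s|) • g s)) (A t (exp (M * |t|) • g t)) t :=
      (intervalIntegral.integral_hasDerivAt_right (hcc.intervalIntegrable _ _) (hcc.stronglyMeasurableAtFilter _ _) hcc.continuousAt).const_add y0
    have h2 : (fun t => exp (M * |t|) • g t) = fun t => y0 + ∫ s in (0:ℝ)..t, A s (exp (M * |s|) • g s) := funext hy
    rw [← h2] at h1
    exact h1
end linODE

lemma ode_exist {q : ℝ → ℝ} (hq : Continuous q) {Q : ℝ} (hQ : ∀ t, |q t| ≤ Q) (a b : ℝ) :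
    ∃ f g : ℝ → ℝ, f 0 = a ∧ g 0 = b ∧ (∀ t, HasDerivAt f (g t) t) ∧ ∀ t, HasDerivAt g (q t * f t) t := by
  let A : ℝ → (ℝ × ℝ) →L[ℝ] (ℝ × ℝ) := fun t => 
    (ContinuousLinearMap.inl ℝ ℝ ℝ).comp (ContinuousLinearMap.snd ℝ ℝ ℝ) + q t • (ContinuousLinearMap.inr ℝ ℝ ℝ).comp (ContinuousLinearMap.fst ℝ ℝ ℝ)
  have hA : Continuous A := by
    simp only [A]; fun_prop
  obtain ⟨y, h0, hy⟩ := lin_exist A hA (B := ‖(ContinuousLinearMap.inl ℝ ℝ ℝ).comp (ContinuousLinearMap.snd ℝ ℝ ℝ)‖ + Q * ‖(ContinuousLinearMap.inr ℝ ℝ ℝ).comp (ContinuousLinearMap.fst ℝ ℝ ℝ)‖) (fun t => by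
    simp only [A]
    refine (norm_add_le _ _).trans ?_
    rw [norm_smul]
    have := hQ t
    gcongr; exact this) (a, b)
  refine ⟨fun t => (y t).1, fun t => (y t).2, by simp [h0], by simp [h0], fun t => ?_, fun t => ?_⟩
  · have := (hasFDerivAt_fst (𝕜 := ℝ) (p := y t)).comp_hasDerivAt t (hy t)
    exact this.congr_deriv (by simp [A])
  · have := (hasFDerivAt_snd (𝕜 := ℝ) (p := y t)).comp_hasDerivAt t (hy t)
    exact this.congr_deriv (by simp [A])

lemma ode_uniq {q f g : ℝ → ℝ} {Q : ℝ} (hQ : ∀ t, |q t| ≤ Q) (hf : ∀ t, HasDerivAt f (g t) t)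
    (hg : ∀ t, HasDerivAt g (q t * f t) t) {t0 : ℝ} (h1 : f t0 = 0) (h2 : g t0 = 0) : ∀ t, f t = 0 := by
  have hQ0 : 0 ≤ Q := (abs_nonneg _).trans (hQ 0)
  have := ODE_solution_unique_univ (E := ℝ × ℝ) (v := fun t z => (z.2, q t * z.1)) (s := fun _ => univ) (K := ⟨1 + Q, by positivity⟩)
    (f := fun t => (f t, g t)) (g := fun t => (0, 0)) (t₀ := t0) (fun t => LipschitzWith.lipschitzOnWith (LipschitzWith.of_dist_le_mul fun x y => by
      rw [Prod.dist_eq, Prod.dist_eq]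
      simp only [Real.dist_eq]
      have : |q t * x.1 - q t * y.1| ≤ Q * |x.1 - y.1| := by
        rw [← mul_sub, abs_mul]; gcongr; exact hQ t
      have a1 := le_max_left |x.1 - y.1| |x.2 - y.2|
      have a2 := le_max_right |x.1 - y.1| |x.2 - y.2|
      have a3 := abs_nonneg (x.1 - y.1)
      have a4 : Q * |x.1 - y.1| ≤ Q * max |x.1 - y.1| |x.2 - y.2| := by gcongr
      refine max_le ?_ ?_ <;> show _ ≤ (1 + Q) * _ <;> nlinarith))
    (fun t => ⟨(hf t).prodMk (hg t), trivial⟩) (fun t => ⟨(hasDerivAt_const t ((0:ℝ),(0:ℝ))).congr_deriv (by simp; rfl), trivial⟩) (by simp [h1, h2])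
  intro t
  have := congrFun this t
  simp at this
  exact this.1

lemma wronsk {q φ1 ψ1 φ2 ψ2 : ℝ → ℝ} (d1 : ∀ t, HasDerivAt φ1 (ψ1 t) t)
  (d1' : ∀ t, HasDerivAt ψ1 (q t * φ1 t) t) (d2 : ∀ t, HasDerivAt φ2 (ψ2 t) t)
  (d2' : ∀ t, HasDerivAt ψ2 (q t * φ2 t) t) (s t : ℝ) : φ1 t * ψ2 t - ψ1 t * φ2 t = φ1 s * ψ2 s - ψ1 s * φ2 s := by
  have hd : ∀ t, HasDerivAt (fun t => φ1 t * ψ2 t - ψ1 t * φ2 t) 0 t := fun t =>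
    (((d1 t).mul (d2' t)).sub ((d1' t).mul (d2 t))).congr_deriv (by ring)
  exact is_const_of_deriv_eq_zero (fun t => (hd t).differentiableAt) (fun t => (hd t).deriv) t s
end P14

section P15
open MeasureTheory Topology
variable {n : ℕ}

lemma per_bdd {f : ℝ → ℝ} {T : ℝ} (hc : Continuous f) (hT : 0 < T) (hp : Periodic f T) : ∃ C, 0 ≤ C ∧ ∀ t, |f t| ≤ C := by
  obtain ⟨C, hC⟩ := (hp.isBounded_of_continuous hT.ne' hc).exists_norm_le
  exact ⟨C, (norm_nonneg _).trans (hC _ ⟨0, rfl⟩), fun t => hC _ ⟨t, rfl⟩⟩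

lemma wronsk_zero {q φ1 ψ1 φ2 ψ2 : ℝ → ℝ} {Q : ℝ} (hQ : ∀ t, |q t| ≤ Q) (d1 : ∀ t, HasDerivAt φ1 (ψ1 t) t)
    (d1' : ∀ t, HasDerivAt ψ1 (q t * φ1 t) t) (d2 : ∀ t, HasDerivAt φ2 (ψ2 t) t)
    (d2' : ∀ t, HasDerivAt ψ2 (q t * φ2 t) t) {s : ℝ} (hs : φ1 s ≠ 0) (hw : φ1 s * ψ2 s - ψ1 s * φ2 s = 0) :
    ∃ c, ∀ t, φ2 t = c * φ1 t := by
  refine ⟨φ2 s / φ1 s, fun t => ?_⟩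
  have := ode_uniq (f := fun t => φ2 t - φ2 s / φ1 s * φ1 t) (g := fun t => ψ2 t - φ2 s / φ1 s * ψ1 t) hQ
    (fun t => (d2 t).sub ((d1 t).const_mul _)) (fun t => ((d2' t).sub ((d1' t).const_mul _)).congr_deriv (by ring))
    (t0 := s) (by field_simp; ring) (by field_simp; linarith) t
  linarith

/-- The potential. -/
def Vh (n : ℕ) (K0 : ℝ) (ξ : ℝ → ℝ) (t : ℝ) : ℝ :=
  ((n : ℝ) + 2) / ((n : ℝ) - 2) * K0 * ξ t ^ ((4 : ℝ) / ((n : ℝ) - 2))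

lemma Vh_cont {K0 T : ℝ} {ξ : ℝ → ℝ} (hξ : FowlerXi n K0 ξ T) : Continuous (Vh n K0 ξ) := by
  unfold Vh
  refine continuous_const.mul (hξ.1.continuous.rpow_const fun t => Or.inl (hξ.2.1 t).ne')

lemma Vh_per {K0 T : ℝ} {ξ : ℝ → ℝ} (hξ : FowlerXi n K0 ξ T) : Periodic (Vh n K0 ξ) T := by
  intro t; simp only [Vh, hξ.2.2.2.1 t]

lemma Vh_bdd {K0 T : ℝ} {ξ : ℝ → ℝ} (hξ : FowlerXi n K0 ξ T) : ∃ C, 0 ≤ C ∧ ∀ t, |Vh n K0 ξ t| ≤ C :=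
  per_bdd (Vh_cont hξ) hξ.2.2.1 (Vh_per hξ)

lemma q_bdd {K0 T : ℝ} {ξ : ℝ → ℝ} (hξ : FowlerXi n K0 ξ T) (μ : ℝ) : ∃ Q, ∀ t, |μ - Vh n K0 ξ t| ≤ Q := by
  obtain ⟨C, _, hC⟩ := Vh_bdd hξ
  exact ⟨|μ| + C, fun t => (abs_sub _ _).trans (by linarith [hC t])⟩

lemma C2_derivs {φ : ℝ → ℝ} (h : ContDiff ℝ 2 φ) : (∀ t, HasDerivAt φ (deriv φ t) t) ∧ ∀ t, HasDerivAt (deriv φ) (dtt φ t) t := by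
  have h1 : ContDiff ℝ 1 (deriv φ) := by
    rw [show (2 : WithTop ℕ∞) = 1 + 1 by norm_num] at h
    exact (contDiff_succ_iff_deriv.1 h).2.2
  exact ⟨fun t => (h.differentiable (by norm_num) t).hasDerivAt, fun t => (h1.differentiable (by norm_num) t).hasDerivAt⟩

lemma kerbasis_solv {K0 T β ρ lam : ℝ} {ξ p₁ p₂ : ℝ → ℝ} (hξ : FowlerXi n K0 ξ T) (hβ : 0 < β) (hρ : 0 < ρ)
    (c1 : Continuous p₁) (c2 : Continuous p₂) (P1 : Periodic p₁ T) (P2 : Periodic p₂ T)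
    (hk : KerBasis (Lop n K0 ξ lam) (fun t => Real.exp (-ρ * t) * p₁ t) (fun t => Real.exp (ρ * t) * p₂ t)) :
    (ρ ≠ β → Solvable (fun t => (lam + ((n:ℝ)-2)^2/4) - Vh n K0 ξ t) β (fun t => exp (-β * t))) ∧
      Solvable (fun t => (lam + ((n:ℝ)-2)^2/4) - Vh n K0 ξ t) β (fun t => t * exp (-β * t)) := by
  obtain ⟨B1, hB1, b1⟩ := per_bdd c1 hξ.2.2.1 P1
  obtain ⟨B2, hB2, b2⟩ := per_bdd c2 hξ.2.2.1 P2
  obtain ⟨Q, hQ⟩ := q_bdd hξ (lam + ((n:ℝ)-2)^2/4)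
  set φ1 := fun t => Real.exp (-ρ * t) * p₁ t with hφ1
  set φ2 := fun t => Real.exp (ρ * t) * p₂ t with hφ2
  obtain ⟨k1, k2, k3, k4, k5, -⟩ := hk
  obtain ⟨d1, d1'⟩ := C2_derivs k1
  obtain ⟨d2, d2'⟩ := C2_derivs k2
  have e1 : ∀ t, dtt φ1 t = ((lam + ((n:ℝ)-2)^2/4) - Vh n K0 ξ t) * φ1 t := fun t => by
    have := k3 t; unfold Lop at this; unfold Vh; linarith
  have e2 : ∀ t, dtt φ2 t = ((lam + ((n:ℝ)-2)^2/4) - Vh n K0 ξ t) * φ2 t := fun t => by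
    have := k4 t; unfold Lop at this; unfold Vh; linarith
  simp only [e1] at d1'
  simp only [e2] at d2'
  have hw : φ1 0 * deriv φ2 0 - deriv φ1 0 * φ2 0 ≠ 0 := by
    intro hw
    rw [LinearIndependent.pair_iff] at k5
    have : ∃ s, φ1 s ≠ 0 := by
      by_contra! hcon
      have := (k5 1 0 (by ext t; simp [hcon t])).1
      norm_num at this
    obtain ⟨s, hs⟩ := this
    obtain ⟨c, hc⟩ := wronsk_zero hQ d1 d1' d2 d2' hs ((wronsk d1 d1' d2 d2' 0 s).trans hw)
    have := (k5 (-c) 1 (by ext t; simp [hc t])).2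
    norm_num at this
  refine solv_exp (C := max B1 B2) (w0 := φ1 0 * deriv φ2 0 - deriv φ1 0 * φ2 0)
    ⟨((continuous_const.sub (Vh_cont hξ))).continuousOn, fun t _ => d1 t, fun t _ => d1' t, fun t _ => d2 t, fun t _ => d2' t, fun t _ => wronsk d1 d1' d2 d2' 0 t, hw⟩
    (le_max_of_le_left hB1) hβ hρ (fun t => ?_) (fun t => ?_)
  · simp only [hφ1]
    rw [abs_mul, abs_of_pos (exp_pos _), mul_comm]
    gcongr; exact (b1 t).trans (le_max_left _ _)
  · simp only [hφ2]
    rw [abs_mul, abs_of_pos (exp_pos _), mul_comm]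
    gcongr; exact (b2 t).trans (le_max_right _ _)

lemma cumHarm_lt (hn : 3 ≤ n) (d : ℕ) : cumHarm n d < cumHarm n (d+1) := by
  unfold cumHarm
  have h1 : Nat.choose (n - 1 + (d+1)) (n-1) = Nat.choose (n-1+d) (n-2) + Nat.choose (n-1+d) (n-1) := by
    obtain ⟨m, rfl⟩ : ∃ m, n = m + 3 := ⟨n - 3, by omega⟩
    simp only [show m + 3 - 1 = m + 2 by omega, show m + 3 - 2 = m + 1 by omega, ← add_assoc]
    rw [Nat.choose_succ_succ]
  have h2 : 0 < Nat.choose (n-1+d) (n-2) := Nat.choose_pos (by omega)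
  have h3 : Nat.choose (n-2+d) (n-1) ≤ Nat.choose (n-2+(d+1)) (n-1) := Nat.choose_mono _ (by omega)
  omega

lemma sphDeg_cum (hn : 3 ≤ n) (k : ℕ) : sphDeg n (cumHarm n k) = k + 1 := by
  have hm : StrictMono (cumHarm n) := strictMono_nat_of_lt_succ (cumHarm_lt hn)
  unfold sphDeg
  have : {d | cumHarm n k < cumHarm n d} = Ici (k+1) := by
    ext d
    rw [mem_ofPred_eq, hm.lt_iff_lt, mem_Ici, Nat.lt_iff_add_one_le]
  rw [this, csInf_Ici]

lemma mode_pos (hn : 3 ≤ n) {K0 T β : ℝ} {ξ : ℝ → ℝ} {ρ : ℕ → ℝ} (hξ : FowlerXi n K0 ξ T) (hρ : FowlerExponents n K0 ξ T ρ)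
    (hβ : 0 < β) (k : ℕ) : ((¬ ∃ i, 1 ≤ i ∧ ρ i = β) → Solvable (fun t => (((k+1:ℕ):ℝ) + ((n:ℝ)-2)/2)^2 - Vh n K0 ξ t) β (fun t => exp (-β * t))) ∧
      Solvable (fun t => (((k+1:ℕ):ℝ) + ((n:ℝ)-2)/2)^2 - Vh n K0 ξ t) β (fun t => t * exp (-β * t)) := by
  have hi : 1 ≤ cumHarm n k := by
    unfold cumHarm
    have : 0 < Nat.choose (n-1+k) (n-1) := Nat.choose_pos (by omega)
    omega
  obtain ⟨p1, p2, c1, c2, P1, P2, hk⟩ := hρ.2.2.2 _ hi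
  have := kerbasis_solv hξ hβ (hρ.1 _ hi) c1.continuous c2.continuous P1 P2 hk
  have e : sphEval n (cumHarm n k) + ((n:ℝ)-2)^2/4 = (((k+1:ℕ):ℝ) + ((n:ℝ)-2)/2)^2 := by
    unfold sphEval; rw [sphDeg_cum hn]; ring
  rw [e] at this
  exact ⟨fun h => this.1 fun hh => h ⟨_, hi, hh⟩, this.2⟩

lemma one_add_le {u : ℝ} (hu : 0 ≤ u) : 1 + u ≤ 2 * exp (1/2 * u) := by
  linarith [add_one_le_exp (1/2 * u)]

lemma floquet {q φ1 ψ1 φ2 ψ2 : ℝ → ℝ} {T Q β : ℝ} (hqc : Continuous q) (hQ : ∀ t, |q t| ≤ Q) (hT : 0 < T) (hqT : Periodic q T) (d1 : ∀ t, HasDerivAt φ1 (ψ1 t) t)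
    (d1' : ∀ t, HasDerivAt ψ1 (q t * φ1 t) t) (d2 : ∀ t, HasDerivAt φ2 (ψ2 t) t)
    (d2' : ∀ t, HasDerivAt ψ2 (q t * φ2 t) t) (P1 : Periodic φ1 T) (P1' : Periodic ψ1 T)
    (hw : φ1 0 * ψ2 0 - ψ1 0 * φ2 0 ≠ 0) (hβ : 1 < β) : Solvable q β (fun t => exp (-β * t)) := by
  have cφ1 : Continuous φ1 := continuous_iff_continuousAt.2 fun t => (d1 t).continuousAt
  have cφ2 : Continuous φ2 := continuous_iff_continuousAt.2 fun t => (d2 t).continuousAt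
  obtain ⟨C1, hC1, b1⟩ := per_bdd cφ1 hT P1
  have hs : ∃ s, φ1 s ≠ 0 := by
    by_contra! hcon
    have h1 : ψ1 0 = 0 := by
      have e : φ1 = fun _ => 0 := funext hcon
      have := d1 0
      rw [e] at this
      exact this.unique (hasDerivAt_const _ _)
    rw [hcon 0, h1] at hw; simp at hw
  obtain ⟨s, hs⟩ := hs
  have hW := wronsk d1 d1' d2 d2'
  obtain ⟨α, hα⟩ := wronsk_zero hQ d1 d1' (φ2 := fun t => φ2 (t + T) - φ2 t) (ψ2 := fun t => ψ2 (t + T) - ψ2 t)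
    (fun t => ((d2 (t+T)).comp_add_const t T).sub (d2 t))
    (fun t => (((d2' (t+T)).comp_add_const t T).sub (d2' t)).congr_deriv (by rw [hqT t]; ring)) hs
    (by have := hW s (s+T)
        rw [P1 s, P1' s] at this
        linear_combination this)
  set P : ℝ → ℝ := fun t => φ2 t - α / T * t * φ1 t with hP
  have PP : Periodic P T := fun t => by
    simp only [hP]
    rw [P1 t]
    have := hα t
    field_simp
    linear_combination T * this
  obtain ⟨C2, hC2, b2⟩ := per_bdd (by simp only [hP]; fun_prop : Continuous P) hT PP
  have e2 : ∀ t, φ2 t = α / T * t * φ1 t + P t := fun t => by simp only [hP]; ring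
  set D : ℝ := |α| / T * C1 ^ 2 + 2 * C1 * C2 + |α| / T * C1 + C1 + C2 with hD
  have hα0 : 0 ≤ |α| / T := by positivity
  have hD0 : 0 ≤ D := by positivity
  refine solvA (α := 1/2) (C := 2 * D) (w0 := φ1 0 * ψ2 0 - ψ1 0 * φ2 0)
    ⟨hqc.continuousOn, fun t _ => d1 t, fun t _ => d1' t, fun t _ => d2 t, fun t _ => d2' t, fun t _ => hW 0 t, hw⟩ (by positivity) (by linarith) (fun t ht => ?_) (fun t ht => ?_) (fun t ht s hs => ?_)
  · have h1 := one_add_le (by linarith : 0 ≤ t)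
    calc |φ1 t| ≤ C1 := b1 t
      _ ≤ D := by rw [hD]; nlinarith [mul_nonneg hC1 hC2, mul_nonneg hα0 hC1, mul_nonneg hα0 (sq_nonneg C1)]
      _ ≤ D * (1 + t) := by nlinarith
      _ ≤ D * (2 * exp (1/2 * t)) := by gcongr
      _ = _ := by ring
  · have h1 := one_add_le (by linarith : 0 ≤ t)
    calc |φ2 t| = |α / T * t * φ1 t + P t| := by rw [e2]
      _ ≤ |α| / T * t * |φ1 t| + |P t| := by
          refine (abs_add_le _ _).trans (le_of_eq ?_)
          rw [abs_mul, abs_mul, abs_div, abs_of_pos hT, abs_of_pos (by linarith : 0 < t)]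
      _ ≤ |α| / T * t * C1 + C2 := by
          have h0 : 0 ≤ |α| / T * t := mul_nonneg hα0 (by linarith)
          have := b2 t
          have := b1 t
          gcongr
      _ ≤ D * (1 + t) := by
          rw [hD]
          have h0 : 0 ≤ t := by linarith
          have := mul_nonneg hC2 h0
          have := mul_nonneg hα0 hC1
          have := mul_nonneg hC1 hC2
          have := mul_nonneg hα0 (sq_nonneg C1)
          have e : (|α| / T * C1 ^ 2 + 2 * C1 * C2 + |α| / T * C1 + C1 + C2) * (1 + t) - (|α| / T * t * C1 + C2) =
            (|α| / T * C1 ^ 2 + 2 * (C1 * C2) + C1) * (1 + t) + |α| / T * C1 + C2 * t := by ring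
          have : 0 ≤ (|α| / T * C1 ^ 2 + 2 * (C1 * C2) + C1) * (1 + t) := by positivity
          linarith
      _ ≤ D * (2 * exp (1/2 * t)) := by gcongr
      _ = _ := by ring
  · have h1 := one_add_le (by linarith : 0 ≤ s - t)
    have e : φ1 s * φ2 t - φ1 t * φ2 s = α / T * (t - s) * (φ1 s * φ1 t) + (φ1 s * P t - φ1 t * P s) := by
      rw [e2 t, e2 s]; ring
    rw [e]
    calc |α / T * (t - s) * (φ1 s * φ1 t) + (φ1 s * P t - φ1 t * P s)|
        ≤ |α| / T * (s - t) * (|φ1 s| * |φ1 t|) + (|φ1 s| * |P t| + |φ1 t| * |P s|) := by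
          refine (abs_add_le _ _).trans (add_le_add (le_of_eq ?_) ((abs_sub _ _).trans (by rw [abs_mul, abs_mul])))
          rw [abs_mul, abs_mul, abs_mul, abs_div, abs_of_pos hT, abs_of_neg (by linarith : t - s < 0), neg_sub]
      _ ≤ |α| / T * (s - t) * (C1 * C1) + (C1 * C2 + C1 * C2) := by
          have h0 : 0 ≤ |α| / T * (s - t) := mul_nonneg hα0 (by linarith)
          have := b2 t
          have := b1 t
          have := b2 s
          have := b1 s
          gcongr
      _ ≤ D * (1 + (s - t)) := by
          rw [hD]
          have h0 : 0 ≤ s - t := by linarith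
          have := mul_nonneg hα0 (sq_nonneg C1)
          have e : (|α| / T * C1 ^ 2 + 2 * C1 * C2 + |α| / T * C1 + C1 + C2) * (1 + (s - t)) - (|α| / T * (s - t) * (C1 * C1) + (C1 * C2 + C1 * C2)) =
            |α| / T * C1 ^ 2 + 2 * (C1 * C2) * (s - t) + (|α| / T * C1 + C1 + C2) * (1 + (s - t)) := by ring
          have : 0 ≤ 2 * (C1 * C2) * (s - t) := by positivity
          have : 0 ≤ (|α| / T * C1 + C1 + C2) * (1 + (s - t)) := by positivity
          linarith
      _ ≤ D * (2 * exp (1/2 * (s - t))) := by gcongr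
      _ = _ := by ring

lemma mode_zero (hn : 3 ≤ n) {K0 T β : ℝ} {ξ : ℝ → ℝ} (hξ : FowlerXi n K0 ξ T) (hβ : 1 < β) :
    Solvable (fun t => (((0:ℕ):ℝ) + ((n:ℝ)-2)/2)^2 - Vh n K0 ξ t) β (fun t => exp (-β * t)) := by
  have hn2 : (0:ℝ) < (n:ℝ) - 2 := by
    have : (3:ℝ) ≤ n := by exact_mod_cast hn
    linarith
  obtain ⟨hC, hpos, hT, hper, heq⟩ := id hξ
  obtain ⟨Q, hQ⟩ := q_bdd hξ ((((0:ℕ):ℝ) + ((n:ℝ)-2)/2)^2)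
  set q : ℝ → ℝ := fun t => (((0:ℕ):ℝ) + ((n:ℝ)-2)/2)^2 - Vh n K0 ξ t with hq
  have hqc : Continuous q := continuous_const.sub (Vh_cont hξ)
  have hqT : Periodic q T := fun t => by simp only [hq, Vh_per hξ t]
  obtain ⟨d1, d1'⟩ := C2_derivs hC
  set pp : ℝ := ((n:ℝ)+2)/((n:ℝ)-2) with hpp
  have hpp1 : pp - 1 = 4 / ((n:ℝ)-2) := by rw [hpp]; field_simp; ring
  have hd2 : ∀ t, dtt ξ t = ((n:ℝ)-2)^2/4 * ξ t - K0 * ξ t ^ pp := fun t => by linarith [heq t]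
  have d2 : ∀ t, HasDerivAt (fun t => dtt ξ t) (q t * deriv ξ t) t := by
    intro t
    have : HasDerivAt (fun t => ((n:ℝ)-2)^2/4 * ξ t - K0 * ξ t ^ pp) (q t * deriv ξ t) t := by
      refine (((d1 t).const_mul _).sub (((d1 t).rpow_const (Or.inl (hpos t).ne')).const_mul K0)).congr_deriv ?_
      simp only [hq, Vh]
      rw [hpp1]; push_cast; ring
    exact this.congr_of_eventuallyEq (Eventually.of_forall hd2)
  have P1 : Periodic (deriv ξ) T := fun t => by
    have : (fun t => ξ (t + T)) = ξ := funext hper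
    rw [← deriv_comp_add_const, this]
  have P2 : Periodic (fun t => dtt ξ t) T := fun t => by simp only [hd2, hper t]
  by_cases hcase : deriv ξ 0 = 0 ∧ dtt ξ 0 = 0
  · have hz := ode_uniq hQ d1' d2 hcase.1 hcase.2
    have hqv : ∀ t, q t = -((n:ℝ)-2) := by
      intro t
      have e0 : dtt ξ t = 0 := by
        have e : deriv ξ = fun _ => 0 := funext hz
        have := d1' t
        rw [e] at this
        exact this.unique (hasDerivAt_const _ _)
      have e1 := hd2 t
      rw [e0] at e1
      have e2 : ξ t ^ pp = ξ t ^ ((4:ℝ)/((n:ℝ)-2)) * ξ t := by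
        rw [← hpp1, rpow_sub_one (hpos t).ne']; field_simp [(hpos t).ne']
      rw [e2] at e1
      have e3 : K0 * ξ t ^ ((4:ℝ)/((n:ℝ)-2)) = ((n:ℝ)-2)^2/4 := by
        have : (((n:ℝ)-2)^2/4 - K0 * ξ t ^ ((4:ℝ)/((n:ℝ)-2))) * ξ t = 0 := by linarith
        rcases mul_eq_zero.1 this with h | h
        · linarith
        · exact absurd h (hpos t).ne'
      simp only [hq, Vh]
      rw [mul_assoc, e3]; push_cast; field_simp; ring
    set ω := √((n:ℝ)-2) with hω
    have hω0 : 0 < ω := Real.sqrt_pos.2 hn2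
    have hω2 : ω * ω = (n:ℝ)-2 := Real.mul_self_sqrt hn2.le
    have dm : ∀ t, HasDerivAt (fun t => ω * t) ω t := fun t => by simpa using (hasDerivAt_id t).const_mul ω
    refine solvA (α := 1/2) (C := 2) (w0 := ω) (φ1 := fun t => cos (ω * t)) (ψ1 := fun t => - sin (ω * t) * ω)
      (φ2 := fun t => sin (ω * t)) (ψ2 := fun t => cos (ω * t) * ω)
      ⟨hqc.continuousOn, fun t _ => (dm t).cos, fun t _ => ?_, fun t _ => (dm t).sin, fun t _ => ?_, fun t _ => ?_, hω0.ne'⟩ (by norm_num) (by linarith) (fun t ht => ?_) (fun t ht => ?_) (fun t ht s hs => ?_)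
    · refine ((dm t).sin.neg.mul_const ω).congr_deriv ?_
      rw [hqv, ← hω2]; ring
    · refine ((dm t).cos.mul_const ω).congr_deriv ?_
      rw [hqv, ← hω2]; ring
    · have := sin_sq_add_cos_sq (ω * t)
      linear_combination ω * this
    · have := abs_cos_le_one (ω * t)
      have : 1 ≤ exp (1/2 * t) := one_le_exp (by linarith)
      linarith
    · have := abs_sin_le_one (ω * t)
      have : 1 ≤ exp (1/2 * t) := one_le_exp (by linarith)
      linarith
    · have e : cos (ω * s) * sin (ω * t) - cos (ω * t) * sin (ω * s) = sin (ω * t - ω * s) := by rw [sin_sub]; ring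
      rw [e]
      have := abs_sin_le_one (ω * t - ω * s)
      have : 1 ≤ exp (1/2 * (s - t)) := one_le_exp (by linarith)
      linarith
  · obtain ⟨f1, g1, f10, g10, df1, dg1⟩ := ode_exist hqc hQ 1 0
    obtain ⟨f2, g2, f20, g20, df2, dg2⟩ := ode_exist hqc hQ 0 1
    by_cases h0 : deriv ξ 0 = 0
    · have h1 : dtt ξ 0 ≠ 0 := fun h => hcase ⟨h0, h⟩
      exact floquet hqc hQ hT hqT d1' d2 df1 dg1 P1 P2 (by rw [f10, g10]; simpa using h1) hβ
    · exact floquet hqc hQ hT hqT d1' d2 df2 dg2 P1 P2 (by rw [f20, g20]; simpa using h0) hβ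

/-- All modes are solvable. -/
lemma mode_solv (hn : 3 ≤ n) {K0 T β : ℝ} {ξ : ℝ → ℝ} {ρ : ℕ → ℝ} (hξ : FowlerXi n K0 ξ T) (hρ : FowlerExponents n K0 ξ T ρ)
    (hβ : 1 < β) (k : ℕ) : ((¬ ∃ i, 1 ≤ i ∧ ρ i = β) → Solvable (fun t => ((k:ℝ) + ((n:ℝ)-2)/2)^2 - Vh n K0 ξ t) β (fun t => exp (-β * t))) ∧
      Solvable (fun t => ((k:ℝ) + ((n:ℝ)-2)/2)^2 - Vh n K0 ξ t) β (fun t => t * exp (-β * t)) := by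
  cases k with
  | zero =>
    refine ⟨fun _ => mode_zero hn hξ hβ, (mode_zero hn hξ hβ).mono fun t ht => ?_⟩
    nlinarith [exp_pos (-β * t)]
  | succ k => exact mode_pos hn hξ hρ (by linarith) k
end P15

section P16
open MeasureTheory Topology
variable {n : ℕ}

abbrev EE (n : ℕ) := EuclideanSpace ℝ (Fin n)

structure Good (R A γ : ℝ) (g : EE n → ℝ) : Prop where
  cont : ContinuousOn g (ball 0 R \ {0})
  bd : ∀ x ∈ ball (0 : EE n) R \ {0}, |g x| ≤ A * ‖x‖ ^ γ
  sup : ∀ x, x ∉ ball (0 : EE n) R \ {0} → g x = 0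

lemma OmO (R : ℝ) : IsOpen (ball (0 : EE n) R \ {0}) := isOpen_ball.sdiff isClosed_singleton

lemma Good.sub {R A B γ : ℝ} {f g : EE n → ℝ} (hf : Good R A γ f) (hg : Good R B γ g) :
    Good R (A + B) γ (fun x => f x - g x) where
  cont := hf.cont.sub hg.cont
  bd x hx := by
    have h1 := hf.bd x hx
    have h2 := hg.bd x hx
    calc |f x - g x| ≤ |f x| + |g x| := abs_sub _ _
      _ ≤ _ := by rw [add_mul]; linarith
  sup x hx := by rw [hf.sup x hx, hg.sup x hx, sub_zero]

lemma Good.mono_A {R A B γ : ℝ} {f : EE n → ℝ} (hf : Good R A γ f) (hg : ∀ x ∈ ball (0 : EE n) R \ {0}, |f x| ≤ B * ‖x‖ ^ γ) :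
    Good R B γ f := ⟨hf.cont, hg, hf.sup⟩

lemma Good.int (hn : 3 ≤ n) {R A γ : ℝ} {g : EE n → ℝ} (h : Good R A γ g) (hγ : -(n:ℝ) < γ) : Integrable g volume := by
  have hind : g = (ball (0 : EE n) R \ {0}).indicator g := by
    ext x; by_cases hx : x ∈ ball (0 : EE n) R \ {0}
    · rw [indicator_of_mem hx]
    · rw [indicator_of_notMem hx, h.sup x hx]
  have hm : AEStronglyMeasurable g volume := by
    rw [hind]
    exact (aestronglyMeasurable_indicator_iff (OmO R).measurableSet).2 (h.cont.aestronglyMeasurable (OmO R).measurableSet)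
  have : IntegrableOn g (ball 0 R) volume := by
    refine integrableOn_ball_of_norm_le_rpow (C := A) (α := -γ) (by simp; omega) (by simp; linarith) ?_ hm
    rw [ae_restrict_iff' measurableSet_ball]
    filter_upwards [ae_ne_zero hn] with x hx hxb
    rw [neg_neg]
    exact h.bd x ⟨hxb, hx⟩
  have e : (ball (0:EE n) R).indicator g = g := by
    rw [indicator_eq_self]
    intro x hx
    by_contra hxb
    exact hx (h.sup x fun hh => hxb hh.1)
  rw [← e, integrable_indicator_iff measurableSet_ball]; exact this

lemma Good.sup1 {R A γ : ℝ} {g : EE n → ℝ} (h : Good R A γ g) (hR : R ≤ 1) : ∀ y, y ∉ ball (0 : EE n) 1 → g y = 0 :=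
  fun y hy => h.sup y fun hh => hy (ball_subset_ball hR hh.1)

lemma HH.bound {k : ℕ} {Y : EE n → ℝ} (hY : HH k Y) : ∃ C, 0 ≤ C ∧ ∀ x, x ≠ 0 → |Y x| ≤ C * ‖x‖ ^ k := by
  obtain ⟨C, hC⟩ := (isCompact_sphere (0 : EE n) 1).exists_bound_of_continuousOn hY.smooth.continuous.continuousOn
  refine ⟨|C|, abs_nonneg _, fun x hx => ?_⟩
  have hr := norm_pos_iff.2 hx
  have e : Y x = ‖x‖ ^ k * Y (‖x‖⁻¹ • x) := by
    rw [← hY.homog, smul_smul, mul_inv_cancel₀ hr.ne', one_smul]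
  have := hC (‖x‖⁻¹ • x) (by simp [norm_smul, hr.ne'])
  rw [e, abs_mul, abs_of_nonneg (pow_nonneg (norm_nonneg x) k), mul_comm]
  exact mul_le_mul_of_nonneg_right (this.trans (le_abs_self _)) (pow_nonneg (norm_nonneg x) k)

lemma sphI_sub {F G : EE n → ℝ} {R r : ℝ} (hF : ContinuousOn F (ball 0 R \ {0})) (hG : ContinuousOn G (ball 0 R \ {0}))
    (hr : r ∈ Ioo 0 R) : sphI (fun y => F y - G y) r = sphI F r - sphI G r := by
  have key : ∀ F : EE n → ℝ, ContinuousOn F (ball 0 R \ {0}) →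
      Integrable (fun ω : sphere (0 : EE n) 1 => F (r • ω.1)) (volume : Measure (EE n)).toSphere := by
    intro F hF
    have : Continuous fun ω : sphere (0 : EE n) 1 => F (r • ω.1) := by
      refine hF.comp_continuous (by fun_prop) fun ω => ?_
      have hω : ‖ω.1‖ = 1 := by simp
      have hr1 : 0 < r := hr.1
      refine ⟨?_, ?_⟩
      · simp only [mem_ball_zero_iff, norm_smul, hω, mul_one, Real.norm_of_nonneg hr1.le]
        exact hr.2
      · rw [mem_singleton_iff, ← norm_eq_zero, norm_smul, hω, mul_one, Real.norm_of_nonneg hr1.le]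
        exact hr1.ne'
    exact this.integrable_of_hasCompactSupport (HasCompactSupport.of_compactSpace _)
  exact integral_sub (key F hF) (key G hG)

lemma lowk (hn : 3 ≤ n) {β K0 : ℝ} {W ξ : ℝ → ℝ} (k : ℕ)
    (hS : Solvable (fun t => ((k:ℝ) + ((n:ℝ)-2)/2)^2 - Vh n K0 ξ t) β W) {γ : ℝ} (hγ : γ = β - ((n:ℝ)-2)/2 - 2)
    (hγn : -(n:ℝ) < γ) :
    ∃ C, 0 ≤ C ∧ ∀ R, 0 < R → R ≤ exp (-1) → ∃ L : (EE n → ℝ) → (EE n → ℝ),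
      (∀ g A, Good R A γ g → ∀ x ∈ ball (0 : EE n) R \ {0}, ContDiffAt ℝ 2 (Mk k g) x ∧ ContDiffAt ℝ 2 (L g) x ∧
        - lapE (L g) x = ‖x‖ ^ (-2:ℝ) * Vh n K0 ξ (-Real.log ‖x‖) * L g x + (- lapE (Mk k g) x) ∧
        |L g x| ≤ C * A * (‖x‖ ^ (-(((n:ℝ)-2)/2)) * W (-Real.log ‖x‖))) ∧
      ∀ f g A B, Good R A γ f → Good R B γ g → ∀ x ∈ ball (0 : EE n) R \ {0}, L (fun y => f y - g y) x = L f x - L g x := by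
  obtain ⟨N, Y, b, Cb, hY, hb, hCb, hbd, hsep⟩ := Zk_sep2 n k
  choose CY hCY0 hCY using fun i => (hY i).bound
  obtain ⟨C, hC, hS⟩ := hS
  set σ := ((volume : Measure (EE n)).toSphere univ).toReal with hσ
  have hσ0 : 0 ≤ σ := ENNReal.toReal_nonneg
  set μ : ℝ := k + ((n:ℝ)-2)/2 with hμ
  have hn3 : (3:ℝ) ≤ n := by exact_mod_cast hn
  have hkn : 0 ≤ 2 * (k:ℝ) + n - 2 := by
    have : (0:ℝ) ≤ k := by positivity
    linarith
  set CF : ℝ := (2 * (k:ℝ) + n - 2) * (Cb * σ) with hCF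
  have hCF0 : 0 ≤ CF := by positivity
  refine ⟨∑ i, C * CF * CY i, Finset.sum_nonneg fun i _ => by have := hCY0 i; positivity, fun R hR hR1 => ?_⟩
  have ht0 : 1 ≤ -Real.log R := by
    have := (Real.log_le_iff_le_exp hR).2 hR1
    linarith
  have hR1' : R ≤ 1 := hR1.trans (exp_le_one_iff.2 (by norm_num))
  obtain ⟨S, hS1, hS2⟩ := hS (-Real.log R) ht0
  set F : Fin N → (EE n → ℝ) → ℝ → ℝ := fun i g t =>
    (2 * (k:ℝ) + n - 2) * (exp (-t) ^ (μ + 2) * (exp (-t) ^ (2*k))⁻¹) * sphI (fun y => b i y * g y) (exp (-t)) with hF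
  have hbg : ∀ i g A, Good R A γ g → ContinuousOn (fun y => b i y * g y) (ball 0 R \ {0}) := fun i g A hg =>
    ((hb i).mono fun y hy => hy.2).mul hg.cont
  have hexp : ∀ t, -Real.log R < t → exp (-t) ∈ Ioo 0 R := fun t ht =>
    ⟨exp_pos _, by rw [← Real.lt_log_iff_exp_lt hR]; linarith⟩
  have hadm : ∀ i g A, Good R A γ g → Adm (-Real.log R) β (CF * A) (F i g) := by
    intro i g A hg
    constructor
    · have h1 : ContinuousOn (fun t => sphI (fun y => b i y * g y) (exp (-t))) (Ioi (-Real.log R)) :=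
        (sphI_continuousOn (hbg i g A hg)).comp (by fun_prop) fun t ht => hexp t ht
      have h2 : Continuous fun t : ℝ => exp (-t) ^ (μ + 2) :=
        Continuous.rpow_const (by fun_prop) fun t => Or.inl (exp_pos _).ne'
      have h3 : Continuous fun t : ℝ => (exp (-t) ^ (2*k))⁻¹ :=
        Continuous.inv₀ (by fun_prop) fun t => (pow_pos (exp_pos _) _).ne'
      exact (continuous_const.mul (h2.mul h3)).continuousOn.mul h1
    · intro t ht
      obtain ⟨hr0, hrR⟩ := hexp t ht
      have hr : exp (-β * t) = exp (-t) ^ β := by rw [← exp_mul]; ring_nf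
      rw [hr]
      simp only [hF]
      set r := exp (-t) with hrdef
      have hsb : |sphI (fun y => b i y * g y) r| ≤ (Cb * r ^ k * (A * r ^ γ)) * σ := by
        refine sphI_bound fun ω hω => ?_
        have hnorm : ‖r • ω‖ = r := by rw [norm_smul, hω, mul_one, Real.norm_of_nonneg hr0.le]
        have hne : r • ω ≠ 0 := by rw [← norm_ne_zero_iff, hnorm]; exact hr0.ne'
        have h1 := hbd i _ hne
        have h2 := hg.bd (r • ω) ⟨by rw [mem_ball_zero_iff, hnorm]; exact hrR, hne⟩
        rw [hnorm] at h1 h2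
        rw [abs_mul]
        exact mul_le_mul h1 h2 (abs_nonneg _) (by positivity)
      rw [abs_mul, abs_of_nonneg (by positivity)]
      calc (2 * (k:ℝ) + n - 2) * (r ^ (μ + 2) * (r ^ (2*k))⁻¹) * |sphI (fun y => b i y * g y) r|
          ≤ (2 * (k:ℝ) + n - 2) * (r ^ (μ + 2) * (r ^ (2*k))⁻¹) * ((Cb * r ^ k * (A * r ^ γ)) * σ) := by gcongr
        _ = CF * A * (r ^ (μ+2) * r ^ γ * (r ^ k)⁻¹) := by
            rw [hCF, two_mul k, pow_add]; field_simp
        _ = CF * A * r ^ β := by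
            rw [← rpow_natCast, ← rpow_neg hr0.le, ← rpow_add hr0, ← rpow_add hr0]
            congr 2; rw [hμ, hγ]; ring
  have hFsub : ∀ i f g A B, Good R A γ f → Good R B γ g → F i (fun y => f y - g y) = fun t => F i f t - F i g t := by
    intro i f g A B hf hg
    ext t
    have : sphI (fun y => b i y * (f y - g y)) (exp (-t)) = sphI (fun y => b i y * f y) (exp (-t)) - sphI (fun y => b i y * g y) (exp (-t)) := by
      by_cases hr : exp (-t) < R
      · rw [← sphI_sub (hbg i f A hf) (hbg i g B hg) ⟨exp_pos _, hr⟩]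
        simp only [mul_sub]
      · have z : ∀ (g : EE n → ℝ) A, Good R A γ g → sphI (fun y => b i y * g y) (exp (-t)) = 0 := by
          intro g A hg
          unfold sphI
          rw [← integral_zero (sphere (0 : EE n) 1) ℝ]
          congr 1; ext ω
          have hω : ‖ω.1‖ = 1 := by simp
          show b i (exp (-t) • ω.1) * g (exp (-t) • ω.1) = 0
          rw [hg.sup, mul_zero]
          intro hh
          have := mem_ball_zero_iff.1 hh.1
          rw [norm_smul, hω, mul_one, Real.norm_of_nonneg (exp_pos _).le] at this
          exact hr this
        rw [z f A hf, z g B hg, z _ _ (hf.sub hg), sub_zero]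
    simp only [hF]
    rw [this]; ring
  set L : (EE n → ℝ) → (EE n → ℝ) := fun g x => ∑ i, cylF μ (S (F i g)) (Y i) x with hL
  refine ⟨L, fun g A hg x hx => ?_, fun f g A B hf hg x hx => ?_⟩
  · have hx0 : x ≠ 0 := hx.2
    have hr : 0 < ‖x‖ := norm_pos_iff.2 hx0
    have ht : -Real.log R < -Real.log ‖x‖ := neg_lt_neg (Real.log_lt_log hr (mem_ball_zero_iff.1 hx.1))
    have hexpl : exp (- -Real.log ‖x‖) = ‖x‖ := by rw [neg_neg, exp_log hr]
    obtain ⟨m1, m2⟩ := Mk_lap hn hY hb hCb hbd hsep (hg.int hn hγn) (hg.sup1 hR1') hg.cont hx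
    have hs := fun i => hS1 (F i g) _ (hadm i g A hg)
    have hcyl := fun i => cylF_lap hx0 hμ ((hs i).1.contDiffAt (isOpen_Ioi.mem_nhds ht)) (hY i)
    refine ⟨m1, ?_, ?_, ?_⟩
    · simp only [hL]
      exact ContDiffAt.sum fun i _ => (hcyl i).1
    · simp only [hL]
      rw [lapE_sum _ fun i _ => (hcyl i).1, m2, neg_neg, ← Finset.sum_neg_distrib, Finset.mul_sum, ← Finset.sum_add_distrib]
      refine Finset.sum_congr rfl fun i _ => ?_
      have ho := (hs i).2.1 _ ht
      rw [(hcyl i).2]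
      have hFv : F i g (-Real.log ‖x‖) = (2 * (k:ℝ) + n - 2) * (‖x‖ ^ (μ + 2) * (‖x‖ ^ (2*k))⁻¹) * sphI (fun y => b i y * g y) ‖x‖ := by
        simp only [hF]; rw [hexpl]
      rw [hFv] at ho
      have hp : ‖x‖ ^ (-μ - 2) * ‖x‖ ^ (μ + 2) = 1 := by rw [← rpow_add hr]; ring_nf; simp
      have hp2 : ‖x‖ ^ (-μ - 2) = ‖x‖ ^ (-2:ℝ) * ‖x‖ ^ (-μ) := by rw [← rpow_add hr]; ring_nf
      have e : deriv (deriv (S (F i g))) (-Real.log ‖x‖) - μ ^ 2 * S (F i g) (-Real.log ‖x‖) =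
        - Vh n K0 ξ (-Real.log ‖x‖) * S (F i g) (-Real.log ‖x‖) - (2 * (k:ℝ) + n - 2) * (‖x‖ ^ (μ + 2) * (‖x‖ ^ (2*k))⁻¹) * sphI (fun y => b i y * g y) ‖x‖ := by linarith
      rw [e]
      unfold cylF
      have e3 : ‖x‖ ^ (-μ - 2) * (- Vh n K0 ξ (-Real.log ‖x‖) * S (F i g) (-Real.log ‖x‖) - (2 * (k:ℝ) + n - 2) * (‖x‖ ^ (μ + 2) * (‖x‖ ^ (2*k))⁻¹) * sphI (fun y => b i y * g y) ‖x‖)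
         = ‖x‖ ^ (-μ - 2) * (- Vh n K0 ξ (-Real.log ‖x‖) * S (F i g) (-Real.log ‖x‖)) - (‖x‖ ^ (-μ - 2) * ‖x‖ ^ (μ + 2)) * ((2 * (k:ℝ) + n - 2) * (‖x‖ ^ (2*k))⁻¹ * sphI (fun y => b i y * g y) ‖x‖) := by ring
      rw [e3, hp, hp2]; ring
    · simp only [hL]
      refine (Finset.abs_sum_le_sum_abs _ _).trans ?_
      rw [Finset.sum_mul, Finset.sum_mul]
      refine Finset.sum_le_sum fun i _ => ?_
      have h1 := (hs i).2.2 _ ht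
      have h2 := hCY i x hx0
      unfold cylF
      rw [abs_mul, abs_mul, abs_of_nonneg (rpow_nonneg hr.le _)]
      have h0 := (abs_nonneg _).trans h1
      calc ‖x‖ ^ (-μ) * |S (F i g) (-Real.log ‖x‖)| * |Y i x|
          ≤ ‖x‖ ^ (-μ) * (C * (CF * A) * W (-Real.log ‖x‖)) * (CY i * ‖x‖ ^ k) := by gcongr
        _ = C * CF * CY i * A * ((‖x‖ ^ (-μ) * ‖x‖ ^ k) * W (-Real.log ‖x‖)) := by ring
        _ = _ := by
            rw [← rpow_natCast, ← rpow_add hr, hμ]; congr 4; ring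
  · have hr : 0 < ‖x‖ := norm_pos_iff.2 hx.2
    have ht : -Real.log R < -Real.log ‖x‖ := neg_lt_neg (Real.log_lt_log hr (mem_ball_zero_iff.1 hx.1))
    simp only [hL]
    rw [← Finset.sum_sub_distrib]
    refine Finset.sum_congr rfl fun i _ => ?_
    unfold cylF
    rw [hFsub i f g A B hf hg, hS2 _ _ _ _ (hadm i f A hf) (hadm i g B hg) _ ht]; ring

/-- The low-mode solution operator. -/
lemma low (hn : 3 ≤ n) {β K0 : ℝ} {W ξ : ℝ → ℝ}
    (hS : ∀ k : ℕ, Solvable (fun t => ((k:ℝ) + ((n:ℝ)-2)/2)^2 - Vh n K0 ξ t) β W) {γ : ℝ} (hγ : γ = β - ((n:ℝ)-2)/2 - 2)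
    (hγn : -(n:ℝ) < γ) (D : ℕ) (κ : ℕ → ℝ) :
    ∃ C, 0 ≤ C ∧ ∀ R, 0 < R → R ≤ exp (-1) → ∃ L : (EE n → ℝ) → (EE n → ℝ),
      (∀ g A, Good R A γ g → ∀ x ∈ ball (0 : EE n) R \ {0}, (∀ k, ContDiffAt ℝ 2 (Mk k g) x) ∧ ContDiffAt ℝ 2 (L g) x ∧
        - lapE (L g) x = ‖x‖ ^ (-2:ℝ) * Vh n K0 ξ (-Real.log ‖x‖) * L g x + (cN n)⁻¹ * ∑ k ∈ Finset.range D, κ k * (- lapE (Mk k g) x) ∧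
        |L g x| ≤ C * A * (‖x‖ ^ (-(((n:ℝ)-2)/2)) * W (-Real.log ‖x‖))) ∧
      ∀ f g A B, Good R A γ f → Good R B γ g → ∀ x ∈ ball (0 : EE n) R \ {0}, L (fun y => f y - g y) x = L f x - L g x := by
  choose C hC h using fun k => lowk hn k (hS k) hγ hγn
  refine ⟨∑ k ∈ Finset.range D, |(cN n)⁻¹ * κ k| * C k, Finset.sum_nonneg fun k _ => mul_nonneg (abs_nonneg _) (hC k), fun R hR hR1 => ?_⟩
  choose L h1 h2 using fun k => h k R hR hR1
  refine ⟨fun g x => ∑ k ∈ Finset.range D, ((cN n)⁻¹ * κ k) * L k g x, fun g A hg x hx => ?_, fun f g A B hf hg x hx => ?_⟩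
  · have hc : ∀ k ∈ Finset.range D, ContDiffAt ℝ 2 (fun x => ((cN n)⁻¹ * κ k) * L k g x) x := fun k _ =>
      contDiffAt_const.mul (h1 k g A hg x hx).2.1
    refine ⟨fun k => (h1 k g A hg x hx).1, ContDiffAt.sum hc, ?_, ?_⟩
    · rw [lapE_sum _ hc, ← Finset.sum_neg_distrib, Finset.mul_sum, Finset.mul_sum, ← Finset.sum_add_distrib]
      refine Finset.sum_congr rfl fun k _ => ?_
      rw [lapE_const_mul _ (h1 k g A hg x hx).2.1]
      have := (h1 k g A hg x hx).2.2.1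
      linear_combination (cN n)⁻¹ * κ k * this
    · refine (Finset.abs_sum_le_sum_abs _ _).trans ?_
      rw [Finset.sum_mul, Finset.sum_mul]
      refine Finset.sum_le_sum fun k _ => ?_
      rw [abs_mul]
      have := (h1 k g A hg x hx).2.2.2
      calc _ ≤ |(cN n)⁻¹ * κ k| * (C k * A * (‖x‖ ^ (-(((n:ℝ)-2)/2)) * W (-Real.log ‖x‖))) := by gcongr
        _ = _ := by ring
  · simp only []
    rw [← Finset.sum_sub_distrib]
    refine Finset.sum_congr rfl fun k _ => ?_
    rw [h2 k f g A B hf hg x hx]; ring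
end P16

section P17
open MeasureTheory Topology
variable {n : ℕ}

open Classical in
/-- Contraction principle in the weighted space. -/
lemma fixpt {R γ M : ℝ} (hM : 0 ≤ M) (Φ : (EE n → ℝ) → (EE n → ℝ))
    (h0 : ∀ g, Good R M γ g → ContinuousOn (Φ g) (ball 0 R \ {0}))
    (hsup : ∀ g x, x ∉ ball (0 : EE n) R \ {0} → Φ g x = 0)
    (h1 : ∀ x ∈ ball (0 : EE n) R \ {0}, |Φ (fun _ => 0) x| ≤ M / 2 * ‖x‖ ^ γ)
    (hc : ∀ f g A, Good R M γ f → Good R M γ g → 0 ≤ A → (∀ x ∈ ball (0 : EE n) R \ {0}, |f x - g x| ≤ A * ‖x‖ ^ γ) →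
      ∀ x ∈ ball (0 : EE n) R \ {0}, |Φ f x - Φ g x| ≤ A / 2 * ‖x‖ ^ γ) :
    ∃ g, Good R M γ g ∧ ∀ x, Φ g x = g x := by
  set Ω : Set (EE n) := ball (0 : EE n) R \ {0} with hΩ
  have hpos : ∀ x ∈ Ω, 0 < ‖x‖ := fun x hx => norm_pos_iff.2 hx.2
  have hw : ContinuousOn (fun x : EE n => ‖x‖ ^ γ) Ω := fun x hx =>
    (ContinuousAt.rpow_const continuous_norm.continuousAt (Or.inl (hpos x hx).ne')).continuousWithinAt
  have hw' : ContinuousOn (fun x : EE n => ‖x‖ ^ (-γ)) Ω := fun x hx =>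
    (ContinuousAt.rpow_const continuous_norm.continuousAt (Or.inl (hpos x hx).ne')).continuousWithinAt
  have hww : ∀ x ∈ Ω, ‖x‖ ^ γ * ‖x‖ ^ (-γ) = 1 := fun x hx => by
    rw [← rpow_add (hpos x hx), add_neg_cancel, rpow_zero]
  have hz : Good R M γ (fun _ : EE n => (0:ℝ)) :=
    ⟨continuousOn_const, fun x hx => by rw [abs_zero]; positivity, fun _ _ => rfl⟩
  -- Φ preserves the ball
  have hP : ∀ g, Good R M γ g → Good R M γ (Φ g) := by
    intro g hg
    refine ⟨h0 g hg, fun x hx => ?_, hsup g⟩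
    have a1 := h1 x hx
    have a2 := hc g (fun _ => 0) M hg hz hM (fun x hx => by rw [sub_zero]; exact hg.bd x hx) x hx
    have : |Φ g x| ≤ |Φ g x - Φ (fun _ => 0) x| + |Φ (fun _ => 0) x| := by
      have := abs_add_le (Φ g x - Φ (fun _ => 0) x) (Φ (fun _ => 0) x)
      simpa using this
    linarith
  let e : BoundedContinuousFunction Ω ℝ → EE n → ℝ := fun G x => if h : x ∈ Ω then G ⟨x, h⟩ * ‖x‖ ^ γ else 0
  have he : ∀ G (x : EE n) (h : x ∈ Ω), e G x = G ⟨x, h⟩ * ‖x‖ ^ γ := fun G x h => dif_pos h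
  have heG : ∀ G : BoundedContinuousFunction Ω ℝ, ‖G‖ ≤ M → Good R M γ (e G) := by
    intro G hG
    refine ⟨?_, fun x hx => ?_, fun x hx => dif_neg hx⟩
    · rw [continuousOn_iff_continuous_domRestrict]
      have : (ball (0 : EE n) R \ {0}).domRestrict (e G) = fun x : Ω => G x * ‖x.1‖ ^ γ := by
        ext x; exact he G x.1 x.2
      rw [this]
      exact G.continuous.mul (continuousOn_iff_continuous_domRestrict.1 hw)
    · rw [he G x hx, abs_mul, abs_of_nonneg (rpow_nonneg (norm_nonneg x) γ)]
      exact mul_le_mul_of_nonneg_right ((G.norm_coe_le_norm _).trans hG) (rpow_nonneg (norm_nonneg x) γ)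
  have hd : ∀ g, Good R M γ g → ∃ G : BoundedContinuousFunction Ω ℝ, ‖G‖ ≤ M ∧ ∀ x : Ω, G x = g x.1 * ‖x.1‖ ^ (-γ) := by
    intro g hg
    have hcont : Continuous fun x : Ω => g x.1 * ‖x.1‖ ^ (-γ) :=
      continuousOn_iff_continuous_domRestrict.1 (hg.cont.mul hw')
    have hbd : ∀ x : Ω, ‖g x.1 * ‖x.1‖ ^ (-γ)‖ ≤ M := fun x => by
      rw [norm_mul, Real.norm_eq_abs, Real.norm_of_nonneg (rpow_nonneg (norm_nonneg x.1) _)]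
      calc _ ≤ M * ‖x.1‖ ^ γ * ‖x.1‖ ^ (-γ) := mul_le_mul_of_nonneg_right (hg.bd x.1 x.2) (rpow_nonneg (norm_nonneg x.1) _)
        _ = M := by rw [mul_assoc, hww x.1 x.2, mul_one]
    exact ⟨BoundedContinuousFunction.ofNormedAddCommGroup _ hcont M hbd,
      BoundedContinuousFunction.norm_ofNormedAddCommGroup_le hcont hM hbd, fun x => rfl⟩
  choose! d hd1 hd2 using hd
  let F : BoundedContinuousFunction Ω ℝ → BoundedContinuousFunction Ω ℝ := fun G => d (Φ (e G))
  have hmaps : MapsTo F (closedBall 0 M) (closedBall 0 M) := by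
    intro G hG
    rw [mem_closedBall_zero_iff] at hG ⊢
    exact hd1 _ (hP _ (heG G hG))
  have hcomp : IsComplete (closedBall (0 : BoundedContinuousFunction Ω ℝ) M) := isClosed_closedBall.isComplete
  have hcontr : ContractingWith (1/2) (hmaps.restrict F _ _) := by
    refine ⟨by rw [← NNReal.coe_lt_coe]; norm_num, LipschitzWith.of_dist_le_mul fun G G' => ?_⟩
    rw [Subtype.dist_eq, Subtype.dist_eq]
    have hG := mem_closedBall_zero_iff.1 G.2
    have hG' := mem_closedBall_zero_iff.1 G'.2
    show dist (F G.1) (F G'.1) ≤ _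
    have hcoe : ((1/2 : NNReal) : ℝ) = 1/2 := by norm_num
    rw [BoundedContinuousFunction.dist_le (by positivity), hcoe]
    intro x
    show dist (d (Φ (e G.1)) x) (d (Φ (e G'.1)) x) ≤ _
    rw [hd2 _ (hP _ (heG G.1 hG)), hd2 _ (hP _ (heG G'.1 hG')), Real.dist_eq, ← sub_mul, abs_mul,
      abs_of_nonneg (rpow_nonneg (norm_nonneg x.1) _)]
    have := hc _ _ (dist G.1 G'.1) (heG G.1 hG) (heG G'.1 hG') dist_nonneg (fun y hy => by
      rw [he _ y hy, he _ y hy, ← sub_mul, abs_mul, abs_of_nonneg (rpow_nonneg (norm_nonneg y) _)]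
      have hd3 : |G.1 ⟨y, hy⟩ - G'.1 ⟨y, hy⟩| ≤ dist G.1 G'.1 := by
        rw [← Real.dist_eq]; exact BoundedContinuousFunction.dist_coe_le_dist _
      exact mul_le_mul_of_nonneg_right hd3 (rpow_nonneg (norm_nonneg y) _)) x.1 x.2
    calc _ ≤ dist G.1 G'.1 / 2 * ‖x.1‖ ^ γ * ‖x.1‖ ^ (-γ) := mul_le_mul_of_nonneg_right this (rpow_nonneg (norm_nonneg x.1) _)
      _ = _ := by rw [mul_assoc, hww x.1 x.2]; ring
  obtain ⟨G, hGm, hG, -⟩ := hcontr.exists_fixedPoint' hcomp hmaps (x := 0) (by simp [hM]) (edist_ne_top _ _)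
  have hG1 := mem_closedBall_zero_iff.1 hGm
  refine ⟨e G, heG G hG1, fun x => ?_⟩
  by_cases hx : x ∈ Ω
  · have h2 := hd2 _ (hP _ (heG G hG1)) ⟨x, hx⟩
    have h3 : d (Φ (e G)) = G := hG
    rw [h3] at h2
    rw [he G x hx, h2, mul_assoc, mul_comm (‖x‖ ^ (-γ)), hww x hx, mul_one]
  · rw [hsup _ x hx]; exact ((heG G hG1).sup x hx).symm

def Hop (D : ℕ) (κ : ℕ → ℝ) (g : EE n → ℝ) (x : EE n) : ℝ :=
  (cN n)⁻¹ * (NP g x - ∑ k ∈ Finset.range D, κ k * Mk k g x)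

lemma TTg_int (hn : 3 ≤ n) (k : ℕ) {g : EE n → ℝ} (hg : Integrable g volume)
    (hs : ∀ y, y ∉ ball (0 : EE n) 1 → g y = 0) {x : EE n} (hx : x ≠ 0) : Integrable (fun y => TT k x y * g y) volume := by
  have hr : 0 < ‖x‖ := norm_pos_iff.2 hx
  set B := |BB (((n:ℝ)-2)/2) k| with hB
  refine (hg.norm.const_mul (B * ‖x‖ ^ k / ‖x‖ ^ (2*k+(n-2)))).mono' ((TT_meas k x).aestronglyMeasurable.mul hg.aestronglyMeasurable) ?_
  refine Eventually.of_forall fun y => ?_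
  by_cases hy : y ∈ ball (0 : EE n) 1
  · rw [norm_mul]
    refine mul_le_mul_of_nonneg_right ?_ (norm_nonneg _)
    have hb := Zk_bound hn k x y
    rw [mem_ball_zero_iff] at hy
    rw [TT, norm_div, Real.norm_eq_abs, Real.norm_of_nonneg (by positivity)]
    have h1 : |Zk k x y| ≤ B * ‖x‖ ^ k := by
      refine hb.trans ?_
      calc _ = BB (((n:ℝ)-2)/2) k * (‖x‖ ^ k * ‖y‖ ^ k) := by ring
        _ ≤ B * (‖x‖ ^ k * ‖y‖ ^ k) := mul_le_mul_of_nonneg_right (le_abs_self _) (by positivity)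
        _ ≤ B * (‖x‖ ^ k * 1) := by
            gcongr; exact pow_le_one₀ (norm_nonneg y) hy.le
        _ = _ := by ring
    gcongr
    exact le_max_left _ _
  · rw [hs y hy, mul_zero, norm_zero, mul_zero]

lemma Hop_int (hn : 3 ≤ n) {D : ℕ} {κ : ℕ → ℝ} {γ : ℝ}
    (hγn : -(n:ℝ) < γ) {R A : ℝ} {g : EE n → ℝ} (hg : Good R A γ g) (hR : R ≤ 1) {x : EE n} (hx : x ≠ 0)
    (hG : Integrable (fun y => |GG D κ x y| * ‖y‖ ^ γ) volume) :
    Integrable (fun y => GG D κ x y * g y) volume ∧ Hop D κ g x = (cN n)⁻¹ * ∫ y, GG D κ x y * g y := by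
  have hgi := hg.int hn hγn
  have hT : ∀ k ∈ Finset.range D, Integrable (fun y => κ k * (TT k x y * g y)) volume := fun k _ =>
    (TTg_int hn k hgi (hg.sup1 hR) hx).const_mul _
  have hTs := integrable_finsetSum _ hT
  have hm : Measurable (fun y => GG D κ x y) := by
    unfold GG
    exact (Gm_meas.comp (by fun_prop)).sub (Finset.measurable_fun_sum _ fun k _ => (TT_meas k x).const_mul _)
  have hGi : Integrable (fun y => GG D κ x y * g y) volume := by
    refine (hG.const_mul |A|).mono' (hm.aestronglyMeasurable.mul hgi.aestronglyMeasurable) (Eventually.of_forall fun y => ?_)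
    rw [norm_mul, Real.norm_eq_abs, Real.norm_eq_abs]
    have : |g y| ≤ |A| * ‖y‖ ^ γ := by
      by_cases hy : y ∈ ball (0 : EE n) R \ {0}
      · exact (hg.bd y hy).trans (mul_le_mul_of_nonneg_right (le_abs_self _) (rpow_nonneg (norm_nonneg y) _))
      · rw [hg.sup y hy, abs_zero]; exact mul_nonneg (abs_nonneg _) (rpow_nonneg (norm_nonneg y) _)
    calc _ ≤ |GG D κ x y| * (|A| * ‖y‖ ^ γ) := mul_le_mul_of_nonneg_left this (abs_nonneg _)
      _ = _ := by ring
  refine ⟨hGi, ?_⟩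
  have e : (fun y => Gm (x - y) * g y) = fun y => GG D κ x y * g y + ∑ k ∈ Finset.range D, κ k * (TT k x y * g y) := by
    ext y
    unfold GG
    rw [sub_mul, Finset.sum_mul]
    simp only [mul_assoc]; ring
  unfold Hop NP Mk
  rw [e, integral_add hGi hTs, integral_finsetSum _ hT]
  simp only [integral_const_mul]
  ring

lemma Hop_bd (hn : 3 ≤ n) {D : ℕ} {κ : ℕ → ℝ} {γ ε : ℝ} (hγn : -(n:ℝ) < γ) {R A : ℝ} {g : EE n → ℝ} (hg : Good R A γ g) (hA : 0 ≤ A)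
    (hR : R ≤ 1)
    (hGG : ∀ x : EE n, x ≠ 0 → Integrable (fun y => |GG D κ x y| * ‖y‖ ^ γ) volume ∧
      ∫ y, |GG D κ x y| * ‖y‖ ^ γ ≤ ε * ‖x‖ ^ (γ+2)) {x : EE n} (hx : x ≠ 0) :
    |Hop D κ g x| ≤ (cN n)⁻¹ * ε * A * ‖x‖ ^ (γ+2) := by
  obtain ⟨h1, h2⟩ := hGG x hx
  obtain ⟨h3, h4⟩ := Hop_int hn hγn hg hR hx h1
  have hc := inv_pos.2 (cN_pos hn)
  rw [h4, abs_mul, abs_of_pos hc]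
  have : |∫ y, GG D κ x y * g y| ≤ A * ∫ y, |GG D κ x y| * ‖y‖ ^ γ := by
    rw [← integral_const_mul, ← Real.norm_eq_abs]
    refine norm_integral_le_of_norm_le (h1.const_mul A) (Eventually.of_forall fun y => ?_)
    rw [norm_mul, Real.norm_eq_abs, Real.norm_eq_abs]
    have : |g y| ≤ A * ‖y‖ ^ γ := by
      by_cases hy : y ∈ ball (0 : EE n) R \ {0}
      · exact hg.bd y hy
      · rw [hg.sup y hy, abs_zero]; exact mul_nonneg hA (rpow_nonneg (norm_nonneg y) _)
    calc _ ≤ |GG D κ x y| * (A * ‖y‖ ^ γ) := mul_le_mul_of_nonneg_left this (abs_nonneg _)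
      _ = _ := by ring
  calc _ ≤ (cN n)⁻¹ * (A * (ε * ‖x‖ ^ (γ+2))) :=
        mul_le_mul_of_nonneg_left (this.trans (mul_le_mul_of_nonneg_left h2 hA)) hc.le
    _ = _ := by ring

lemma Hop_sub (hn : 3 ≤ n) {D : ℕ} {κ : ℕ → ℝ} {γ : ℝ} (hγn : -(n:ℝ) < γ) {R A B : ℝ} {f g : EE n → ℝ}
    (hf : Good R A γ f) (hg : Good R B γ g) (hR : R ≤ 1) {x : EE n} (hx : x ≠ 0)
    (hG : Integrable (fun y => |GG D κ x y| * ‖y‖ ^ γ) volume) :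
    Hop D κ (fun y => f y - g y) x = Hop D κ f x - Hop D κ g x := by
  obtain ⟨a1, a2⟩ := Hop_int hn hγn hf hR hx hG
  obtain ⟨b1, b2⟩ := Hop_int hn hγn hg hR hx hG
  obtain ⟨c1, c2⟩ := Hop_int hn hγn (hf.sub hg) hR hx hG
  rw [a2, b2, c2, ← mul_sub, ← integral_sub a1 b1]
  simp only [mul_sub]

lemma Hop_C1 (hn : 3 ≤ n) {D : ℕ} {κ : ℕ → ℝ} {γ : ℝ} (hγn : -(n:ℝ) < γ) {R A : ℝ} {g : EE n → ℝ}
    (hg : Good R A γ g) (hR : R ≤ 1) (hM : ∀ x ∈ ball (0 : EE n) R \ {0}, ∀ k, ContDiffAt ℝ 2 (Mk k g) x) :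
    ContDiffOn ℝ 1 (Hop D κ g) (ball 0 R \ {0}) := by
  have h1 := newton_C1 hn (OmO R) (fun x hx => ball_subset_ball hR hx.1) (hg.int hn hγn) (hg.sup1 hR) hg.cont
  unfold Hop
  refine contDiffOn_const.mul (h1.sub ?_)
  refine ContDiffOn.sum fun k _ => contDiffOn_const.mul fun x hx => ?_
  exact ((hM x hx k).of_le (by norm_num)).contDiffWithinAt

lemma Hop_C2 (hn : 3 ≤ n) {D : ℕ} {κ : ℕ → ℝ} {γ : ℝ} (hγn : -(n:ℝ) < γ) {R A : ℝ} {g : EE n → ℝ}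
    (hg : Good R A γ g) (hR : R ≤ 1) (hC : ContDiffOn ℝ 1 g (ball 0 R \ {0})) {x : EE n} (hx : x ∈ ball (0 : EE n) R \ {0})
    (hM : ∀ k, ContDiffAt ℝ 2 (Mk k g) x) :
    ContDiffAt ℝ 2 (Hop D κ g) x ∧
      - lapE (Hop D κ g) x = g x - (cN n)⁻¹ * ∑ k ∈ Finset.range D, κ k * (- lapE (Mk k g) x) := by
  obtain ⟨h1, h2⟩ := newton_C2 hn (OmO R) (fun x hx => ball_subset_ball hR hx.1) (hg.int hn hγn) (hg.sup1 hR) hC hx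
  have hs : ∀ k ∈ Finset.range D, ContDiffAt ℝ 2 (fun x => (-κ k) * Mk k g x) x := fun k _ => contDiffAt_const.mul (hM k)
  have hss : ContDiffAt ℝ 2 (fun x => ∑ k ∈ Finset.range D, (-κ k) * Mk k g x) x := ContDiffAt.sum hs
  have e : Hop D κ g = fun x => (cN n)⁻¹ * (NP g x + ∑ k ∈ Finset.range D, (-κ k) * Mk k g x) := by
    ext y; unfold Hop; simp only [neg_mul, Finset.sum_neg_distrib]; ring
  have hc := (cN_pos hn).ne'
  rw [e]
  refine ⟨contDiffAt_const.mul (h1.add hss), ?_⟩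
  rw [lapE_const_mul _ (h1.add hss), lapE_add h1 hss, lapE_sum _ hs, h2]
  have e2 : ∑ k ∈ Finset.range D, lapE (fun x => (-κ k) * Mk k g x) x = ∑ k ∈ Finset.range D, κ k * (- lapE (Mk k g) x) :=
    Finset.sum_congr rfl fun k _ => by rw [lapE_const_mul _ (hM k)]; ring
  rw [e2]
  field_simp
  ring
end P17

section P18
open MeasureTheory Topology
variable {n : ℕ}

def QQ (p K K0 ξ v : ℝ) : ℝ := K * (ξ + v) ^ p - K0 * ξ ^ p - p * K0 * ξ ^ (p-1) * v

lemma rpow_bd (q : ℝ) {a b : ℝ} (ha : 0 < a) : ∃ C, 0 ≤ C ∧ ∀ y ∈ Icc a b, |y ^ q| ≤ C := by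
  have hc : ContinuousOn (fun y : ℝ => y ^ q) (Icc a b) := fun y hy =>
    (Real.continuousAt_rpow_const y q (Or.inl (ha.trans_le hy.1).ne')).continuousWithinAt
  obtain ⟨C, hC⟩ := isCompact_Icc.exists_bound_of_continuousOn hc
  exact ⟨|C|, abs_nonneg _, fun y hy => (hC y hy).trans (le_abs_self _)⟩

lemma rpow_lip (q : ℝ) {a b : ℝ} (ha : 0 < a) : ∃ C, 0 ≤ C ∧ ∀ y ∈ Icc a b, ∀ z ∈ Icc a b, |z ^ q - y ^ q| ≤ C * |z - y| := by
  obtain ⟨C, hC, h⟩ := rpow_bd (q-1) (b := b) ha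
  refine ⟨|q| * C, by positivity, fun y hy z hz => ?_⟩
  refine (convex_Icc a b).norm_image_sub_le_of_norm_hasDerivWithin_le (f := fun y : ℝ => y ^ q) (f' := fun y => q * y ^ (q-1)) ?_ ?_ hy hz
  · intro x hx
    exact (Real.hasDerivAt_rpow_const (Or.inl (ha.trans_le hx.1).ne')).hasDerivWithinAt
  · intro x hx
    rw [norm_mul, Real.norm_eq_abs, Real.norm_eq_abs]
    exact mul_le_mul_of_nonneg_left (h x hx) (abs_nonneg _)

lemma Q_est (p K0 : ℝ) {m B : ℝ} (hm : 0 < m) : ∃ C, 0 < C ∧ ∀ ξ ∈ Icc m B, ∀ K : ℝ,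
    |QQ p K K0 ξ 0| ≤ C * |K - K0| ∧ ∀ v v', |v| ≤ m/2 → |v'| ≤ m/2 →
      |QQ p K K0 ξ v - QQ p K K0 ξ v'| ≤ C * (|K - K0| + |v| + |v'|) * |v - v'| := by
  obtain ⟨C1, hC1, h1⟩ := rpow_bd p (b := B) hm
  obtain ⟨C2, hC2, h2⟩ := rpow_bd (p-1) (a := m/2) (b := B + m/2) (by positivity)
  obtain ⟨C3, hC3, h3⟩ := rpow_lip (p-1) (a := m/2) (b := B + m/2) (by positivity)
  set C := C1 + |p| * C2 + |p| * |K0| * C3 + 1 with hC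
  have c1 : C1 ≤ C := by rw [hC]; have : 0 ≤ |p| * C2 + |p| * |K0| * C3 + 1 := by positivity
                         linarith
  have c2 : |p| * C2 ≤ C := by rw [hC]; have : 0 ≤ C1 + |p| * |K0| * C3 + 1 := by positivity
                               linarith
  have c3 : |p| * |K0| * C3 ≤ C := by rw [hC]; have : 0 ≤ C1 + |p| * C2 + 1 := by positivity
                                      linarith
  refine ⟨C, by positivity, fun ξ hξ K => ⟨?_, fun v v' hv hv' => ?_⟩⟩
  · have : QQ p K K0 ξ 0 = ξ ^ p * (K - K0) := by unfold QQ; rw [add_zero]; ring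
    rw [this, abs_mul]
    exact mul_le_mul_of_nonneg_right ((h1 ξ hξ).trans c1) (abs_nonneg _)
  · have key := (convex_Icc (-(|v| ⊔ |v'|)) (|v| ⊔ |v'|)).norm_image_sub_le_of_norm_hasDerivWithin_le
      (f := fun s => QQ p K K0 ξ s) (f' := fun s => p * K * (ξ + s) ^ (p-1) - p * K0 * ξ ^ (p-1)) (C := C * (|K - K0| + |v| + |v'|))
      (x := v') (y := v) ?_ ?_ ?_ ?_
    · exact key
    · intro s hs
      have hs' : |s| ≤ m/2 := (abs_le.2 hs).trans (max_le hv hv')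
      have hpos : 0 < ξ + s := by have := (abs_le.1 hs').1; have := hξ.1; linarith
      have d1 : HasDerivAt (fun s : ℝ => (ξ + s) ^ p) (p * (ξ + s) ^ (p-1)) s := by
        have := ((hasDerivAt_id s).const_add ξ).rpow_const (p := p) (Or.inl hpos.ne')
        exact this.congr_deriv (by simp)
      have d2 := ((d1.const_mul K).sub_const (K0 * ξ ^ p)).sub ((hasDerivAt_id s).const_mul (p * K0 * ξ ^ (p-1)))
      exact (d2.congr_deriv (by ring)).hasDerivWithinAt
    · intro s hs
      have hs0 : |s| ≤ |v| + |v'| := (abs_le.2 hs).trans (max_le (by linarith [abs_nonneg v']) (by linarith [abs_nonneg v]))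
      have hs' : |s| ≤ m/2 := (abs_le.2 hs).trans (max_le hv hv')
      have hmem : ξ + s ∈ Icc (m/2) (B + m/2) := by
        have := abs_le.1 hs'; exact ⟨by linarith [hξ.1], by linarith [hξ.2]⟩
      have hmem0 : ξ ∈ Icc (m/2) (B + m/2) := ⟨by linarith [hξ.1], by linarith [hξ.2]⟩
      have e : p * K * (ξ + s) ^ (p-1) - p * K0 * ξ ^ (p-1) =
        p * (ξ + s) ^ (p-1) * (K - K0) + p * K0 * ((ξ + s) ^ (p-1) - ξ ^ (p-1)) := by ring
      rw [Real.norm_eq_abs, e]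
      have l := h3 ξ hmem0 (ξ + s) hmem
      rw [add_sub_cancel_left] at l
      calc _ ≤ |p| * |(ξ + s) ^ (p-1)| * |K - K0| + |p| * |K0| * |(ξ + s) ^ (p-1) - ξ ^ (p-1)| := by
            refine (abs_add_le _ _).trans (le_of_eq ?_)
            rw [abs_mul, abs_mul, abs_mul, abs_mul]
        _ ≤ |p| * C2 * |K - K0| + |p| * |K0| * (C3 * |s|) := by
            have := h2 _ hmem
            gcongr
        _ ≤ C * |K - K0| + C * |s| := by
            rw [← mul_assoc]; gcongr
        _ ≤ _ := by rw [← mul_add, add_assoc |K - K0|]; gcongr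
    · exact abs_le.1 (le_max_right |v| |v'|)
    · exact abs_le.1 (le_max_left |v| |v'|)

lemma K_est {K : EE n → ℝ} (hK : ContDiffOn ℝ 1 K (ball (0 : EE n) 1)) {β : ℝ} (hβ : 1 < β)
    (hKgrad : ∃ C > (0 : ℝ), ∃ r > (0 : ℝ), ∀ x : EE n, ‖x‖ < r → ‖fderiv ℝ K x‖ ≤ C * ‖x‖ ^ (β - 1)) :
    ∃ C, 0 < C ∧ ∃ r, 0 < r ∧ r ≤ 1 ∧ ∀ x : EE n, ‖x‖ < r → |K x - K 0| ≤ C * ‖x‖ ^ β := by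
  obtain ⟨C, hC, r, hr, h⟩ := hKgrad
  refine ⟨C, hC, min r 1, by positivity, min_le_right _ _, fun x hx => ?_⟩
  have hx1 : ‖x‖ < r := hx.trans_le (min_le_left _ _)
  have hx2 : ‖x‖ < 1 := hx.trans_le (min_le_right _ _)
  rcases eq_or_ne x 0 with rfl | hx0
  · rw [sub_self, abs_zero]; positivity
  have hp := norm_pos_iff.2 hx0
  have key := (convex_closedBall (0 : EE n) ‖x‖).norm_image_sub_le_of_norm_fderiv_le (𝕜 := ℝ) (f := K) (C := C * ‖x‖ ^ (β - 1)) (x := 0) (y := x)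
    (fun y hy => ?_) (fun y hy => ?_) (by simp) (by simp)
  · rw [sub_zero] at key
    refine key.trans (le_of_eq ?_)
    rw [mul_assoc, ← rpow_add_one hp.ne']; ring_nf
  · have : ‖y‖ < 1 := (mem_closedBall_zero_iff.1 hy).trans_lt hx2
    exact (hK.contDiffAt (isOpen_ball.mem_nhds (mem_ball_zero_iff.2 this))).differentiableAt (by norm_num)
  · have h1 := mem_closedBall_zero_iff.1 hy
    refine (h y (h1.trans_lt hx1)).trans ?_
    gcongr

lemma xi_bd {n : ℕ} {K0 T : ℝ} {ξ : ℝ → ℝ} (hξ : FowlerXi n K0 ξ T) : ∃ m B, 0 < m ∧ ∀ t, ξ t ∈ Icc m B := by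
  obtain ⟨h1, h2, h3, h4, -⟩ := hξ
  have hc := h1.continuous
  obtain ⟨x1, hx1, hm⟩ := isCompact_Icc.exists_isMinOn (nonempty_Icc.2 h3.le) hc.continuousOn
  obtain ⟨x2, hx2, hM⟩ := isCompact_Icc.exists_isMaxOn (nonempty_Icc.2 h3.le) hc.continuousOn
  refine ⟨ξ x1, ξ x2, h2 _, fun t => ?_⟩
  obtain ⟨s, hs, e⟩ := h4.exists_mem_Ico₀ h3 t
  rw [e]
  exact ⟨hm ⟨hs.1, hs.2.le⟩, hM ⟨hs.1, hs.2.le⟩⟩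
end P18

section P19
open MeasureTheory Topology
variable {n : ℕ}

lemma HH_one : HH 0 (fun _ : EE n => (1:ℝ)) := by
  refine ⟨contDiff_const, fun c x => by simp, fun x => ?_⟩
  unfold lapE
  refine Finset.sum_eq_zero fun i _ => ?_
  rw [iteratedFDeriv_const_of_ne (by norm_num)]
  rfl

lemma eta_small {β : ℝ} (hβ : 1 < β) (c1 c2 : ℝ) {d1 d2 : ℝ} (h1 : 0 < d1) (h2 : 0 < d2) :
    ∃ t0 : ℝ, 1 ≤ t0 ∧ ∀ t > t0, c1 * (t ^ 2 * exp (-β * t)) ≤ d1 ∧ c2 * (t ^ 2 * exp (-β * t)) ≤ d2 := by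
  have h := tendsto_rpow_mul_exp_neg_mul_atTop_nhds_zero 2 β (by linarith)
  have e1 := (h.const_mul c1).eventually_lt_const (v := c1 * 0) (u := d1) (by simpa using h1)
  have e2 := (h.const_mul c2).eventually_lt_const (v := c2 * 0) (u := d2) (by simpa using h2)
  obtain ⟨t1, ht1⟩ := (e1.and e2).exists_forall_of_atTop
  refine ⟨max t1 1, le_max_right _ _, fun t ht => ?_⟩
  obtain ⟨a1, a2⟩ := ht1 t ((le_max_left _ _).trans ht.le)
  rw [show t ^ (2:ℝ) = t ^ 2 from rpow_two t] at a1 a2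
  exact ⟨a1.le, a2.le⟩

lemma main_exist (hn : 3 ≤ n) {K : EE n → ℝ} (hK : ContDiffOn ℝ 1 K (ball (0 : EE n) 1)) {β : ℝ} (hβ : 1 < β)
    (hKgrad : ∃ C > (0 : ℝ), ∃ r > (0 : ℝ), ∀ x : EE n, ‖x‖ < r → ‖fderiv ℝ K x‖ ≤ C * ‖x‖ ^ (β - 1))
    {ξ : ℝ → ℝ} {T : ℝ} (hξ : FowlerXi n (K 0) ξ T) {W : ℝ → ℝ}
    (hS : ∀ k : ℕ, Solvable (fun t => ((k:ℝ) + ((n:ℝ)-2)/2)^2 - Vh n (K 0) ξ t) β W)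
    (hW : ∀ t > 1, exp (-β * t) ≤ W t ∧ W t ≤ t * exp (-β * t)) :
    ∃ R : ℝ, 0 < R ∧ R < 1 ∧ ∃ C > (0 : ℝ), ∃ u : EE n → ℝ,
      ContDiffOn ℝ 2 u (ball (0 : EE n) R \ {0}) ∧
      (∀ x ∈ ball (0 : EE n) R \ {0}, 0 < u x) ∧
      (∀ x ∈ ball (0 : EE n) R \ {0}, -lapE u x = K x * u x ^ (((n : ℝ) + 2) / ((n : ℝ) - 2))) ∧
      ∀ x ∈ ball (0 : EE n) R \ {0}, 1 < -Real.log ‖x‖ ∧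
          |u x - ‖x‖ ^ (-(((n : ℝ) - 2) / 2)) * ξ (-Real.log ‖x‖)| ≤ C * (‖x‖ ^ (-(((n : ℝ) - 2) / 2)) * W (-Real.log ‖x‖)) := by
  have hn3 : (3:ℝ) ≤ n := by exact_mod_cast hn
  have hn2 : (n:ℝ) - 2 ≠ 0 := by linarith
  set a : ℝ := ((n:ℝ) - 2) / 2 with ha
  set p : ℝ := ((n:ℝ) + 2) / ((n:ℝ) - 2) with hp
  set K0 : ℝ := K 0 with hK0
  have hap : a * p = a + 2 := by rw [ha, hp]; field_simp; ring
  have hVp : ∀ t, Vh n K0 ξ t = p * K0 * ξ t ^ (p - 1) := fun t => by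
    unfold Vh; rw [hp]; congr 2; field_simp; ring
  obtain ⟨m, B, hm, hmB⟩ := xi_bd hξ
  obtain ⟨CV, hCV, hV⟩ := Vh_bdd hξ
  obtain ⟨CQ, hCQ, hQ⟩ := Q_est p K0 (B := B) hm
  obtain ⟨CK, hCK, rK, hrK, hrK1, hKe⟩ := K_est hK hβ hKgrad
  have hc := cN_pos hn
  set ε : ℝ := cN n / (4 * (CV + 1)) with hε
  have hε0 : 0 < ε := by positivity
  set e : ℝ := (cN n)⁻¹ * ε with he
  have hee : e = 1 / (4 * (CV + 1)) := by rw [he, hε]; field_simp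
  have he0 : 0 < e := by positivity
  have he1 : e ≤ 1 := by
    rw [hee, div_le_one (by positivity)]; linarith
  have heV : CV * e ≤ 1/4 := by
    rw [hee, mul_one_div, div_le_div_iff₀ (by positivity) (by norm_num)]; linarith
  set γ : ℝ := β - a - 2 with hγ
  have hγn : -(n:ℝ) < γ := by rw [hγ, ha]; linarith
  obtain ⟨D, κ, hGG⟩ := estB hn γ hε0
  obtain ⟨CL, hCL, hlow⟩ := low hn hS hγ hγn D κ
  set C1 : ℝ := CL + 1 with hC1
  have hC10 : 0 < C1 := by positivity
  set M : ℝ := 2 * (CQ * CK) with hM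
  have hM0 : 0 < M := by positivity
  set C2 : ℝ := CQ * (CK + 2 * (C1 * M)) * C1 with hC2
  obtain ⟨t0, ht01, ht0⟩ := eta_small hβ (C1 * M) C2 (d1 := m/2) (d2 := 1/4) (by positivity) (by norm_num)
  set R : ℝ := min (exp (-t0)) rK with hR
  have hR0 : 0 < R := lt_min (exp_pos _) hrK
  have hRe : R ≤ exp (-1) := (min_le_left _ _).trans (exp_le_exp.2 (by linarith))
  have hR1 : R < 1 := hRe.trans_lt (by rw [← exp_zero]; exact exp_lt_exp.2 (by norm_num))
  obtain ⟨L, hL, hLsub⟩ := hlow R hR0 hRe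
  set Ω : Set (EE n) := ball (0 : EE n) R \ {0} with hΩ
  have hpos : ∀ x ∈ Ω, 0 < ‖x‖ := fun x hx => norm_pos_iff.2 hx.2
  have hxR : ∀ x ∈ Ω, ‖x‖ < R := fun x hx => mem_ball_zero_iff.1 hx.1
  have htx : ∀ x ∈ Ω, t0 < -Real.log ‖x‖ := fun x hx => by
    have h1 : ‖x‖ < exp (-t0) := (hxR x hx).trans_le (min_le_left _ _)
    have := (Real.log_lt_iff_lt_exp (hpos x hx)).2 h1
    linarith
  have hSx : ∀ x ∈ Ω, exp (-β * -Real.log ‖x‖) = ‖x‖ ^ β := fun x hx => by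
    rw [rpow_def_of_pos (hpos x hx)]; ring_nf
  -- bounds
  have hvb : ∀ g A, 0 ≤ A → Good R A γ g → ∀ x ∈ Ω, |‖x‖ ^ a * Hop D κ g x| ≤ e * A * ‖x‖ ^ β ∧
      |‖x‖ ^ a * (L g x + Hop D κ g x)| ≤ C1 * A * W (-Real.log ‖x‖) := by
    intro g A hA hg x hx
    have hr := hpos x hx
    have h1 := Hop_bd hn hγn hg hA hR1.le hGG hx.2
    have h2 := (hL g A hg x hx).2.2.2
    have h3 : |‖x‖ ^ a * Hop D κ g x| ≤ e * A * ‖x‖ ^ β := by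
      rw [abs_mul, abs_of_pos (rpow_pos_of_pos hr a)]
      calc _ ≤ ‖x‖ ^ a * ((cN n)⁻¹ * ε * A * ‖x‖ ^ (γ + 2)) := by gcongr
        _ = e * A * (‖x‖ ^ a * ‖x‖ ^ (γ + 2)) := by rw [he]; ring
        _ = _ := by rw [← rpow_add hr]; congr 2; rw [hγ]; ring
    refine ⟨h3, ?_⟩
    have h4 : |‖x‖ ^ a * L g x| ≤ CL * A * W (-Real.log ‖x‖) := by
      rw [abs_mul, abs_of_pos (rpow_pos_of_pos hr a)]
      calc _ ≤ ‖x‖ ^ a * (CL * A * (‖x‖ ^ (-a) * W (-Real.log ‖x‖))) := by gcongr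
        _ = CL * A * ((‖x‖ ^ a * ‖x‖ ^ (-a)) * W (-Real.log ‖x‖)) := by ring
        _ = _ := by rw [← rpow_add hr, add_neg_cancel, rpow_zero, one_mul]
    have hSW := (hW _ (ht01.trans_lt (htx x hx))).1
    rw [hSx x hx] at hSW
    rw [mul_add]
    calc _ ≤ CL * A * W (-Real.log ‖x‖) + e * A * ‖x‖ ^ β := (abs_add_le _ _).trans (add_le_add h4 h3)
      _ ≤ CL * A * W (-Real.log ‖x‖) + 1 * A * W (-Real.log ‖x‖) := by gcongr
      _ = _ := by rw [hC1]; ring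
  have hWs : ∀ x ∈ Ω, 0 < W (-Real.log ‖x‖) ∧ W (-Real.log ‖x‖) ≤ (-Real.log ‖x‖) ^ 2 * exp (-β * -Real.log ‖x‖) := by
    intro x hx
    have ht := ht01.trans_lt (htx x hx)
    have h := hW _ ht
    refine ⟨(exp_pos _).trans_le h.1, h.2.trans ?_⟩
    have : -Real.log ‖x‖ ≤ (-Real.log ‖x‖) ^ 2 := by nlinarith
    gcongr
  have hvs : ∀ g, Good R M γ g → ∀ x ∈ Ω, |‖x‖ ^ a * (L g x + Hop D κ g x)| ≤ m / 2 := by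
    intro g hg x hx
    refine ((hvb g M hM0.le hg x hx).2.trans ?_).trans (ht0 _ (htx x hx)).1
    have := (hWs x hx).2
    gcongr
  set v : (EE n → ℝ) → EE n → ℝ := fun g x => ‖x‖ ^ a * (L g x + Hop D κ g x) with hv
  set Ψ : (EE n → ℝ) → EE n → ℝ := fun g x => ‖x‖ ^ (-a - 2) *
    (Vh n K0 ξ (-Real.log ‖x‖) * (‖x‖ ^ a * Hop D κ g x) + QQ p (K x) K0 (ξ (-Real.log ‖x‖)) (v g x)) with hΨ
  -- regularity of Ψ
  have hnorm : ContDiffOn ℝ 1 (fun x : EE n => ‖x‖) Ω := fun x hx =>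
    (contDiffAt_norm ℝ hx.2).contDiffWithinAt
  have hrp : ∀ s : ℝ, ContDiffOn ℝ 1 (fun x : EE n => ‖x‖ ^ s) Ω := fun s =>
    hnorm.rpow_const_of_ne fun x hx => (hpos x hx).ne'
  have hlog : ContDiffOn ℝ 1 (fun x : EE n => -Real.log ‖x‖) Ω :=
    (hnorm.log fun x hx => (hpos x hx).ne').neg
  have hξC : ContDiffOn ℝ 1 (fun x : EE n => ξ (-Real.log ‖x‖)) Ω :=
    (hξ.1.of_le (by norm_num)).comp_contDiffOn hlog
  have hVC : ContDiffOn ℝ 1 (fun x : EE n => Vh n K0 ξ (-Real.log ‖x‖)) Ω := by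
    unfold Vh
    exact contDiffOn_const.mul (hξC.rpow_const_of_ne fun x hx => (hξ.2.1 _).ne')
  have hΩ1 : Ω ⊆ ball 0 1 := fun x hx => ball_subset_ball hR1.le hx.1
  have hHC : ∀ g, Good R M γ g → ContDiffOn ℝ 1 (Hop D κ g) Ω := fun g hg =>
    Hop_C1 hn hγn hg hR1.le fun x hx => (hL g M hg x hx).1
  have hvC : ∀ g, Good R M γ g → ContDiffOn ℝ 1 (v g) Ω := fun g hg => by
    refine (hrp a).mul (ContDiffOn.add (fun x hx => ?_) (hHC g hg))
    exact ((hL g M hg x hx).2.1.of_le (by norm_num)).contDiffWithinAt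
  have hvpos : ∀ g, Good R M γ g → ∀ x ∈ Ω, 0 < ξ (-Real.log ‖x‖) + v g x := fun g hg x hx => by
    have h1 := (abs_le.1 (hvs g hg x hx)).1
    have h2 := (hmB (-Real.log ‖x‖)).1
    simp only [hv]; linarith
  have hΨC : ∀ g, Good R M γ g → ContDiffOn ℝ 1 (Ψ g) Ω := fun g hg => by
    refine (hrp _).mul ((hVC.mul ((hrp a).mul (hHC g hg))).add ?_)
    unfold QQ
    refine (((hK.mono hΩ1).mul ((hξC.add (hvC g hg)).rpow_const_of_ne fun x hx => (hvpos g hg x hx).ne')).sub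
      (contDiffOn_const.mul (hξC.rpow_const_of_ne fun x hx => (hξ.2.1 _).ne'))).sub
      ((contDiffOn_const.mul (hξC.rpow_const_of_ne fun x hx => (hξ.2.1 _).ne')).mul (hvC g hg))
  have hΦC : ∀ g, Good R M γ g → ContDiffOn ℝ 1 (Ω.indicator (Ψ g)) Ω := fun g hg =>
    (hΨC g hg).congr fun x hx => indicator_of_mem hx _
  have hγx : ∀ x ∈ Ω, ‖x‖ ^ (-a - 2) * ‖x‖ ^ β = ‖x‖ ^ γ := fun x hx => by
    rw [← rpow_add (hpos x hx)]; congr 1; rw [hγ]; ring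
  have hKx : ∀ x ∈ Ω, |K x - K0| ≤ CK * ‖x‖ ^ β := fun x hx => hKe x ((hxR x hx).trans_le (min_le_right _ _))
  obtain ⟨g, hg, hfix⟩ := fixpt (R := R) (γ := γ) hM0.le (fun g => Ω.indicator (Ψ g)) (fun g hg => (hΦC g hg).continuousOn)
    (fun g x hx => indicator_of_notMem hx _) (fun x hx => by
      have hr := hpos x hx
      have hz : Good R 0 γ (fun _ : EE n => (0:ℝ)) :=
        ⟨continuousOn_const, fun x hx => by rw [abs_zero, zero_mul], fun _ _ => rfl⟩
      obtain ⟨z1, z2⟩ := hvb _ 0 le_rfl hz x hx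
      rw [mul_zero, zero_mul, abs_nonpos_iff] at z1 z2
      rw [indicator_of_mem hx]
      simp only [hΨ, hv]
      rw [z1, z2, mul_zero, zero_add, abs_mul, abs_of_pos (rpow_pos_of_pos hr _), ← hγx x hx, hM]
      have h1 := (hQ _ (hmB (-Real.log ‖x‖)) (K x)).1
      have h2 := hKx x hx
      calc _ ≤ ‖x‖ ^ (-a - 2) * (CQ * (CK * ‖x‖ ^ β)) := by gcongr; exact h1.trans (by gcongr)
        _ = _ := by ring)
    (fun f g A hf hg hA hfg x hx => by
      have hr := hpos x hx
      have hd : Good R A γ (fun y => f y - g y) := (hf.sub hg).mono_A hfg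
      obtain ⟨d1, d2⟩ := hvb _ A hA hd x hx
      have l1 := hLsub f g M M hf hg x hx
      have l2 := Hop_sub hn hγn hf hg hR1.le hx.2 (hGG x hx.2).1
      have f1 := hvs f hf x hx
      have g1 := hvs g hg x hx
      have f2 := (hvb f M hM0.le hf x hx).2
      have g2 := (hvb g M hM0.le hg x hx).2
      have q := (hQ _ (hmB (-Real.log ‖x‖)) (K x)).2 _ _ f1 g1
      rw [indicator_of_mem hx, indicator_of_mem hx]
      rw [l2] at d1
      rw [l1, l2] at d2
      obtain ⟨w0, w1⟩ := hWs x hx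
      have hwt := (hW _ (ht01.trans_lt (htx x hx)))
      have hη := (ht0 _ (htx x hx)).2
      set t := -Real.log ‖x‖ with ht
      rw [hSx x hx] at hwt hη w1
      have hSp : 0 < ‖x‖ ^ β := rpow_pos_of_pos hr _
      have d2' : |v f x - v g x| ≤ C1 * A * W t := by
        have : v f x - v g x = ‖x‖ ^ a * (L f x - L g x + (Hop D κ f x - Hop D κ g x)) := by simp only [hv]; ring
        rw [this]; exact d2
      have hWW : W t * W t ≤ t ^ 2 * ‖x‖ ^ β * ‖x‖ ^ β := by
        calc W t * W t ≤ (t * ‖x‖ ^ β) * (t * ‖x‖ ^ β) := mul_le_mul hwt.2 hwt.2 w0.le (w0.le.trans hwt.2)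
          _ = _ := by ring
      have hQ1 : |QQ p (K x) K0 (ξ t) (v f x) - QQ p (K x) K0 (ξ t) (v g x)| ≤ 1/4 * A * ‖x‖ ^ β := by
        calc _ ≤ CQ * (|K x - K0| + |v f x| + |v g x|) * |v f x - v g x| := q
          _ ≤ CQ * (CK * W t + C1 * M * W t + C1 * M * W t) * (C1 * A * W t) := by
              gcongr
              exact (hKx x hx).trans (by gcongr; exact hwt.1)
          _ = C2 * A * (W t * W t) := by rw [hC2]; ring
          _ ≤ C2 * A * (t ^ 2 * ‖x‖ ^ β * ‖x‖ ^ β) := by gcongr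
          _ = (C2 * (t ^ 2 * ‖x‖ ^ β)) * (A * ‖x‖ ^ β) := by ring
          _ ≤ 1/4 * (A * ‖x‖ ^ β) := by gcongr
          _ = _ := by ring
      have hV1 : |Vh n K0 ξ t * (‖x‖ ^ a * (Hop D κ f x - Hop D κ g x))| ≤ 1/4 * A * ‖x‖ ^ β := by
        rw [abs_mul]
        calc _ ≤ CV * (e * A * ‖x‖ ^ β) := mul_le_mul (hV t) d1 (abs_nonneg _) hCV
          _ = CV * e * (A * ‖x‖ ^ β) := by ring
          _ ≤ 1/4 * (A * ‖x‖ ^ β) := by gcongr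
          _ = _ := by ring
      have heq : Ψ f x - Ψ g x = ‖x‖ ^ (-a - 2) * (Vh n K0 ξ t * (‖x‖ ^ a * (Hop D κ f x - Hop D κ g x)) +
          (QQ p (K x) K0 (ξ t) (v f x) - QQ p (K x) K0 (ξ t) (v g x))) := by
        simp only [hΨ]; ring
      rw [heq, abs_mul, abs_of_pos (rpow_pos_of_pos hr _), ← hγx x hx]
      calc _ ≤ ‖x‖ ^ (-a - 2) * (1/4 * A * ‖x‖ ^ β + 1/4 * A * ‖x‖ ^ β) := by
            gcongr; exact (abs_add_le _ _).trans (add_le_add hV1 hQ1)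
        _ = _ := by ring)
  -- regularity of g
  have hgC : ContDiffOn ℝ 1 g Ω := (hΦC g hg).congr fun x hx => (hfix x).symm
  have hgv : ∀ x ∈ Ω, g x = Ψ g x := fun x hx => by
    rw [← hfix x]; exact indicator_of_mem hx _
  have hU : ∀ x ∈ Ω, _ := fun x hx => cylF_lap (k := 0) (μ := a) (h := ξ) hx.2 (by simp [ha]) hξ.1.contDiffAt HH_one
  have hH2 : ∀ x ∈ Ω, _ := fun x hx => Hop_C2 (D := D) (κ := κ) hn hγn hg hR1.le hgC hx (hL g M hg x hx).1
  have hueq : ∀ x ∈ Ω, cylF a ξ (fun _ => 1) x + (L g x + Hop D κ g x) = ‖x‖ ^ (-a) * (ξ (-Real.log ‖x‖) + v g x) := fun x hx => by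
    have : ‖x‖ ^ (-a) * ‖x‖ ^ a = 1 := by rw [← rpow_add (hpos x hx), neg_add_cancel, rpow_zero]
    simp only [cylF, hv]
    linear_combination (-(L g x + Hop D κ g x)) * this
  refine ⟨R, hR0, hR1, C1 * M, by positivity, fun x => cylF a ξ (fun _ => 1) x + (L g x + Hop D κ g x), fun x hx => ?_, fun x hx => ?_, fun x hx => ?_, fun x hx => ?_⟩
  · exact ((hU x hx).1.add ((hL g M hg x hx).2.1.add (hH2 x hx).1)).contDiffWithinAt
  · show 0 < cylF a ξ (fun _ => 1) x + (L g x + Hop D κ g x)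
    rw [hueq x hx]
    exact mul_pos (rpow_pos_of_pos (hpos x hx) _) (hvpos g hg x hx)
  · have hr := hpos x hx
    rw [lapE_add (hU x hx).1 ((hL g M hg x hx).2.1.add (hH2 x hx).1), lapE_add (hL g M hg x hx).2.1 (hH2 x hx).1]
    have l1 := (hL g M hg x hx).2.2.1
    have l2 := (hH2 x hx).2
    have l3 := (hU x hx).2
    show -(lapE (cylF a ξ (fun _ => 1)) x + (lapE (L g) x + lapE (Hop D κ g) x)) = K x * (cylF a ξ (fun _ => 1) x + (L g x + Hop D κ g x)) ^ p
    rw [hueq x hx, mul_rpow (rpow_nonneg hr.le _) (hvpos g hg x hx).le, ← rpow_mul hr.le]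
    have hexp : -a * p = -a - 2 := by linarith
    rw [hexp]
    have hode := hξ.2.2.2.2 (-Real.log ‖x‖)
    have hode' : deriv (deriv ξ) (-Real.log ‖x‖) - a ^ 2 * ξ (-Real.log ‖x‖) = - (K0 * ξ (-Real.log ‖x‖) ^ p) := by
      have e1 : a ^ 2 = ((n:ℝ) - 2) ^ 2 / 4 := by rw [ha]; ring
      rw [e1, ← hode]; unfold dtt; ring
    rw [hode', mul_one] at l3
    rw [hgv x hx] at l2
    simp only [hΨ] at l2
    unfold QQ at l2
    rw [← hVp] at l2
    have h2 : ‖x‖ ^ (-2:ℝ) = ‖x‖ ^ (-a - 2) * ‖x‖ ^ a := by rw [← rpow_add hr]; congr 1; ring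
    rw [h2] at l1
    have hvx : v g x = ‖x‖ ^ a * (L g x + Hop D κ g x) := rfl
    linear_combination l1 + l2 - l3 - ‖x‖ ^ (-a - 2) * Vh n K0 ξ (-Real.log ‖x‖) * hvx
  · refine ⟨ht01.trans_lt (htx x hx), ?_⟩
    show |cylF a ξ (fun _ => 1) x + (L g x + Hop D κ g x) - _| ≤ _
    rw [hueq x hx, mul_add, add_sub_cancel_left, abs_mul, abs_of_pos (rpow_pos_of_pos (hpos x hx) _)]
    calc _ ≤ ‖x‖ ^ (-a) * (C1 * M * W (-Real.log ‖x‖)) :=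
          mul_le_mul_of_nonneg_left (hvb g M hM0.le hg x hx).2 (rpow_nonneg (norm_nonneg x) _)
      _ = _ := by ring

theorem statement_9_aux (n : ℕ) (hn : 3 ≤ n)
    (K : EuclideanSpace ℝ (Fin n) → ℝ)
    (hK : ContDiffOn ℝ 1 K (ball (0 : EuclideanSpace ℝ (Fin n)) 1))
    (β : ℝ) (hβ : 1 < β)
    (hKgrad : ∃ C > (0 : ℝ), ∃ r > (0 : ℝ), ∀ x : EuclideanSpace ℝ (Fin n),
      ‖x‖ < r → ‖fderiv ℝ K x‖ ≤ C * ‖x‖ ^ (β - 1))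
    (ξ : ℝ → ℝ) (T : ℝ) (hξ : FowlerXi n (K 0) ξ T)
    (ρ : ℕ → ℝ) (hρ : FowlerExponents n (K 0) ξ T ρ) :
    ∃ R : ℝ, 0 < R ∧ R < 1 ∧ ∃ C > (0 : ℝ), ∃ u : EuclideanSpace ℝ (Fin n) → ℝ,
      ContDiffOn ℝ 2 u (ball (0 : EuclideanSpace ℝ (Fin n)) R \ {0}) ∧
      (∀ x ∈ ball (0 : EuclideanSpace ℝ (Fin n)) R \ {0}, 0 < u x) ∧
      (∀ x ∈ ball (0 : EuclideanSpace ℝ (Fin n)) R \ {0},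
        -lapE u x = K x * u x ^ (((n : ℝ) + 2) / ((n : ℝ) - 2))) ∧
      ((¬ ∃ i : ℕ, 1 ≤ i ∧ ρ i = β) →
        ∀ x ∈ ball (0 : EuclideanSpace ℝ (Fin n)) R \ {0},
          |u x - ‖x‖ ^ (-(((n : ℝ) - 2) / 2)) * ξ (-Real.log ‖x‖)|
            ≤ C * ‖x‖ ^ (β - ((n : ℝ) - 2) / 2)) ∧
      ((∃ i : ℕ, 1 ≤ i ∧ ρ i = β) →
        ∀ x ∈ ball (0 : EuclideanSpace ℝ (Fin n)) R \ {0},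
          |u x - ‖x‖ ^ (-(((n : ℝ) - 2) / 2)) * ξ (-Real.log ‖x‖)|
            ≤ C * ‖x‖ ^ (β - ((n : ℝ) - 2) / 2) * (-Real.log ‖x‖)) := by
  have hSx : ∀ x : EE n, x ≠ 0 → ‖x‖ ^ (-(((n : ℝ) - 2) / 2)) * exp (-β * -Real.log ‖x‖) = ‖x‖ ^ (β - ((n : ℝ) - 2) / 2) := fun x hx => by
    have hr := norm_pos_iff.2 hx
    have : exp (-β * -Real.log ‖x‖) = ‖x‖ ^ β := by rw [rpow_def_of_pos hr]; ring_nf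
    rw [this, ← rpow_add hr]; congr 1; ring
  have hle : ∀ t > (1:ℝ), exp (-β * t) ≤ t * exp (-β * t) := fun t ht => by nlinarith [exp_pos (-β * t)]
  by_cases h : ∃ i : ℕ, 1 ≤ i ∧ ρ i = β
  · obtain ⟨R, h1, h2, C, hC, u, h3, h4, h5, h6⟩ := main_exist hn hK hβ hKgrad hξ
      (fun k => (mode_solv hn hξ hρ hβ k).2) (fun t ht => ⟨hle t ht, le_rfl⟩)
    refine ⟨R, h1, h2, C, hC, u, h3, h4, h5, fun hh => absurd h hh, fun _ x hx => ?_⟩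
    refine (h6 x hx).2.trans (le_of_eq ?_)
    rw [← hSx x hx.2]; ring
  · obtain ⟨R, h1, h2, C, hC, u, h3, h4, h5, h6⟩ := main_exist hn hK hβ hKgrad hξ
      (fun k => (mode_solv hn hξ hρ hβ k).1 h) (fun t ht => ⟨le_rfl, hle t ht⟩)
    refine ⟨R, h1, h2, C, hC, u, h3, h4, h5, fun _ x hx => ?_, fun hh => absurd hh h⟩
    refine (h6 x hx).2.trans (le_of_eq ?_)
    rw [← hSx x hx.2]
end P19

/-- (Corollary 1.7: existence in `x`-coordinates.) -/
theorem statement_9 (n : ℕ) (hn : 3 ≤ n)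
    (K : EuclideanSpace ℝ (Fin n) → ℝ)
    (hK : ContDiffOn ℝ 1 K (ball (0 : EuclideanSpace ℝ (Fin n)) 1))
    (hKpos : ∀ x ∈ ball (0 : EuclideanSpace ℝ (Fin n)) 1, 0 < K x)
    (β : ℝ) (hβ : 1 < β)
    (hKgrad : ∃ C > (0 : ℝ), ∃ r > (0 : ℝ), ∀ x : EuclideanSpace ℝ (Fin n),
      ‖x‖ < r → ‖fderiv ℝ K x‖ ≤ C * ‖x‖ ^ (β - 1))
    (ξ : ℝ → ℝ) (T : ℝ) (hξ : FowlerXi n (K 0) ξ T)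
    (ρ : ℕ → ℝ) (hρ : FowlerExponents n (K 0) ξ T ρ) :
    ∃ R : ℝ, 0 < R ∧ R < 1 ∧ ∃ C > (0 : ℝ), ∃ u : EuclideanSpace ℝ (Fin n) → ℝ,
      ContDiffOn ℝ 2 u (ball (0 : EuclideanSpace ℝ (Fin n)) R \ {0}) ∧
      (∀ x ∈ ball (0 : EuclideanSpace ℝ (Fin n)) R \ {0}, 0 < u x) ∧
      (∀ x ∈ ball (0 : EuclideanSpace ℝ (Fin n)) R \ {0},
        -lapE u x = K x * u x ^ (((n : ℝ) + 2) / ((n : ℝ) - 2))) ∧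
      ((¬ ∃ i : ℕ, 1 ≤ i ∧ ρ i = β) →
        ∀ x ∈ ball (0 : EuclideanSpace ℝ (Fin n)) R \ {0},
          |u x - ‖x‖ ^ (-(((n : ℝ) - 2) / 2)) * ξ (-Real.log ‖x‖)|
            ≤ C * ‖x‖ ^ (β - ((n : ℝ) - 2) / 2)) ∧
      ((∃ i : ℕ, 1 ≤ i ∧ ρ i = β) →
        ∀ x ∈ ball (0 : EuclideanSpace ℝ (Fin n)) R \ {0},
          |u x - ‖x‖ ^ (-(((n : ℝ) - 2) / 2)) * ξ (-Real.log ‖x‖)|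
            ≤ C * ‖x‖ ^ (β - ((n : ℝ) - 2) / 2) * (-Real.log ‖x‖)) := by
  exact statement_9_aux n hn K hK β hβ hKgrad ξ T hξ ρ hρ
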